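/- arXiv:2102.11613 — 6 statements merged into one kernel-verified Lean document; each statement's English description precedes it below -/
import Mathlib

section
/- Let (M,d,μ) be a doubling metric measure space and H_t a kernel with two-sided Gaussian bounds (constants C₀, b₀, b₁), and set b = b₀/b₁. Then for every pair 0 < c₁ < c₂ there exists a constant C > 0 such that for all s > 0, all t ∈ [c₁ s, c₂ s] and all x, y ∈ M one has H_t(x,y) ≤ C · H_{b c₂ s}(x,y); consequently, for every measurable f such that T_{b c₂ s}|f|(x) < ∞, one has |T_t f(x)| ≤ C · T_{b c₂ s}|f|(x). -/
open MeasureTheory Metric Set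

/-- Lemma on comparison of heat kernels at comparable times: with two-sided Gaussian
bounds (constants `C₀, b₀, b₁`) and `b = b₀/b₁`, for every `0 < c₁ < c₂` there is `C > 0`
such that `H_t(x,y) ≤ C H_{b c₂ s}(x,y)` whenever `t ∈ [c₁ s, c₂ s]`, and consequently
`|T_t f(x)| ≤ C T_{b c₂ s}|f|(x)` for measurable `f` with `T_{b c₂ s}|f|(x) < ∞`. -/
theorem stmt_8 {M : Type*} [MetricSpace M] [MeasurableSpace M] (μ : Measure M)
    (c₀ D : ℝ) (hc₀ : 0 < c₀) (hD : 0 < D)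
    (hdoub : ∀ (x : M) (r R : ℝ), 0 < r → 1 ≤ R →
      μ (ball x (R * r)) ≤ ENNReal.ofReal (c₀ * R ^ D) * μ (ball x r))
    (H : ℝ → M → M → ℝ)
    (hHmeas : Measurable fun p : ℝ × M × M => H p.1 p.2.1 p.2.2)
    (hHnonneg : ∀ t x y, 0 < t → 0 ≤ H t x y)
    (C₀ b₀ b₁ : ℝ) (hC₀ : 0 < C₀) (hb₀ : 0 < b₀) (hb₁ : 0 < b₁)
    (hlower : ∀ t x y, 0 < t →
      C₀⁻¹ * Real.exp (-b₀ * dist x y ^ 2 / t) ≤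
        H t x y *
          Real.sqrt
            ((μ (ball x (Real.sqrt t))).toReal * (μ (ball y (Real.sqrt t))).toReal))
    (hupper : ∀ t x y, 0 < t →
      H t x y *
          Real.sqrt
            ((μ (ball x (Real.sqrt t))).toReal * (μ (ball y (Real.sqrt t))).toReal) ≤
        C₀ * Real.exp (-b₁ * dist x y ^ 2 / t))
    (c₁ c₂ : ℝ) (hc₁ : 0 < c₁) (hc₁₂ : c₁ < c₂) :
    ∃ C : ℝ, 0 < C ∧
      (∀ s t x y, 0 < s → t ∈ Icc (c₁ * s) (c₂ * s) →
        H t x y ≤ C * H (b₀ / b₁ * c₂ * s) x y) ∧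
      (∀ s t x, 0 < s → t ∈ Icc (c₁ * s) (c₂ * s) → ∀ f : M → ℝ, Measurable f →
        Integrable (fun y => H (b₀ / b₁ * c₂ * s) x y * |f y|) μ →
        |∫ y, H t x y * f y ∂μ| ≤ C * ∫ y, H (b₀ / b₁ * c₂ * s) x y * |f y| ∂μ) := by
  set R : ℝ := max 1 (Real.sqrt (b₀ / b₁ * c₂ / c₁)) with hR
  have hR1 : 1 ≤ R := le_max_left _ _
  set K : ℝ := c₀ * R ^ D with hK
  have hc₂ : 0 < c₂ := hc₁.trans hc₁₂
  have hKpos : 0 < K := mul_pos hc₀ (Real.rpow_pos_of_pos (by linarith) _)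
  have hVpos : ∀ t x y, 0 < t →
      0 < Real.sqrt
        ((μ (ball x (Real.sqrt t))).toReal * (μ (ball y (Real.sqrt t))).toReal) := by
    intro t x y ht
    have h := hlower t x y ht
    have h2 : 0 < C₀⁻¹ * Real.exp (-b₀ * dist x y ^ 2 / t) := by positivity
    refine lt_of_le_of_ne (Real.sqrt_nonneg _) fun h0 => ?_
    rw [← h0] at h
    linarith
  have hfin : ∀ t x, 0 < t → μ (ball x (Real.sqrt t)) ≠ ⊤ := by
    intro t x ht htop
    have h := hVpos t x x ht
    rw [htop] at h
    simp at h
  have main : ∀ s t x y, 0 < s → t ∈ Icc (c₁ * s) (c₂ * s) →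
        H t x y ≤ (C₀ ^ 2 * K) * H (b₀ / b₁ * c₂ * s) x y := by
    intro s t x y hs ht
    have htpos : 0 < t := lt_of_lt_of_le (mul_pos hc₁ hs) ht.1
    set τ : ℝ := b₀ / b₁ * c₂ * s with hτ
    have hτpos : 0 < τ := by positivity
    have hrad : Real.sqrt τ ≤ R * Real.sqrt t := by
      have h1 : τ ≤ (b₀ / b₁ * c₂ / c₁) * t := by
        calc τ = (b₀ / b₁ * c₂ / c₁) * (c₁ * s) := by rw [hτ]; field_simp
          _ ≤ _ := mul_le_mul_of_nonneg_left ht.1 (by positivity)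
      calc Real.sqrt τ ≤ Real.sqrt ((b₀ / b₁ * c₂ / c₁) * t) := Real.sqrt_le_sqrt h1
        _ = Real.sqrt (b₀ / b₁ * c₂ / c₁) * Real.sqrt t := Real.sqrt_mul (by positivity) _
        _ ≤ _ := mul_le_mul_of_nonneg_right (le_max_right _ _) (Real.sqrt_nonneg _)
    have hvol : ∀ z, (μ (ball z (Real.sqrt τ))).toReal ≤
        K * (μ (ball z (Real.sqrt t))).toReal := by
      intro z
      have h1 := (measure_mono (ball_subset_ball hrad)).trans
        (hdoub z (Real.sqrt t) R (Real.sqrt_pos.2 htpos) hR1)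
      have h2 := ENNReal.toReal_mono
        (ENNReal.mul_ne_top ENNReal.ofReal_ne_top (hfin t z htpos)) h1
      rwa [ENNReal.toReal_mul, ENNReal.toReal_ofReal hKpos.le] at h2
    have hsq : Real.sqrt
          ((μ (ball x (Real.sqrt τ))).toReal * (μ (ball y (Real.sqrt τ))).toReal) ≤
        K * Real.sqrt
          ((μ (ball x (Real.sqrt t))).toReal * (μ (ball y (Real.sqrt t))).toReal) := by
      rw [Real.sqrt_le_left (by positivity), mul_pow, Real.sq_sqrt (by positivity)]
      calc _ ≤ (K * (μ (ball x (Real.sqrt t))).toReal) *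
            (K * (μ (ball y (Real.sqrt t))).toReal) :=
            mul_le_mul (hvol x) (hvol y) ENNReal.toReal_nonneg (by positivity)
        _ = _ := by ring
    have hexp : Real.exp (-b₁ * dist x y ^ 2 / t) ≤ Real.exp (-b₀ * dist x y ^ 2 / τ) := by
      apply Real.exp_le_exp.2
      have h1 : -b₀ * dist x y ^ 2 / τ = -(b₁ * dist x y ^ 2 / (c₂ * s)) := by
        rw [hτ]; field_simp
      have h2 : -b₁ * dist x y ^ 2 / t = -(b₁ * dist x y ^ 2 / t) := by ring
      rw [h1, h2, neg_le_neg_iff]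
      exact div_le_div_of_nonneg_left (by positivity) htpos ht.2
    have hlow := hlower τ x y hτpos
    have hup := hupper t x y htpos
    have hV := hVpos t x y htpos
    have hHn := hHnonneg τ x y hτpos
    refine le_of_mul_le_mul_right ?_ hV
    calc _ ≤ C₀ * Real.exp (-b₁ * dist x y ^ 2 / t) := hup
      _ ≤ C₀ * Real.exp (-b₀ * dist x y ^ 2 / τ) := mul_le_mul_of_nonneg_left hexp hC₀.le
      _ = C₀ ^ 2 * (C₀⁻¹ * Real.exp (-b₀ * dist x y ^ 2 / τ)) := by field_simp
      _ ≤ C₀ ^ 2 * (H τ x y * _) := mul_le_mul_of_nonneg_left hlow (by positivity)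
      _ ≤ C₀ ^ 2 * (H τ x y * _) :=
        mul_le_mul_of_nonneg_left (mul_le_mul_of_nonneg_left hsq hHn) (by positivity)
      _ = _ := by ring
  refine ⟨C₀ ^ 2 * K, by positivity, main, ?_⟩
  intro s t x hs ht f _ hint
  have htpos : 0 < t := lt_of_lt_of_le (mul_pos hc₁ hs) ht.1
  rw [← integral_const_mul, ← Real.norm_eq_abs]
  refine norm_integral_le_of_norm_le (hint.const_mul _) (Filter.Eventually.of_forall fun y => ?_)
  rw [Real.norm_eq_abs, abs_mul, abs_of_nonneg (hHnonneg t x y htpos), ← mul_assoc]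
  exact mul_le_mul_of_nonneg_right (main s t x y hs ht) (abs_nonneg _)
end

section
/- Let (M,d,μ) be a doubling metric measure space and H_t a kernel with two-sided Gaussian bounds. Fix k ∈ ℕ and assume that for each x, y ∈ M the map t ↦ H_t(x,y) is k times differentiable on (0,∞) and that there exist constants C_k, δ_k > 0 with |∂_t^k H_t(x,y)| ≤ C_k t^{-k} (μ(B(x,√t)) μ(B(y,√t)))^{-1/2} exp(-δ_k d(x,y)²/t) for all x, y ∈ M and t > 0. Then there exist constants a_k > 0 and C' > 0 such that |∂_t^k H_t(x,y)| ≤ C' t^{-k} H_{a_k t}(x,y) for all x, y ∈ M and t > 0; consequently, for every measurable f such that T_{a_k t}|f|(x) < ∞, one has |∫_M ∂_t^k H_t(x,y) f(y) dμ(y)| ≤ C' t^{-k} T_{a_k t}|f|(x). -/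
open MeasureTheory Metric Set

/-- Time-derivative heat kernel estimate: under two-sided Gaussian bounds for `H_t` and a
Gaussian upper bound for the `k`-th time derivative `∂_t^k H_t`, there are `a_k, C' > 0`
with `|∂_t^k H_t(x,y)| ≤ C' t^(-k) H_{a_k t}(x,y)`, and consequently
`|∫ ∂_t^k H_t(x,·) f dμ| ≤ C' t^(-k) T_{a_k t}|f|(x)` for measurable `f` with
`T_{a_k t}|f|(x) < ∞`. -/
theorem stmt_9 {M : Type*} [MetricSpace M] [MeasurableSpace M] (μ : Measure M)
    (c₀ D : ℝ) (hc₀ : 0 < c₀) (hD : 0 < D)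
    (hdoub : ∀ (x : M) (r R : ℝ), 0 < r → 1 ≤ R →
      μ (ball x (R * r)) ≤ ENNReal.ofReal (c₀ * R ^ D) * μ (ball x r))
    (H : ℝ → M → M → ℝ)
    (hHmeas : Measurable fun p : ℝ × M × M => H p.1 p.2.1 p.2.2)
    (hHnonneg : ∀ t x y, 0 < t → 0 ≤ H t x y)
    (C₀ b₀ b₁ : ℝ) (hC₀ : 0 < C₀) (hb₀ : 0 < b₀) (hb₁ : 0 < b₁)
    (hlower : ∀ t x y, 0 < t →
      C₀⁻¹ * Real.exp (-b₀ * dist x y ^ 2 / t) ≤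
        H t x y *
          Real.sqrt
            ((μ (ball x (Real.sqrt t))).toReal * (μ (ball y (Real.sqrt t))).toReal))
    (hupper : ∀ t x y, 0 < t →
      H t x y *
          Real.sqrt
            ((μ (ball x (Real.sqrt t))).toReal * (μ (ball y (Real.sqrt t))).toReal) ≤
        C₀ * Real.exp (-b₁ * dist x y ^ 2 / t))
    (k : ℕ)
    (hdiff : ∀ (x y : M) (i : ℕ), i < k →
      DifferentiableOn ℝ (iteratedDerivWithin i (fun s => H s x y) (Ioi 0)) (Ioi 0))
    (Ck δk : ℝ) (hCk : 0 < Ck) (hδk : 0 < δk)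
    (hder : ∀ t x y, 0 < t →
      |iteratedDerivWithin k (fun s => H s x y) (Ioi 0) t| *
          Real.sqrt
            ((μ (ball x (Real.sqrt t))).toReal * (μ (ball y (Real.sqrt t))).toReal) ≤
        Ck * (t ^ k)⁻¹ * Real.exp (-δk * dist x y ^ 2 / t)) :
    ∃ a C' : ℝ, 0 < a ∧ 0 < C' ∧
      (∀ t x y, 0 < t →
        |iteratedDerivWithin k (fun s => H s x y) (Ioi 0) t| ≤
          C' * (t ^ k)⁻¹ * H (a * t) x y) ∧
      (∀ t x, 0 < t → ∀ f : M → ℝ, Measurable f →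
        Integrable (fun y => H (a * t) x y * |f y|) μ →
        |∫ y, iteratedDerivWithin k (fun s => H s x y) (Ioi 0) t * f y ∂μ| ≤
          C' * (t ^ k)⁻¹ * ∫ y, H (a * t) x y * |f y| ∂μ) := by
  set a : ℝ := max 1 (b₀ / δk) with ha
  have ha1 : 1 ≤ a := le_max_left _ _
  have ha0 : 0 < a := by linarith
  have hab : b₀ ≤ δk * a := by
    have h : b₀ / δk ≤ a := le_max_right _ _
    rw [div_le_iff₀ hδk] at h
    linarith
  have hR1 : 1 ≤ Real.sqrt a := by
    rw [Real.one_le_sqrt]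
    exact ha1
  have hRD : 0 < Real.sqrt a ^ D := Real.rpow_pos_of_pos (by linarith) _
  set K : ℝ := c₀ * Real.sqrt a ^ D with hK
  have hK0 : 0 < K := mul_pos hc₀ hRD
  have hS : ∀ t x y, 0 < t → 0 < Real.sqrt
      ((μ (ball x (Real.sqrt t))).toReal * (μ (ball y (Real.sqrt t))).toReal) := by
    intro t x y ht
    have h1 := hlower t x y ht
    have h2 : 0 < C₀⁻¹ * Real.exp (-b₀ * dist x y ^ 2 / t) := by positivity
    refine lt_of_le_of_ne (Real.sqrt_nonneg _) fun h => ?_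
    rw [← h, mul_zero] at h1
    linarith
  have hfin : ∀ t x, 0 < t → μ (ball x (Real.sqrt t)) ≠ ⊤ := by
    intro t x ht h
    have h1 := hS t x x ht
    rw [h] at h1
    simp at h1
  have hV : ∀ t x, 0 < t → (μ (ball x (Real.sqrt (a * t)))).toReal ≤
      K * (μ (ball x (Real.sqrt t))).toReal := by
    intro t x ht
    have h1 := hdoub x (Real.sqrt t) (Real.sqrt a) (Real.sqrt_pos.2 ht) hR1
    rw [← Real.sqrt_mul ha0.le] at h1
    have h2 := ENNReal.toReal_mono (ENNReal.mul_ne_top ENNReal.ofReal_ne_top (hfin t x ht)) h1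
    rwa [ENNReal.toReal_mul, ENNReal.toReal_ofReal hK0.le] at h2
  have hSS : ∀ t x y, 0 < t → Real.sqrt
      ((μ (ball x (Real.sqrt (a * t)))).toReal * (μ (ball y (Real.sqrt (a * t)))).toReal) ≤
      K * Real.sqrt
      ((μ (ball x (Real.sqrt t))).toReal * (μ (ball y (Real.sqrt t))).toReal) := by
    intro t x y ht
    refine Real.sqrt_le_iff.2 ⟨by positivity, ?_⟩
    rw [mul_pow, Real.sq_sqrt (by positivity)]
    calc _ ≤ (K * (μ (ball x (Real.sqrt t))).toReal) * (K * (μ (ball y (Real.sqrt t))).toReal) :=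
          mul_le_mul (hV t x ht) (hV t y ht) (by positivity) (by positivity)
      _ = _ := by ring
  have main : ∀ t x y, 0 < t →
        |iteratedDerivWithin k (fun s => H s x y) (Ioi 0) t| ≤
          (Ck * C₀ * K) * (t ^ k)⁻¹ * H (a * t) x y := by
    intro t x y ht
    have hat : 0 < a * t := mul_pos ha0 ht
    refine le_of_mul_le_mul_right ?_ (hS t x y ht)
    refine (hder t x y ht).trans ?_
    have he : Real.exp (-δk * dist x y ^ 2 / t) ≤ Real.exp (-b₀ * dist x y ^ 2 / (a * t)) := by
      apply Real.exp_le_exp.2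
      rw [div_le_div_iff₀ ht hat]
      have : 0 ≤ (δk * a - b₀) * (dist x y ^ 2 * t) :=
        mul_nonneg (by linarith) (by positivity)
      nlinarith
    have hl := hlower (a * t) x y hat
    rw [inv_mul_le_iff₀ hC₀] at hl
    have h3 : H (a * t) x y * Real.sqrt
        ((μ (ball x (Real.sqrt (a * t)))).toReal * (μ (ball y (Real.sqrt (a * t)))).toReal) ≤
        H (a * t) x y * (K * Real.sqrt
        ((μ (ball x (Real.sqrt t))).toReal * (μ (ball y (Real.sqrt t))).toReal)) :=
      mul_le_mul_of_nonneg_left (hSS t x y ht) (hHnonneg _ x y hat)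
    have h4 := (he.trans hl).trans (mul_le_mul_of_nonneg_left h3 hC₀.le)
    have h5 := mul_le_mul_of_nonneg_left h4 (show 0 ≤ Ck * (t ^ k)⁻¹ by positivity)
    refine h5.trans (le_of_eq ?_)
    ring
  refine ⟨a, Ck * C₀ * K, ha0, by positivity, main, ?_⟩
  intro t x ht f _ hint
  rw [← integral_const_mul, ← Real.norm_eq_abs]
  refine norm_integral_le_of_norm_le (hint.const_mul _) (Filter.Eventually.of_forall fun y => ?_)
  rw [Real.norm_eq_abs, abs_mul, ← mul_assoc]
  exact mul_le_mul_of_nonneg_right (main t x y ht) (abs_nonneg _)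
end

section
/- Let (M,d) be a metric space and μ a Borel measure on M which is doubling with constants c₀ > 0 and D > 0. Then for every n ∈ ℕ and every c > 0 there exists a constant C > 0 such that for all x ∈ M and all t > 0 one has ∫_M (1 + d(x,y))^n exp(-c d(x,y)²/t) dμ(y) ≤ C (1 + √t)^n μ(B(x,√t)). -/
open MeasureTheory Metric Set

/-- Gaussian integral estimate on a doubling metric measure space: for every `n ∈ ℕ` and
`c > 0` there is `C > 0` with
`∫_M (1+d(x,y))^n exp(-c d(x,y)²/t) dμ(y) ≤ C (1+√t)^n μ(B(x,√t))` for all `x` and `t > 0`. -/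
theorem stmt_11 {M : Type*} [MetricSpace M] [MeasurableSpace M] (μ : Measure M)
    (c₀ D : ℝ) (hc₀ : 0 < c₀) (hD : 0 < D)
    (hdoub : ∀ (x : M) (r R : ℝ), 0 < r → 1 ≤ R →
      μ (ball x (R * r)) ≤ ENNReal.ofReal (c₀ * R ^ D) * μ (ball x r))
    (n : ℕ) (c : ℝ) (hc : 0 < c) :
    ∃ C : ℝ, 0 < C ∧ ∀ (x : M) (t : ℝ), 0 < t →
      ∫⁻ y, ENNReal.ofReal ((1 + dist x y) ^ n * Real.exp (-c * dist x y ^ 2 / t)) ∂μ ≤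
        ENNReal.ofReal (C * (1 + Real.sqrt t) ^ n) * μ (ball x (Real.sqrt t)) := by
  have hsum : Summable (fun k : ℕ => ((k : ℝ) + 1) ^ n * Real.exp (-c * (k : ℝ) ^ 2) *
      (c₀ * ((k : ℝ) + 1) ^ D)) := by
    obtain ⟨m, hm⟩ := exists_nat_ge D
    have h1 := Real.summable_pow_mul_exp_neg_nat_mul (n + m) hc
    have h2 := ((summable_nat_add_iff 1).2 h1).mul_left (c₀ * Real.exp c)
    refine Summable.of_nonneg_of_le (fun k => by positivity) (fun k => ?_) h2
    have hk : (1 : ℝ) ≤ (k : ℝ) + 1 := by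
      have : (0 : ℝ) ≤ k := Nat.cast_nonneg k
      linarith
    have e1 : ((k : ℝ) + 1) ^ D ≤ ((k : ℝ) + 1) ^ m := by
      rw [← Real.rpow_natCast]
      exact Real.rpow_le_rpow_of_exponent_le hk hm
    have hkk : (k : ℝ) ≤ (k : ℝ) ^ 2 := by
      exact_mod_cast Nat.le_self_pow (by norm_num) k
    have e2 : Real.exp (-c * (k : ℝ) ^ 2) ≤ Real.exp c * Real.exp (-c * ((k : ℝ) + 1)) := by
      rw [← Real.exp_add]
      apply Real.exp_le_exp.2
      nlinarith
    calc ((k : ℝ) + 1) ^ n * Real.exp (-c * (k : ℝ) ^ 2) * (c₀ * ((k : ℝ) + 1) ^ D)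
        ≤ ((k : ℝ) + 1) ^ n * (Real.exp c * Real.exp (-c * ((k : ℝ) + 1))) *
          (c₀ * ((k : ℝ) + 1) ^ m) := by gcongr
      _ = _ := by
        push_cast
        ring
  have hpos : ∀ k : ℕ, 0 < ((k : ℝ) + 1) ^ n * Real.exp (-c * (k : ℝ) ^ 2) *
      (c₀ * ((k : ℝ) + 1) ^ D) := fun k => by positivity
  refine ⟨∑' k : ℕ, ((k : ℝ) + 1) ^ n * Real.exp (-c * (k : ℝ) ^ 2) *
      (c₀ * ((k : ℝ) + 1) ^ D), hsum.tsum_pos (fun k => (hpos k).le) 0 (hpos 0), ?_⟩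
  intro x t ht
  have hs : 0 < Real.sqrt t := Real.sqrt_pos.2 ht
  have hst : Real.sqrt t ^ 2 = t := Real.sq_sqrt ht.le
  generalize Real.sqrt t = s at hs hst
  subst hst
  let T : ℕ → Set M := fun k => toMeasurable μ (ball x (((k : ℝ) + 1) * s))
  let a : ℕ → ℝ := fun k => (1 + s) ^ n * (((k : ℝ) + 1) ^ n * Real.exp (-c * (k : ℝ) ^ 2))
  have ha : ∀ k, 0 ≤ a k := fun k => by positivity
  have hT : ∀ k, MeasurableSet (T k) := fun k => measurableSet_toMeasurable _ _
  calc ∫⁻ y, ENNReal.ofReal ((1 + dist x y) ^ n * Real.exp (-c * dist x y ^ 2 / s ^ 2)) ∂μ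
      ≤ ∫⁻ y, ∑' k, (T k).indicator (fun _ => ENNReal.ofReal (a k)) y ∂μ := by
        refine lintegral_mono fun y => ?_
        refine le_trans ?_ (ENNReal.le_tsum ⌊dist x y / s⌋₊)
        have hd : 0 ≤ dist x y := dist_nonneg
        have hk1 : (⌊dist x y / s⌋₊ : ℝ) ≤ dist x y / s := Nat.floor_le (by positivity)
        have hk2 : dist x y / s < (⌊dist x y / s⌋₊ : ℝ) + 1 := Nat.lt_floor_add_one _
        generalize ⌊dist x y / s⌋₊ = k at hk1 hk2
        rw [div_lt_iff₀ hs] at hk2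
        have hk0 : (0 : ℝ) ≤ k := Nat.cast_nonneg k
        have hy : y ∈ T k := subset_toMeasurable _ _ (by rwa [mem_ball'])
        rw [indicator_of_mem hy]
        apply ENNReal.ofReal_le_ofReal
        have e1 : 1 + dist x y ≤ (1 + s) * ((k : ℝ) + 1) := by nlinarith
        have e2 : -c * dist x y ^ 2 / s ^ 2 ≤ -c * (k : ℝ) ^ 2 := by
          rw [mul_div_assoc, ← div_pow]
          have : (k : ℝ) ^ 2 ≤ (dist x y / s) ^ 2 := by gcongr
          nlinarith
        calc (1 + dist x y) ^ n * Real.exp (-c * dist x y ^ 2 / s ^ 2)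
            ≤ ((1 + s) * ((k : ℝ) + 1)) ^ n * Real.exp (-c * (k : ℝ) ^ 2) := by gcongr
          _ = a k := by
            simp only [a]
            rw [mul_pow, mul_assoc]
    _ = ∑' k, ENNReal.ofReal (a k) * μ (T k) := by
        rw [lintegral_tsum fun k => (measurable_const.indicator (hT k)).aemeasurable]
        exact tsum_congr fun k => lintegral_indicator_const (hT k) _
    _ ≤ ∑' k : ℕ, ENNReal.ofReal (((k : ℝ) + 1) ^ n * Real.exp (-c * (k : ℝ) ^ 2) *
          (c₀ * ((k : ℝ) + 1) ^ D)) * (ENNReal.ofReal ((1 + s) ^ n) * μ (ball x s)) := by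
        refine ENNReal.tsum_le_tsum fun k => ?_
        have hk : (1 : ℝ) ≤ (k : ℝ) + 1 := by
          have : (0 : ℝ) ≤ k := Nat.cast_nonneg k
          linarith
        have h := hdoub x s ((k : ℝ) + 1) hs hk
        simp only [T]
        rw [measure_toMeasurable]
        refine (mul_le_mul_right h _).trans (le_of_eq ?_)
        rw [← mul_assoc, ← mul_assoc, ← ENNReal.ofReal_mul (ha k),
          ← ENNReal.ofReal_mul (hpos k).le]
        congr 2
        simp only [a]
        ring
    _ = _ := by
        rw [ENNReal.tsum_mul_right, ← ENNReal.ofReal_tsum_of_nonneg (fun k => (hpos k).le) hsum,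
          ← mul_assoc, ← ENNReal.ofReal_mul (tsum_nonneg fun k => (hpos k).le)]
end

section
/- Let (M,d) be a metric space and μ a Borel measure on M which is doubling with constants c₀ > 0 and D > 0 and noncollapsing, i.e. μ(B(x,1)) ≥ c₀^{-1} for every x ∈ M. Then for every n ∈ ℕ, every c > 0 and every r ∈ [1,∞) there exists a constant C > 0 such that for all x ∈ M and t > 0, writing r' for the conjugate exponent of r (1/r + 1/r' = 1), one has ( ∫_M ( (1 + d(x,y))^n μ(B(x,√t))^{-1} exp(-c d(x,y)²/t) )^r dμ(y) )^{1/r} ≤ C t^{-D/(2r')} if 0 < t < 1, and ( ∫_M ( (1 + d(x,y))^n μ(B(x,√t))^{-1} exp(-c d(x,y)²/t) )^r dμ(y) )^{1/r} ≤ C t^{n/2} if t ≥ 1. -/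
open MeasureTheory Metric Set

lemma aux_summable (c₀ D c r : ℝ) (n : ℕ) (hc₀ : 0 < c₀) (hc : 0 < c) (hr : 1 ≤ r) :
    Summable (fun k : ℕ => (((k : ℝ) + 2) ^ n * Real.exp (-c * (k : ℝ) ^ 2)) ^ r
      * (c₀ * ((k : ℝ) + 1) ^ D)) := by
  have hr0 : 0 < r := by linarith
  obtain ⟨P, hP⟩ := exists_nat_ge (n * r)
  obtain ⟨Q, hQ⟩ := exists_nat_ge D
  have h1 := Real.summable_pow_mul_exp_neg_nat_mul (P + Q) (mul_pos hc hr0)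
  have h2 := ((summable_nat_add_iff 2).2 h1).mul_left (c₀ * Real.exp (2 * (c * r)))
  refine Summable.of_nonneg_of_le (fun k => by positivity) (fun k => ?_) h2
  have hk : (0 : ℝ) ≤ k := Nat.cast_nonneg k
  have hk2 : (k : ℝ) ≤ (k : ℝ) ^ 2 := by exact_mod_cast Nat.le_self_pow (by norm_num) k
  have e1 : (((k : ℝ) + 2) ^ n) ^ r ≤ ((k : ℝ) + 2) ^ P := by
    rw [← Real.rpow_natCast, ← Real.rpow_mul (by positivity), ← Real.rpow_natCast]
    exact Real.rpow_le_rpow_of_exponent_le (by linarith) hP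
  have e2 : ((k : ℝ) + 1) ^ D ≤ ((k : ℝ) + 2) ^ Q := by
    calc ((k : ℝ) + 1) ^ D ≤ ((k : ℝ) + 1) ^ (Q : ℝ) :=
          Real.rpow_le_rpow_of_exponent_le (by linarith) hQ
      _ = ((k : ℝ) + 1) ^ Q := Real.rpow_natCast _ _
      _ ≤ _ := by gcongr; norm_num
  have e3 : (Real.exp (-c * (k : ℝ) ^ 2)) ^ r
      ≤ Real.exp (2 * (c * r)) * Real.exp (-(c * r) * ((k + 2 : ℕ) : ℝ)) := by
    rw [← Real.exp_mul, ← Real.exp_add]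
    apply Real.exp_le_exp.2
    push_cast
    nlinarith [mul_le_mul_of_nonneg_left hk2 (mul_pos hc hr0).le]
  rw [Real.mul_rpow (by positivity) (by positivity)]
  calc _ ≤ (((k : ℝ) + 2) ^ P * (Real.exp (2 * (c * r)) *
        Real.exp (-(c * r) * ((k + 2 : ℕ) : ℝ)))) * (c₀ * ((k : ℝ) + 2) ^ Q) := by gcongr
    _ = _ := by push_cast; ring

lemma aux_main {M : Type*} [MetricSpace M] [MeasurableSpace M] (μ : Measure M)
    (c₀ D : ℝ) (hc₀ : 0 < c₀)
    (hdoub : ∀ (x : M) (r R : ℝ), 0 < r → 1 ≤ R →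
      μ (ball x (R * r)) ≤ ENNReal.ofReal (c₀ * R ^ D) * μ (ball x r))
    (n : ℕ) (c r : ℝ) (hc : 0 < c) (hr : 1 ≤ r) (K : ℝ)
    (hK : HasSum (fun k : ℕ => (((k : ℝ) + 2) ^ n * Real.exp (-c * (k : ℝ) ^ 2)) ^ r
      * (c₀ * ((k : ℝ) + 1) ^ D)) K) (x : M) (t m v : ℝ) (ht : 0 < t) (hm : 1 ≤ m)
    (hm' : Real.sqrt t ≤ m) (hv : 0 < v)
    (hV : ENNReal.ofReal v ≤ μ (ball x (Real.sqrt t))) :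
    (∫⁻ y, (ENNReal.ofReal ((1 + dist x y) ^ n * Real.exp (-c * dist x y ^ 2 / t)) *
                (μ (ball x (Real.sqrt t)))⁻¹) ^ r ∂μ) ^ (1 / r) ≤
      ENNReal.ofReal (K ^ (1 / r) * v ^ (-(1 - 1 / r)) * m ^ n) := by
  have hr0 : 0 < r := by linarith
  have hs : 0 < Real.sqrt t := Real.sqrt_pos.2 ht
  have hst : Real.sqrt t ^ 2 = t := Real.sq_sqrt ht.le
  have hd := hdoub x (Real.sqrt t)
  generalize Real.sqrt t = s at *
  have hK0 : 0 ≤ K := hK.nonneg (fun k => by positivity)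
  by_cases htop : μ (ball x s) = ⊤
  · simp [htop, hr0]
  obtain ⟨w, hw0, hw⟩ : ∃ w : ℝ, 0 ≤ w ∧ μ (ball x s) = ENNReal.ofReal w :=
    ⟨_, ENNReal.toReal_nonneg, (ENNReal.ofReal_toReal htop).symm⟩
  rw [hw] at hV hd ⊢
  have hvw : v ≤ w := (ENNReal.ofReal_le_ofReal_iff hw0).1 hV
  have hwp : 0 < w := hv.trans_le hvw
  set b : ℕ → ℝ := fun k => ((k : ℝ) + 2) ^ n * Real.exp (-c * (k : ℝ) ^ 2) with hb
  have hb0 : ∀ k, 0 ≤ b k := fun k => by positivity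
  have hm0 : 0 < m := by linarith
  -- pointwise bound
  have hpt : ∀ y, (ENNReal.ofReal ((1 + dist x y) ^ n * Real.exp (-c * dist x y ^ 2 / t)) *
                (ENNReal.ofReal w)⁻¹) ^ r ≤
      ∑' k : ℕ, (toMeasurable μ (ball x (((k : ℝ) + 1) * s))).indicator
        (fun _ => ENNReal.ofReal ((m ^ n * w⁻¹ * b k) ^ r)) y := by
    intro y
    set k := ⌊dist x y / s⌋₊ with hk
    have hk1 : (k : ℝ) * s ≤ dist x y := by
      rw [← le_div_iff₀ hs]; exact Nat.floor_le (by positivity)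
    have hk2 : dist x y < ((k : ℝ) + 1) * s := by
      rw [← div_lt_iff₀ hs]; exact Nat.lt_floor_add_one _
    refine le_trans ?_ (ENNReal.le_tsum k)
    rw [indicator_of_mem (subset_toMeasurable _ _ (by rw [mem_ball, dist_comm]; exact hk2)),
      ← ENNReal.ofReal_inv_of_pos hwp, ← ENNReal.ofReal_mul (by positivity),
      ENNReal.ofReal_rpow_of_nonneg (by positivity) hr0.le]
    apply ENNReal.ofReal_le_ofReal
    apply Real.rpow_le_rpow (by positivity) _ hr0.le
    have f1 : 1 + dist x y ≤ m * ((k : ℝ) + 2) := by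
      have : ((k : ℝ) + 1) * s ≤ ((k : ℝ) + 1) * m := by gcongr
      nlinarith
    have f2 : -c * dist x y ^ 2 / t ≤ -c * (k : ℝ) ^ 2 := by
      rw [div_le_iff₀ ht, ← hst]
      have : ((k : ℝ) * s) ^ 2 ≤ dist x y ^ 2 := by gcongr
      nlinarith [mul_le_mul_of_nonneg_left this hc.le]
    calc _ ≤ (m * ((k : ℝ) + 2)) ^ n * Real.exp (-c * (k : ℝ) ^ 2) * w⁻¹ := by gcongr
      _ = _ := by rw [hb, mul_pow]; ring
  have hint : (∫⁻ y, (ENNReal.ofReal ((1 + dist x y) ^ n * Real.exp (-c * dist x y ^ 2 / t)) *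
                (ENNReal.ofReal w)⁻¹) ^ r ∂μ) ≤ ENNReal.ofReal ((m ^ n * w⁻¹) ^ r * w * K) := by
    refine (lintegral_mono hpt).trans ?_
    rw [lintegral_tsum (fun k =>
      (measurable_const.indicator (measurableSet_toMeasurable _ _)).aemeasurable)]
    rw [← (hK.mul_left ((m ^ n * w⁻¹) ^ r * w)).tsum_eq, ENNReal.ofReal_tsum_of_nonneg
      (fun k => by have := hb0 k; positivity) (hK.mul_left _).summable]
    refine ENNReal.tsum_le_tsum fun k => ?_
    rw [lintegral_indicator_const (measurableSet_toMeasurable _ _), measure_toMeasurable]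
    have hk := hd ((k : ℝ) + 1) hs (by have : (0:ℝ) ≤ k := Nat.cast_nonneg k
                                       linarith)
    refine (mul_le_mul_right hk _).trans ?_
    have := hb0 k
    rw [← ENNReal.ofReal_mul (by positivity), ← ENNReal.ofReal_mul (by positivity),
      Real.mul_rpow (by positivity) (hb0 k)]
    apply le_of_eq
    congr 1
    ring
  refine (ENNReal.rpow_le_rpow hint (by positivity)).trans ?_
  rw [ENNReal.ofReal_rpow_of_nonneg (by positivity) (by positivity)]
  apply ENNReal.ofReal_le_ofReal
  have hp : 0 ≤ 1 - 1 / r := by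
    rw [sub_nonneg, div_le_one hr0]; exact hr
  have g1 : w⁻¹ * w ^ (1 / r) ≤ v ^ (-(1 - 1 / r)) := by
    rw [← Real.rpow_neg_one, ← Real.rpow_add hwp]
    rw [show -1 + 1 / r = -(1 - 1 / r) by ring]
    exact Real.rpow_le_rpow_of_nonpos hv hvw (by linarith)
  rw [Real.mul_rpow (by positivity) hK0, Real.mul_rpow (by positivity) hw0,
    ← Real.rpow_mul (by positivity), mul_one_div_cancel hr0.ne', Real.rpow_one]
  calc _ = K ^ (1 / r) * (w⁻¹ * w ^ (1 / r)) * m ^ n := by ring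
    _ ≤ _ := by gcongr

/-- `L^r` estimate for the normalized Gaussian kernel on a doubling, noncollapsing metric
measure space: for `n ∈ ℕ`, `c > 0` and `r ∈ [1,∞)`, with `1/r' = 1 - 1/r` the conjugate
exponent, one has `‖(1+d(x,·))^n μ(B(x,√t))⁻¹ e^{-c d(x,·)²/t}‖_r ≤ C t^(-D/(2r'))` for
`0 < t < 1`, and `≤ C t^(n/2)` for `t ≥ 1`. -/
theorem stmt_12 {M : Type*} [MetricSpace M] [MeasurableSpace M] (μ : Measure M)
    (c₀ D : ℝ) (hc₀ : 0 < c₀) (hD : 0 < D)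
    (hdoub : ∀ (x : M) (r R : ℝ), 0 < r → 1 ≤ R →
      μ (ball x (R * r)) ≤ ENNReal.ofReal (c₀ * R ^ D) * μ (ball x r))
    (hnoncol : ∀ x : M, ENNReal.ofReal c₀⁻¹ ≤ μ (ball x 1))
    (n : ℕ) (c r : ℝ) (hc : 0 < c) (hr : 1 ≤ r) :
    ∃ C : ℝ, 0 < C ∧ ∀ (x : M) (t : ℝ),
      (0 < t → t < 1 →
        (∫⁻ y,
            (ENNReal.ofReal ((1 + dist x y) ^ n * Real.exp (-c * dist x y ^ 2 / t)) *
                (μ (ball x (Real.sqrt t)))⁻¹) ^ r ∂μ) ^ (1 / r) ≤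
          ENNReal.ofReal (C * t ^ (-(D / 2) * (1 - 1 / r)))) ∧
      (1 ≤ t →
        (∫⁻ y,
            (ENNReal.ofReal ((1 + dist x y) ^ n * Real.exp (-c * dist x y ^ 2 / t)) *
                (μ (ball x (Real.sqrt t)))⁻¹) ^ r ∂μ) ^ (1 / r) ≤
          ENNReal.ofReal (C * t ^ ((n : ℝ) / 2))) := by
  obtain ⟨K, hK⟩ := aux_summable c₀ D c r n hc₀ hc hr
  have hr0 : 0 < r := by linarith
  have hK0 : 0 ≤ K := hK.nonneg (fun k => by positivity)
  have main := aux_main μ c₀ D hc₀ hdoub n c r hc hr K hK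
  refine ⟨(K ^ (1 / r) + 1) * ((c₀⁻¹) ^ (-(1 - 1 / r)) + (c₀⁻¹ * c₀⁻¹) ^ (-(1 - 1 / r))),
    by positivity, fun x t => ⟨fun ht ht1 => ?_, fun ht => ?_⟩⟩
  · have hs : 0 < Real.sqrt t := Real.sqrt_pos.2 ht
    have hs1 : Real.sqrt t ≤ 1 := Real.sqrt_le_one.2 ht1.le
    have hsD : Real.sqrt t ^ D = t ^ (D / 2) := by
      rw [Real.sqrt_eq_rpow, ← Real.rpow_mul ht.le]; congr 1; ring
    have hV : ENNReal.ofReal (c₀⁻¹ * c₀⁻¹ * t ^ (D / 2)) ≤ μ (ball x (Real.sqrt t)) := by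
      have h := (hnoncol x).trans
        (by simpa [hs.ne'] using hdoub x (Real.sqrt t) (Real.sqrt t)⁻¹ hs ((one_le_inv₀ hs).2 hs1))
      rw [Real.inv_rpow hs.le, hsD] at h
      have h2 := mul_le_mul_right h (ENNReal.ofReal (c₀⁻¹ * t ^ (D / 2)))
      rw [← mul_assoc, ← ENNReal.ofReal_mul (by positivity),
        ← ENNReal.ofReal_mul (by positivity)] at h2
      have e : c₀⁻¹ * t ^ (D / 2) * (c₀ * (t ^ (D / 2))⁻¹) = 1 := by
        have : t ^ (D / 2) ≠ 0 := by positivity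
        field_simp
      rw [e, ENNReal.ofReal_one, one_mul] at h2
      rw [show c₀⁻¹ * c₀⁻¹ * t ^ (D / 2) = c₀⁻¹ * t ^ (D / 2) * c₀⁻¹ by ring]
      exact h2
    refine (main x t 1 _ ht le_rfl hs1 (by positivity) hV).trans (ENNReal.ofReal_le_ofReal ?_)
    rw [Real.mul_rpow (by positivity) (by positivity), ← Real.rpow_mul ht.le, one_pow, mul_one,
      show D / 2 * -(1 - 1 / r) = -(D / 2) * (1 - 1 / r) by ring, ← mul_assoc]
    gcongr
    · linarith
    · have : 0 < (c₀⁻¹) ^ (-(1 - 1 / r)) := by positivity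
      linarith
  · have ht0 : 0 < t := by linarith
    have hs1 : 1 ≤ Real.sqrt t := Real.one_le_sqrt.2 ht
    have hV : ENNReal.ofReal c₀⁻¹ ≤ μ (ball x (Real.sqrt t)) :=
      (hnoncol x).trans (measure_mono (ball_subset_ball hs1))
    refine (main x t _ _ ht0 hs1 le_rfl (by positivity) hV).trans (ENNReal.ofReal_le_ofReal ?_)
    have e : Real.sqrt t ^ n = t ^ ((n : ℝ) / 2) := by
      rw [Real.sqrt_eq_rpow, ← Real.rpow_natCast, ← Real.rpow_mul ht0.le]; congr 1; ring
    rw [e]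
    gcongr
    · linarith
    · have : 0 < (c₀⁻¹ * c₀⁻¹) ^ (-(1 - 1 / r)) := by positivity
      linarith
end

section
/- Let (M,d,μ) be a doubling metric measure space and H_t a symmetric Markovian kernel satisfying the Chapman–Kolmogorov identity and two-sided Gaussian bounds. Let p ∈ (1,∞), q ∈ [1,∞] and 0 < c₁ < c₂. Then there exists a constant C > 0 such that for every sequence (t_j)_{j∈ℤ} of measurable functions t_j : M → ℝ with c₁ 2^j ≤ t_j(x) ≤ c₂ 2^j for all j ∈ ℤ and x ∈ M, and every sequence (f_j)_{j∈ℤ} of measurable functions on M, one has ‖ (Σ_{j∈ℤ} |T_{t_j(x)} f_j(x)|^q)^{1/q} ‖_{L^p(μ)} ≤ C ‖ (Σ_{j∈ℤ} |f_j|^q)^{1/q} ‖_{L^p(μ)} (with the sup over j replacing the ℓ^q sum when q = ∞), the inequality being understood in [0,∞]. -/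
open MeasureTheory Metric Set

/-- The `ℓ^q` norm of a `ℤ`-indexed family in `[0,∞]`, with the supremum when `q = ∞`. -/
noncomputable def zlqNorm (q : ENNReal) (f : ℤ → ENNReal) : ENNReal :=
  if q = ⊤ then ⨆ j, f j else (∑' j, f j ^ q.toReal) ^ (1 / q.toReal)


namespace HeatFS

/-- Absorption. -/
theorem absorb {p p' : ℝ} (h : p.HolderConjugate p') {Y c : ENNReal} (hY : Y ≠ ⊤)
    (hle : Y ≤ c * Y ^ (1 / p')) : Y ≤ c ^ p := by
  rcases eq_or_ne Y 0 with h0 | h0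
  · simp [h0]
  have hp := h.pos
  have e : Y = Y ^ (1 / p) * Y ^ (1 / p') := by
    rw [← ENNReal.rpow_add _ _ h0 hY, one_div, one_div, h.inv_add_inv_eq_one, ENNReal.rpow_one]
  have h1 : Y ^ (1 / p') ≠ 0 := by
    simp [ENNReal.rpow_eq_zero_iff, h0, hY]
  have h2 : Y ^ (1 / p') ≠ ⊤ := by
    simp [ENNReal.rpow_eq_top_iff, h0, hY]
  have h3 : Y ^ (1 / p) ≤ c := by
    rw [← ENNReal.mul_le_mul_iff_left h1 h2, ← e]
    exact hle
  calc Y = (Y ^ (1 / p)) ^ p := by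
        rw [← ENNReal.rpow_mul, one_div, inv_mul_cancel₀ hp.ne', ENNReal.rpow_one]
    _ ≤ c ^ p := ENNReal.rpow_le_rpow h3 hp.le

theorem add_rpow_le {p : ℝ} (hp : 1 < p) (a S : ENNReal) :
    (a + S) ^ p ≤ S ^ p + ENNReal.ofReal p * (a * (a + S) ^ (p - 1)) := by
  have hp0 : 0 < p := by linarith
  rcases eq_or_ne S ⊤ with hS | hS
  · simp [hS, ENNReal.top_rpow_of_pos hp0]
  rcases eq_or_ne a ⊤ with ha | ha
  · have : 0 < p - 1 := by linarith
    simp [ha, ENNReal.top_rpow_of_pos hp0, ENNReal.top_rpow_of_pos this, ENNReal.mul_top, hp0]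
  lift a to NNReal using ha
  lift S to NNReal using hS
  have key : ((a : ℝ) + S) ^ p ≤ (S : ℝ) ^ p + p * (a * ((a : ℝ) + S) ^ (p - 1)) := by
    rcases eq_or_lt_of_le (show (0 : ℝ) ≤ (a : ℝ) + S by positivity) with h0 | h0
    · rw [← h0, Real.zero_rpow hp0.ne']
      have : (0 : ℝ) ≤ (0 : ℝ) ^ (p - 1) := by positivity
      positivity
    have hs : (-1 : ℝ) ≤ -(a / ((a : ℝ) + S)) := by
      rw [neg_le_neg_iff, div_le_one h0]
      simp
    have hb := one_add_mul_self_le_rpow_one_add hs hp.le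
    have e1 : 1 + -((a : ℝ) / ((a : ℝ) + S)) = S / ((a : ℝ) + S) := by
      field_simp
      ring
    rw [e1, Real.div_rpow (NNReal.coe_nonneg S) h0.le, le_div_iff₀ (by positivity)] at hb
    have e2 : ((a : ℝ) + S) ^ p = ((a : ℝ) + S) ^ (p - 1) * ((a : ℝ) + S) := by
      conv_rhs => rw [← Real.rpow_add_one h0.ne']
      congr 1
      ring
    have e3 : (1 + p * -((a : ℝ) / ((a : ℝ) + S))) * ((a : ℝ) + S) ^ p
        = ((a : ℝ) + S) ^ p - p * (a * ((a : ℝ) + S) ^ (p - 1)) := by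
      rw [e2]
      field_simp
      ring
    rw [e3] at hb
    linarith [hb]
  rw [← ENNReal.coe_add, ← ENNReal.coe_rpow_of_nonneg _ hp0.le,
    ← ENNReal.coe_rpow_of_nonneg _ hp0.le, ← ENNReal.coe_rpow_of_nonneg _ (by linarith : 0 ≤ p - 1),
    ENNReal.ofReal, ← ENNReal.coe_mul, ← ENNReal.coe_mul, ← ENNReal.coe_add, ENNReal.coe_le_coe,
    ← NNReal.coe_le_coe]
  push_cast
  rw [Real.coe_toNNReal _ hp0.le]
  exact key

theorem sum_rpow_le {p : ℝ} (hp : 1 < p) (J : Finset ℤ) (a : ℤ → ENNReal) :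
    (∑ j ∈ J, a j) ^ p ≤
      ENNReal.ofReal p * ∑ j ∈ J, a j * (∑ i ∈ J with j ≤ i, a i) ^ (p - 1) := by
  induction J using Finset.induction_on_min with
  | empty => simp [ENNReal.zero_rpow_of_pos (by linarith : 0 < p)]
  | insert b s hb ih =>
    have hbs : b ∉ s := fun h => lt_irrefl _ (hb b h)
    rw [Finset.sum_insert hbs, Finset.sum_insert hbs, mul_add]
    refine (add_rpow_le hp _ _).trans ?_
    rw [add_comm]
    have e1 : (∑ i ∈ insert b s with b ≤ i, a i) = a b + ∑ i ∈ s, a i := by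
      rw [Finset.filter_true_of_mem, Finset.sum_insert hbs]
      intro x hx
      rcases Finset.mem_insert.1 hx with rfl | h
      · exact le_rfl
      · exact (hb x h).le
    rw [e1]
    gcongr
    refine ih.trans ?_
    gcongr with j hj
    exact Finset.subset_insert _ _

section
variable {M : Type*} [MeasurableSpace M] (μ : Measure M)

/-- The integral operator. -/
noncomputable def TK (k : M → M → ENNReal) (g : M → ENNReal) (x : M) : ENNReal :=
  ∫⁻ y, k x y * g y ∂μ

variable {μ}

theorem TK_meas [SFinite μ] {k : M → M → ENNReal} (hk : Measurable fun z : M × M => k z.1 z.2)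
    {g : M → ENNReal} (hg : Measurable g) : Measurable (TK μ k g) :=
  Measurable.lintegral_prod_right' (f := fun z : M × M => k z.1 z.2 * g z.2)
    (hk.mul (hg.comp measurable_snd))

theorem TK_dual [SFinite μ] {k : M → M → ENNReal} (hk : Measurable fun z : M × M => k z.1 z.2)
    {g h : M → ENNReal} (hg : Measurable g) (hh : Measurable h) :
    ∫⁻ x, TK μ k g x * h x ∂μ = ∫⁻ y, g y * ∫⁻ x, k x y * h x ∂μ ∂μ := by
  have h1 : ∀ x, TK μ k g x * h x = ∫⁻ y, k x y * g y * h x ∂μ := fun x => by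
    have hm : Measurable fun y => k x y * g y := (hk.comp measurable_prodMk_left).mul hg
    rw [TK, lintegral_mul_const _ hm]
  have h2 : ∀ y, g y * ∫⁻ x, k x y * h x ∂μ = ∫⁻ x, k x y * g y * h x ∂μ := fun y => by
    have hm : Measurable fun x => k x y * h x := (hk.comp measurable_prodMk_right).mul hh
    rw [← lintegral_const_mul _ hm]
    congr 1
    ext x
    ring
  simp_rw [h1, h2]
  apply lintegral_lintegral_swap
  exact ((hk.mul (hg.comp measurable_snd)).mul (hh.comp measurable_fst)).aemeasurable

theorem TK_dual' [SFinite μ] {k : M → M → ENNReal} (hk : Measurable fun z : M × M => k z.1 z.2)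
    (hs : ∀ x y, k x y = k y x)
    {g h : M → ENNReal} (hg : Measurable g) (hh : Measurable h) :
    ∫⁻ x, TK μ k g x * h x ∂μ = ∫⁻ y, g y * TK μ k h y ∂μ := by
  rw [TK_dual hk hg hh]
  refine lintegral_congr fun y => ?_
  congr 1
  refine lintegral_congr fun x => ?_
  rw [hs]

theorem TK_jensen {k : M → M → ENNReal} (hk : Measurable fun z : M × M => k z.1 z.2)
    (h1 : ∀ x, ∫⁻ y, k x y ∂μ = 1) {g : M → ENNReal} (hg : Measurable g) {p : ℝ} (hp : 1 ≤ p)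
    (x : M) : TK μ k g x ^ p ≤ TK μ k (fun y => g y ^ p) x := by
  rcases eq_or_lt_of_le hp with rfl | hp
  · simp
  have hkx : Measurable (k x) := hk.comp measurable_prodMk_left
  have hc := Real.HolderConjugate.conjExponent hp
  have hp0 := hc.pos
  have e : ∀ f : M → ENNReal, Measurable f → TK μ k f x = ∫⁻ y, f y ∂(μ.withDensity (k x)) := by
    intro f hf
    rw [lintegral_withDensity_eq_lintegral_mul _ hkx hf]
    rfl
  rw [e g hg, e _ (hg.pow_const p)]
  have := ENNReal.lintegral_mul_le_Lp_mul_Lq (μ.withDensity (k x)) hc hg.aemeasurable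
    (g := fun _ => 1) aemeasurable_const
  have hu : (μ.withDensity (k x)) univ = 1 := by
    rw [withDensity_apply _ MeasurableSet.univ, Measure.restrict_univ, h1]
  simp only [Pi.mul_apply, mul_one, ENNReal.one_rpow, lintegral_const, hu] at this
  calc _ ≤ ((∫⁻ y, g y ^ p ∂(μ.withDensity (k x))) ^ (1 / p)) ^ p :=
        ENNReal.rpow_le_rpow this hp0.le
    _ = _ := by rw [← ENNReal.rpow_mul, one_div, inv_mul_cancel₀ hp0.ne', ENNReal.rpow_one]

theorem TK_lint [SFinite μ] {k : M → M → ENNReal} (hk : Measurable fun z : M × M => k z.1 z.2)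
    (hs : ∀ x y, k x y = k y x)
    (h1 : ∀ x, ∫⁻ y, k x y ∂μ = 1) {g : M → ENNReal} (hg : Measurable g) :
    ∫⁻ x, TK μ k g x ∂μ = ∫⁻ x, g x ∂μ := by
  have := TK_dual' (μ := μ) hk hs hg (h := fun _ => 1) measurable_const
  simpa [TK, h1] using this

theorem TK_apriori [SFinite μ] {K : ℤ → M → M → ENNReal}
    (hk : ∀ j, Measurable fun z : M × M => K j z.1 z.2)
    (hs : ∀ j x y, K j x y = K j y x)
    (h1 : ∀ j x, ∫⁻ y, K j x y ∂μ = 1) {p : ℝ} (hp : 1 ≤ p) (J : Finset ℤ) (s : ℤ → ℤ)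
    {g : ℤ → M → ENNReal} (hg : ∀ j, Measurable (g j)) :
    ∫⁻ x, (∑ j ∈ J, TK μ (K (s j)) (g j) x) ^ p ∂μ ≤
      (J.card : ENNReal) ^ (p - 1) * ∑ j ∈ J, ∫⁻ x, g j x ^ p ∂μ := by
  have hm : ∀ j, Measurable (TK μ (K (s j)) (fun y => g j y ^ p)) :=
    fun j => TK_meas (hk _) ((hg j).pow_const p)
  calc _ ≤ ∫⁻ x, (J.card : ENNReal) ^ (p - 1) *
          ∑ j ∈ J, TK μ (K (s j)) (fun y => g j y ^ p) x ∂μ := by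
        apply lintegral_mono
        intro x
        refine (ENNReal.rpow_sum_le_const_mul_sum_rpow _ _ hp).trans ?_
        refine mul_le_mul_right (Finset.sum_le_sum fun j hj => ?_) _
        exact TK_jensen (hk _) (h1 _) (hg j) hp x
    _ = _ := by
        rw [lintegral_const_mul _ (Finset.measurable_sum _ fun j _ => hm j),
          lintegral_finsetSum _ fun j _ => hm j]
        congr 1
        refine Finset.sum_congr rfl fun j _ => ?_
        exact TK_lint (hk _) (hs _) (h1 _) ((hg j).pow_const p)

/-- comparison hypothesis -/
def Comp (μ : Measure M) (K : ℤ → M → M → ENNReal) : Prop :=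
  ∀ r : ℝ, 0 < r → ∃ (k : ℤ) (C : ENNReal), C ≠ ⊤ ∧
    ∀ (J : Finset ℤ) (g : ℤ → M → ENNReal) (m j : ℤ) (y : M), (∀ i ∈ J, j ≤ i) →
      ∫⁻ x, K (j + m) x y * (∑ i ∈ J, TK μ (K (i + m)) (g i) x) ^ r ∂μ ≤
        C * (∑ i ∈ J, TK μ (K (i + (m + k))) (g i) y) ^ r

/-- The case `q = 1`. -/
theorem q_one [SFinite μ] {K : ℤ → M → M → ENNReal}
    (hk : ∀ j, Measurable fun z : M × M => K j z.1 z.2)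
    (hs : ∀ j x y, K j x y = K j y x)
    (h1 : ∀ j x, ∫⁻ y, K j x y ∂μ = 1) (hcomp : Comp μ K) {p : ℝ} (hp : 1 ≤ p) :
    ∃ C : ENNReal, C ≠ ⊤ ∧ ∀ (J : Finset ℤ) (g : ℤ → M → ENNReal), (∀ j, Measurable (g j)) →
      ∫⁻ x, (∑ j ∈ J, TK μ (K j) (g j) x) ^ p ∂μ ≤ C * ∫⁻ x, (∑ j ∈ J, g j x) ^ p ∂μ := by
  rcases eq_or_lt_of_le hp with rfl | hp1
  · refine ⟨1, by simp, fun J g hg => ?_⟩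
    simp only [ENNReal.rpow_one, one_mul]
    rw [lintegral_finsetSum _ fun j _ => hg j,
      lintegral_finsetSum _ fun j _ => TK_meas (hk j) (hg j)]
    exact (Finset.sum_congr rfl fun j _ => TK_lint (hk _) (hs _) (h1 _) (hg j)).le
  obtain ⟨k, C, hC, hcomp⟩ := hcomp (p - 1) (by linarith)
  have hc := Real.HolderConjugate.conjExponent hp1
  set p' := p.conjExponent
  have hp0 := hc.pos
  refine ⟨(ENNReal.ofReal p * C) ^ p + 1, ?_, fun J g hg => ?_⟩
  · finiteness
  set X := ∫⁻ x, (∑ j ∈ J, g j x) ^ p ∂μ with hX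
  rcases eq_or_ne X ⊤ with hXt | hXt
  · rw [hXt, ENNReal.mul_top (by simp)]
    exact le_top
  let a : ℕ → ENNReal := fun m => ∫⁻ x, (∑ j ∈ J, TK μ (K (j + m * k)) (g j) x) ^ p ∂μ
  have step : ∀ m, a m ≤ (ENNReal.ofReal p * C * X ^ (1 / p)) * a (m + 1) ^ (1 / p') := by
    intro m
    have mS : ∀ (j : ℤ), Measurable (fun x => (∑ i ∈ J with j ≤ i, TK μ (K (i + m * k)) (g i) x) ^ (p - 1)) :=
      fun j => (Finset.measurable_sum _ fun i _ => TK_meas (hk _) (hg i)).pow_const _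
    have mS' : Measurable (fun x => (∑ i ∈ J, TK μ (K (i + (m * k + k))) (g i) x)) :=
      (Finset.measurable_sum _ fun i _ => TK_meas (hk _) (hg i))
    have mG : Measurable (fun x => ∑ j ∈ J, g j x) := Finset.measurable_sum _ fun i _ => hg i
    calc a m ≤ ∫⁻ x, ENNReal.ofReal p * ∑ j ∈ J, TK μ (K (j + m * k)) (g j) x *
          (∑ i ∈ J with j ≤ i, TK μ (K (i + m * k)) (g i) x) ^ (p - 1) ∂μ :=
          lintegral_mono fun x => sum_rpow_le hp1 J _
      _ = ENNReal.ofReal p * ∑ j ∈ J, ∫⁻ x, TK μ (K (j + m * k)) (g j) x *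
          (∑ i ∈ J with j ≤ i, TK μ (K (i + m * k)) (g i) x) ^ (p - 1) ∂μ := by
          rw [lintegral_const_mul, lintegral_finsetSum]
          · exact fun j _ => (TK_meas (hk _) (hg j)).mul (mS j)
          · exact Finset.measurable_sum _ fun j _ => (TK_meas (hk _) (hg j)).mul (mS j)
      _ ≤ ENNReal.ofReal p * ∑ j ∈ J, ∫⁻ y, C * (g j y *
          (∑ i ∈ J, TK μ (K (i + (m * k + k))) (g i) y) ^ (p - 1)) ∂μ := by
          refine mul_le_mul_right (Finset.sum_le_sum fun j hj => ?_) _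
          rw [TK_dual (hk _) (hg j) (mS j)]
          apply lintegral_mono
          intro y
          dsimp only
          rw [mul_left_comm]
          gcongr
          refine (hcomp _ g (m * k) j y (by simp)).trans ?_
          have : 0 ≤ p - 1 := by linarith
          gcongr
          simp
      _ = ENNReal.ofReal p * (C * ∫⁻ y, (∑ j ∈ J, g j y) *
          (∑ i ∈ J, TK μ (K (i + (m * k + k))) (g i) y) ^ (p - 1) ∂μ) := by
          congr 1
          have hm : Measurable fun y => (∑ j ∈ J, g j y) *
            (∑ i ∈ J, TK μ (K (i + (m * k + k))) (g i) y) ^ (p - 1) := mG.mul (mS'.pow_const _)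
          rw [← lintegral_finsetSum, ← lintegral_const_mul _ hm]
          · congr 1
            ext y
            rw [← Finset.mul_sum, ← Finset.sum_mul]
          · exact fun j _ => ((hg j).mul (mS'.pow_const _)).const_mul _
      _ ≤ ENNReal.ofReal p * (C * (X ^ (1 / p) * a (m + 1) ^ (1 / p'))) := by
          gcongr
          refine (ENNReal.lintegral_mul_le_Lp_mul_Lq μ hc mG.aemeasurable
            (mS'.pow_const (p - 1)).aemeasurable).trans ?_
          refine mul_le_mul_right (le_of_eq ?_) _
          congr 1
          refine lintegral_congr fun x => ?_
          rw [← ENNReal.rpow_mul, hc.sub_one_mul_conj]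
          congr 3
          ext i
          push_cast
          ring_nf
      _ = _ := by ring
  have hab : ∀ m, a m ≤ (J.card : ENNReal) ^ (p - 1) * ∑ j ∈ J, ∫⁻ x, g j x ^ p ∂μ :=
    fun m => TK_apriori hk hs h1 hp J (fun j => j + m * k) hg
  have hfin : ⨆ m, a m ≠ ⊤ := by
    refine ne_top_of_le_ne_top ?_ (iSup_le hab)
    refine ENNReal.mul_ne_top (ENNReal.rpow_ne_top_of_nonneg (by linarith) (by simp)) ?_
    rw [ENNReal.sum_ne_top]
    intro j hj
    refine ne_top_of_le_ne_top hXt (lintegral_mono fun x => ?_)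
    dsimp only
    gcongr
    exact Finset.single_le_sum (f := fun j => g j x) (by simp) hj
  have hsup : ⨆ m, a m ≤ (ENNReal.ofReal p * C * X ^ (1 / p)) * (⨆ m, a m) ^ (1 / p') := by
    refine iSup_le fun m => (step m).trans ?_
    have := hc.symm.pos
    gcongr
    exact le_iSup a (m + 1)
  have hfinal := absorb hc hfin hsup
  have h0 : ∫⁻ x, (∑ j ∈ J, TK μ (K j) (g j) x) ^ p ∂μ = a 0 := by simp [a]
  rw [h0]
  refine (le_iSup a 0).trans (hfinal.trans ?_)
  rw [ENNReal.mul_rpow_of_nonneg _ _ hp0.le, ← ENNReal.rpow_mul, one_div,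
    inv_mul_cancel₀ hp0.ne', ENNReal.rpow_one]
  gcongr
  simp

/-- The case `q ≤ p`. -/
theorem q_le [SFinite μ] {K : ℤ → M → M → ENNReal}
    (hk : ∀ j, Measurable fun z : M × M => K j z.1 z.2)
    (hs : ∀ j x y, K j x y = K j y x)
    (h1 : ∀ j x, ∫⁻ y, K j x y ∂μ = 1) (hcomp : Comp μ K) {p q : ℝ} (hq : 1 ≤ q) (hqp : q ≤ p) :
    ∃ C : ENNReal, C ≠ ⊤ ∧ ∀ (J : Finset ℤ) (g : ℤ → M → ENNReal), (∀ j, Measurable (g j)) →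
      ∫⁻ x, ((∑ j ∈ J, TK μ (K j) (g j) x ^ q) ^ (1 / q)) ^ p ∂μ ≤
        C * ∫⁻ x, ((∑ j ∈ J, g j x ^ q) ^ (1 / q)) ^ p ∂μ := by
  have hq0 : 0 < q := by linarith
  obtain ⟨C, hC, h⟩ := q_one hk hs h1 hcomp (p := p / q) ((one_le_div hq0).2 hqp)
  refine ⟨C, hC, fun J g hg => ?_⟩
  have := h J (fun j x => g j x ^ q) fun j => (hg j).pow_const q
  simp_rw [← ENNReal.rpow_mul, one_div_mul_eq_div]
  refine le_trans (lintegral_mono fun x => ?_) this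
  dsimp only
  have : 0 ≤ p / q := div_nonneg (by linarith) hq0.le
  gcongr with j hj
  exact TK_jensen (hk _) (h1 _) (hg j) hq x

/-- Duality step. -/
theorem dual_step [SFinite μ] {K : ℤ → M → M → ENNReal}
    (hk : ∀ j, Measurable fun z : M × M => K j z.1 z.2)
    (hs : ∀ j x y, K j x y = K j y x) {p p' q' : ℝ} (hc : p.HolderConjugate p')
    {C : ENNReal} (hC : ∀ (J : Finset ℤ) (g : ℤ → M → ENNReal), (∀ j, Measurable (g j)) →
      ∫⁻ x, ((∑ j ∈ J, TK μ (K j) (g j) x ^ q') ^ (1 / q')) ^ p' ∂μ ≤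
        C * ∫⁻ x, ((∑ j ∈ J, g j x ^ q') ^ (1 / q')) ^ p' ∂μ)
    (J : Finset ℤ) (g : ℤ → M → ENNReal) (hg : ∀ j, Measurable (g j))
    (G U : M → ENNReal) (hGm : Measurable G)
    (hG : ∀ x (v : ℤ → ENNReal), ∑ j ∈ J, g j x * v j ≤ G x * (∑ j ∈ J, v j ^ q') ^ (1 / q'))
    (h : ℤ → M → ENNReal) (hh : ∀ j, Measurable (h j))
    (hU : ∀ᵐ x ∂μ, U x ^ p ≤ ∑ j ∈ J, TK μ (K j) (g j) x * h j x)
    (hU' : ∀ x, (∑ j ∈ J, h j x ^ q') ^ (1 / q') ≤ U x ^ (p - 1))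
    (hfin : ∫⁻ x, U x ^ p ∂μ ≠ ⊤) :
    ∫⁻ x, U x ^ p ∂μ ≤ C ^ (p - 1) * ∫⁻ x, G x ^ p ∂μ := by
  have hp0 := hc.pos
  have hp'0 := hc.symm.pos
  set Y := ∫⁻ x, U x ^ p ∂μ with hY
  have mT : ∀ j, Measurable (TK μ (K j) (h j)) := fun j => TK_meas (hk j) (hh j)
  have mS : Measurable fun x => (∑ j ∈ J, TK μ (K j) (h j) x ^ q') ^ (1 / q') :=
    (Finset.measurable_sum _ fun j _ => (mT j).pow_const _).pow_const _
  have key : Y ≤ ((∫⁻ x, G x ^ p ∂μ) ^ (1 / p) * C ^ (1 / p')) * Y ^ (1 / p') := by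
    calc Y ≤ ∫⁻ x, ∑ j ∈ J, TK μ (K j) (g j) x * h j x ∂μ := lintegral_mono_ae hU
      _ = ∑ j ∈ J, ∫⁻ x, TK μ (K j) (g j) x * h j x ∂μ :=
          lintegral_finsetSum _ fun j _ => (TK_meas (hk j) (hg j)).mul (hh j)
      _ = ∑ j ∈ J, ∫⁻ x, g j x * TK μ (K j) (h j) x ∂μ :=
          Finset.sum_congr rfl fun j _ => TK_dual' (hk j) (hs j) (hg j) (hh j)
      _ = ∫⁻ x, ∑ j ∈ J, g j x * TK μ (K j) (h j) x ∂μ :=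
          (lintegral_finsetSum _ fun j _ => (hg j).mul (mT j)).symm
      _ ≤ ∫⁻ x, G x * (∑ j ∈ J, TK μ (K j) (h j) x ^ q') ^ (1 / q') ∂μ :=
          lintegral_mono fun x => hG x _
      _ ≤ (∫⁻ x, G x ^ p ∂μ) ^ (1 / p) *
          (∫⁻ x, ((∑ j ∈ J, TK μ (K j) (h j) x ^ q') ^ (1 / q')) ^ p' ∂μ) ^ (1 / p') :=
          ENNReal.lintegral_mul_le_Lp_mul_Lq μ hc hGm.aemeasurable mS.aemeasurable
      _ ≤ (∫⁻ x, G x ^ p ∂μ) ^ (1 / p) * (C * Y) ^ (1 / p') := by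
          gcongr
          refine (hC J h hh).trans ?_
          gcongr
          refine lintegral_mono fun x => ?_
          calc _ ≤ (U x ^ (p - 1)) ^ p' := by
                gcongr
                exact hU' x
            _ = U x ^ p := by rw [← ENNReal.rpow_mul, hc.sub_one_mul_conj]
      _ = _ := by
          rw [ENNReal.mul_rpow_of_nonneg _ _ (by positivity)]
          ring
  refine (absorb hc hfin key).trans (le_of_eq ?_)
  rw [ENNReal.mul_rpow_of_nonneg _ _ hp0.le, ← ENNReal.rpow_mul, ← ENNReal.rpow_mul, one_div,
    inv_mul_cancel₀ hp0.ne', ENNReal.rpow_one, mul_comm, one_div_mul_eq_div, hc.div_conj_eq_sub_one]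

end

/-- finite `ℓ^q` norm -/
noncomputable def zF (q : ENNReal) (J : Finset ℤ) (f : ℤ → ENNReal) : ENNReal :=
  if q = ⊤ then ⨆ j ∈ J, f j else (∑ j ∈ J, f j ^ q.toReal) ^ (1 / q.toReal)

theorem toReal_one_le {q : ENNReal} (hq : 1 ≤ q) (hqt : q ≠ ⊤) : 1 ≤ q.toReal := by
  have := ENNReal.toReal_mono hqt hq
  simpa using this

theorem le_zF {q : ENNReal} (hq : 1 ≤ q) (J : Finset ℤ) (f : ℤ → ENNReal) {j : ℤ} (hj : j ∈ J) :
    f j ≤ zF q J f := by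
  unfold zF
  split_ifs with h
  · exact le_iSup₂ (f := fun j (_ : j ∈ J) => f j) j hj
  · have h1 := toReal_one_le hq h
    have h0 : 0 < q.toReal := by linarith
    calc f j = (f j ^ q.toReal) ^ (1 / q.toReal) := by
          rw [← ENNReal.rpow_mul, mul_one_div_cancel h0.ne', ENNReal.rpow_one]
      _ ≤ _ := by
          gcongr
          exact Finset.single_le_sum (f := fun j => f j ^ q.toReal) (by simp) hj

theorem zF_le_sum {q : ENNReal} (hq : 1 ≤ q) (J : Finset ℤ) (f : ℤ → ENNReal) :
    zF q J f ≤ ∑ j ∈ J, f j := by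
  unfold zF
  split_ifs with h
  · exact iSup₂_le fun j hj => Finset.single_le_sum (f := f) (by simp) hj
  · have h1 := toReal_one_le hq h
    have h0 : 0 < q.toReal := by linarith
    set S := ∑ j ∈ J, f j
    have e : ∀ a : ENNReal, a ^ q.toReal = a * a ^ (q.toReal - 1) := fun a => by
      conv_rhs => rw [← ENNReal.rpow_one a, ← ENNReal.rpow_mul,
        ← ENNReal.rpow_add_of_nonneg _ _ zero_le_one (by linarith)]
      congr 1
      ring
    have : ∑ j ∈ J, f j ^ q.toReal ≤ S ^ q.toReal := by
      rw [e S, Finset.sum_mul]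
      refine Finset.sum_le_sum fun j hj => ?_
      rw [e]
      refine mul_le_mul_right (ENNReal.rpow_le_rpow ?_ (by linarith)) _
      exact Finset.single_le_sum (f := f) (by simp) hj
    calc _ ≤ (S ^ q.toReal) ^ (1 / q.toReal) := by gcongr
      _ = S := by rw [← ENNReal.rpow_mul, mul_one_div_cancel h0.ne', ENNReal.rpow_one]

section
variable {M : Type*} [MeasurableSpace M] {μ : Measure M}

theorem zF_meas (q : ENNReal) (J : Finset ℤ) {f : ℤ → M → ENNReal} (hf : ∀ j, Measurable (f j)) :
    Measurable fun x => zF q J (fun j => f j x) := by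
  unfold zF
  split_ifs with h
  · exact Measurable.biSup _ (Finset.countable_toSet J) fun j _ => hf j
  · exact (Finset.measurable_sum _ fun j _ => (hf j).pow_const _).pow_const _

theorem fin_bound [SFinite μ] {K : ℤ → M → M → ENNReal}
    (hk : ∀ j, Measurable fun z : M × M => K j z.1 z.2)
    (hs : ∀ j x y, K j x y = K j y x)
    (h1 : ∀ j x, ∫⁻ y, K j x y ∂μ = 1) (hcomp : Comp μ K) {p : ℝ} (hp : 1 < p)
    {q : ENNReal} (hq : 1 ≤ q) :
    ∃ C : ENNReal, C ≠ ⊤ ∧ ∀ (J : Finset ℤ) (g : ℤ → M → ENNReal), (∀ j, Measurable (g j)) →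
      ∫⁻ x, zF q J (fun j => TK μ (K j) (g j) x) ^ p ∂μ ≤
        C * ∫⁻ x, zF q J (fun j => g j x) ^ p ∂μ := by
  have hc := Real.HolderConjugate.conjExponent hp
  set p' := p.conjExponent
  have hp0 := hc.pos
  have hp'0 := hc.symm.pos
  have apriori : ∀ (J : Finset ℤ) (g : ℤ → M → ENNReal), (∀ j, Measurable (g j)) →
      ∫⁻ x, zF q J (fun j => g j x) ^ p ∂μ ≠ ⊤ →
      ∫⁻ x, zF q J (fun j => TK μ (K j) (g j) x) ^ p ∂μ ≠ ⊤ := by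
    intro J g hg hX
    have := TK_apriori hk hs h1 hp.le J (fun j => j) hg
    refine ne_top_of_le_ne_top ?_ ((lintegral_mono fun x => ?_).trans this)
    · refine ENNReal.mul_ne_top (ENNReal.rpow_ne_top_of_nonneg (by linarith) (by simp)) ?_
      rw [ENNReal.sum_ne_top]
      intro j hj
      refine ne_top_of_le_ne_top hX (lintegral_mono fun x => ?_)
      exact ENNReal.rpow_le_rpow (le_zF hq J (fun j => g j x) hj) hp0.le
    · exact ENNReal.rpow_le_rpow (zF_le_sum hq _ _) hp0.le
  rcases eq_or_ne q ⊤ with hqt | hqt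
  · -- `q = ∞`
    obtain ⟨C, hC, hb⟩ := q_le hk hs h1 hcomp (le_refl 1) hc.symm.lt.le
    refine ⟨C ^ (p - 1) + 1, by finiteness [hp], fun J g hg => ?_⟩
    rcases eq_or_ne (∫⁻ x, zF q J (fun j => g j x) ^ p ∂μ) ⊤ with hX | hX
    · rw [hX, ENNReal.mul_top (by simp)]
      exact le_top
    have mt : ∀ j, Measurable (TK μ (K j) (g j)) := fun j => TK_meas (hk j) (hg j)
    set U : M → ENNReal := fun x => zF q J (fun j => TK μ (K j) (g j) x) with hU
    have mU : Measurable U := zF_meas q J mt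
    let A : ℤ → Set M := fun j => {x | TK μ (K j) (g j) x = U x}
    have mA : ∀ j, MeasurableSet (A j) := fun j => measurableSet_eq_fun (mt j) mU
    let I : ℤ → M → ENNReal := fun j => (A j).indicator (fun _ => 1)
    have mI : ∀ j, Measurable (I j) := fun j => measurable_const.indicator (mA j)
    let h : ℤ → M → ENNReal := fun j x => I j x / (∑ i ∈ J, I i x) * U x ^ (p - 1)
    have hIt : ∀ x, ∑ i ∈ J, I i x ≠ ⊤ := by
      intro x
      rw [ENNReal.sum_ne_top]
      intro i _
      by_cases hx : x ∈ A i <;> simp [I, hx]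
    refine (dual_step hk hs hc hb J g hg (fun x => zF q J (fun j => g j x)) U
      (zF_meas q J hg) ?_ h ?_ ?_ ?_ (apriori J g hg hX)).trans ?_
    · intro x v
      simp only [ENNReal.rpow_one, div_one]
      rw [Finset.mul_sum]
      exact Finset.sum_le_sum fun j hj => mul_le_mul_left (le_zF hq J (fun j => g j x) hj) _
    · exact fun j => ((mI j).div (Finset.measurable_sum _ fun i _ => mI i)).mul (mU.pow_const _)
    · refine Filter.Eventually.of_forall fun x => ?_
      rcases J.eq_empty_or_nonempty with hJ | hJ
      · simp [hU, zF, hqt, hJ, hp0]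
      obtain ⟨i, hi, hmax⟩ := J.exists_max_image (fun j => TK μ (K j) (g j) x) hJ
      have hiA : x ∈ A i := by
        apply le_antisymm (le_zF hq J (fun j => TK μ (K j) (g j) x) hi)
        simp only [zF, hqt, if_true]
        exact iSup₂_le fun j hj => hmax j hj
      have hne : ∑ i ∈ J, I i x ≠ 0 := by
        have : I i x ≤ ∑ i ∈ J, I i x := Finset.single_le_sum (f := fun i => I i x) (by simp) hi
        have h1 : I i x = 1 := by simp [I, hiA]
        intro h0
        rw [h0, h1] at this
        simp at this
      have e : ∀ j, TK μ (K j) (g j) x * h j x = I j x / (∑ i ∈ J, I i x) * U x ^ p := by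
        intro j
        by_cases hx : x ∈ A j
        · have : TK μ (K j) (g j) x = U x := hx
          have e2 : U x ^ p = U x * U x ^ (p - 1) := by
            conv_rhs => rw [← ENNReal.rpow_one (U x), ← ENNReal.rpow_mul,
              ← ENNReal.rpow_add_of_nonneg _ _ zero_le_one (by linarith)]
            congr 1
            ring
          rw [this, e2]
          simp only [h]
          ring
        · simp [h, I, hx]
      simp_rw [e]
      rw [← Finset.sum_mul]
      simp_rw [div_eq_mul_inv]
      rw [← Finset.sum_mul, ENNReal.mul_inv_cancel hne (hIt x), one_mul]
    · intro x
      simp only [ENNReal.rpow_one, div_one, h]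
      rw [← Finset.sum_mul]
      simp_rw [div_eq_mul_inv]
      rw [← Finset.sum_mul]
      calc _ ≤ 1 * U x ^ (p - 1) := by
            gcongr
            exact ENNReal.mul_inv_le_one _
        _ = _ := one_mul _
    · gcongr
      simp
  · have hq1 := toReal_one_le hq hqt
    rcases le_or_gt q.toReal p with hqp | hqp
    · obtain ⟨C, hC, hb⟩ := q_le hk hs h1 hcomp hq1 hqp
      refine ⟨C, hC, fun J g hg => ?_⟩
      simpa only [zF, hqt, if_false] using hb J g hg
    · have hcq := Real.HolderConjugate.conjExponent (hp.trans hqp)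
      set r := q.toReal with hr
      set r' := r.conjExponent
      have hr0 := hcq.pos
      have hr'0 := hcq.symm.pos
      have hrp : r' ≤ p' := by
        have e1 := hcq.inv_add_inv_eq_one
        have e2 := hc.inv_add_inv_eq_one
        have e3 : r⁻¹ < p⁻¹ := inv_strictAnti₀ hp0 hqp
        rw [← inv_le_inv₀ hp'0 hr'0]
        linarith
      obtain ⟨C, hC, hb⟩ := q_le hk hs h1 hcomp hcq.symm.lt.le hrp
      refine ⟨C ^ (p - 1) + 1, by finiteness [hp], fun J g hg => ?_⟩
      rcases eq_or_ne (∫⁻ x, zF q J (fun j => g j x) ^ p ∂μ) ⊤ with hX | hX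
      · rw [hX, ENNReal.mul_top (by simp)]
        exact le_top
      have mt : ∀ j, Measurable (TK μ (K j) (g j)) := fun j => TK_meas (hk j) (hg j)
      set U : M → ENNReal := fun x => zF q J (fun j => TK μ (K j) (g j) x) with hU
      have mU : Measurable U := zF_meas q J mt
      have hfin := apriori J g hg hX
      have hUe : ∀ x, U x = (∑ j ∈ J, TK μ (K j) (g j) x ^ r) ^ (1 / r) := fun x => by
        simp only [hU, zF, hqt, if_false]
        rfl
      have hUr : ∀ x, ∑ j ∈ J, TK μ (K j) (g j) x ^ r = U x ^ r := fun x => by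
        rw [hUe, ← ENNReal.rpow_mul, one_div_mul_cancel hr0.ne', ENNReal.rpow_one]
      let h : ℤ → M → ENNReal := fun j x => TK μ (K j) (g j) x ^ (r - 1) * U x ^ (p - r)
      have hU0 : ∀ x, U x = 0 → ∀ j ∈ J, TK μ (K j) (g j) x = 0 := fun x hx j hj => by
        have := le_zF hq J (fun j => TK μ (K j) (g j) x) hj
        simpa [← hU, hx] using this.trans hx.le
      have hr1 : 0 < r - 1 := by linarith
      refine (dual_step hk hs hc hb J g hg (fun x => zF q J (fun j => g j x)) U
        (zF_meas q J hg) ?_ h ?_ ?_ ?_ hfin).trans ?_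
      · intro x v
        simp only [zF, hqt, if_false]
        exact ENNReal.inner_le_Lp_mul_Lq J (fun j => g j x) v hcq
      · exact fun j => ((mt j).pow_const _).mul (mU.pow_const _)
      · have hae := ae_lt_top (mU.pow_const p) hfin
        filter_upwards [hae] with x hx
        have hxt : U x ≠ ⊤ := by
          intro h
          rw [h, ENNReal.top_rpow_of_pos hp0] at hx
          exact lt_irrefl _ hx
        rcases eq_or_ne (U x) 0 with h0 | h0
        · simp [h0, hp0]
        have e : ∀ j, TK μ (K j) (g j) x * h j x = TK μ (K j) (g j) x ^ r * U x ^ (p - r) := by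
          intro j
          simp only [h]
          rw [← mul_assoc]
          congr 1
          conv_lhs => enter [1]; rw [← ENNReal.rpow_one (TK μ (K j) (g j) x)]
          rw [← ENNReal.rpow_add_of_nonneg _ _ zero_le_one hr1.le]
          congr 1
          ring
        simp_rw [e]
        rw [← Finset.sum_mul, hUr, ← ENNReal.rpow_add _ _ h0 hxt]
        apply le_of_eq
        congr 1
        ring
      · intro x
        rcases eq_or_ne (U x) ⊤ with hxt | hxt
        · rw [hxt, ENNReal.top_rpow_of_pos (by linarith)]
          exact le_top
        rcases eq_or_ne (U x) 0 with h0 | h0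
        · have : ∑ j ∈ J, h j x ^ r' = 0 := by
            refine Finset.sum_eq_zero fun j hj => ?_
            simp [h, hU0 x h0 j hj, hr1, hr'0]
          rw [this]
          simp [hr'0]
        have e : ∀ j, h j x ^ r' = TK μ (K j) (g j) x ^ r * U x ^ ((p - r) * r') := by
          intro j
          simp only [h]
          rw [ENNReal.mul_rpow_of_nonneg _ _ hr'0.le, ← ENNReal.rpow_mul, ← ENNReal.rpow_mul,
            hcq.sub_one_mul_conj]
        simp_rw [e]
        rw [← Finset.sum_mul, hUr, ← ENNReal.rpow_add _ _ h0 hxt, ← ENNReal.rpow_mul]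
        apply le_of_eq
        congr 1
        have := hcq.div_conj_eq_sub_one
        rw [add_mul, mul_one_div, this]
        field_simp
        ring
      · gcongr
        simp

theorem zF_mono_J {q : ENNReal} (f : ℤ → ENNReal) {J J' : Finset ℤ} (h : J ⊆ J') :
    zF q J f ≤ zF q J' f := by
  unfold zF
  split_ifs
  · exact biSup_mono fun j hj => h hj
  · have : 0 ≤ 1 / q.toReal := by positivity
    gcongr

theorem zF_le_zlq {q : ENNReal} (f : ℤ → ENNReal) (J : Finset ℤ) :
    zF q J f ≤ zlqNorm q f := by
  unfold zF zlqNorm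
  split_ifs
  · exact iSup₂_le fun j _ => le_iSup f j
  · have : 0 ≤ 1 / q.toReal := by positivity
    gcongr
    exact ENNReal.sum_le_tsum _

theorem zlq_eq {q : ENNReal} (hq : 1 ≤ q) (f : ℤ → ENNReal) :
    zlqNorm q f = ⨆ n : ℕ, zF q (Finset.Icc (-(n : ℤ)) n) f := by
  apply le_antisymm _ (iSup_le fun n => zF_le_zlq f _)
  unfold zlqNorm
  split_ifs with h
  · refine iSup_le fun j => ?_
    refine le_trans ?_ (le_iSup _ j.natAbs)
    apply le_zF hq
    rw [Finset.mem_Icc]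
    omega
  · have h1 := toReal_one_le hq h
    have h0 : 0 < q.toReal := by linarith
    rw [one_div, ENNReal.rpow_inv_le_iff h0, ENNReal.tsum_eq_iSup_sum]
    refine iSup_le fun s => ?_
    have hs : s ⊆ Finset.Icc (-((s.sup Int.natAbs : ℕ) : ℤ)) (s.sup Int.natAbs : ℕ) := by
      intro j hj
      have := Finset.le_sup (f := Int.natAbs) hj
      rw [Finset.mem_Icc]
      omega
    rw [← ENNReal.rpow_inv_le_iff h0]
    refine le_trans ?_ (le_iSup _ (s.sup Int.natAbs))
    refine le_trans ?_ (zF_mono_J f hs)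
    simp [zF, h]

theorem zlq_mul {q : ENNReal} (hq : 1 ≤ q) (c : ENNReal) {f g : ℤ → ENNReal}
    (h : ∀ j, f j ≤ c * g j) : zlqNorm q f ≤ c * zlqNorm q g := by
  unfold zlqNorm
  split_ifs with hqt
  · exact iSup_le fun j => (h j).trans (mul_le_mul_right (le_iSup g j) _)
  · have h1 := toReal_one_le hq hqt
    have h0 : 0 < q.toReal := by linarith
    calc _ ≤ (∑' j, c ^ q.toReal * g j ^ q.toReal) ^ (1 / q.toReal) := by
          gcongr with j
          rw [← ENNReal.mul_rpow_of_nonneg _ _ h0.le]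
          exact ENNReal.rpow_le_rpow (h j) h0.le
      _ = _ := by
          rw [ENNReal.tsum_mul_left, ENNReal.mul_rpow_of_nonneg _ _ (by positivity),
            ← ENNReal.rpow_mul, mul_one_div_cancel h0.ne', ENNReal.rpow_one]

theorem full_bound [SFinite μ] {K : ℤ → M → M → ENNReal}
    (hk : ∀ j, Measurable fun z : M × M => K j z.1 z.2)
    (hs : ∀ j x y, K j x y = K j y x)
    (h1 : ∀ j x, ∫⁻ y, K j x y ∂μ = 1) (hcomp : Comp μ K) {p : ℝ} (hp : 1 < p)
    {q : ENNReal} (hq : 1 ≤ q) :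
    ∃ C : ENNReal, C ≠ ⊤ ∧ ∀ (g : ℤ → M → ENNReal), (∀ j, Measurable (g j)) →
      ∫⁻ x, zlqNorm q (fun j => TK μ (K j) (g j) x) ^ p ∂μ ≤
        C * ∫⁻ x, zlqNorm q (fun j => g j x) ^ p ∂μ := by
  obtain ⟨C, hC, h⟩ := fin_bound hk hs h1 hcomp hp hq
  have hp0 : 0 < p := by linarith
  refine ⟨C, hC, fun g hg => ?_⟩
  have mt : ∀ j, Measurable (TK μ (K j) (g j)) := fun j => TK_meas (hk j) (hg j)
  have e : ∀ x, zlqNorm q (fun j => TK μ (K j) (g j) x) ^ p =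
      ⨆ n : ℕ, zF q (Finset.Icc (-(n : ℤ)) n) (fun j => TK μ (K j) (g j) x) ^ p := by
    intro x
    rw [zlq_eq hq]
    exact (ENNReal.orderIsoRpow p hp0).map_iSup _
  simp_rw [e]
  rw [lintegral_iSup]
  · refine iSup_le fun n => (h _ g hg).trans ?_
    refine mul_le_mul_right (lintegral_mono fun x => ?_) _
    exact ENNReal.rpow_le_rpow (zF_le_zlq _ _) hp0.le
  · exact fun n => (zF_meas q _ mt).pow_const p
  · intro n m hnm x
    refine ENNReal.rpow_le_rpow (zF_mono_J _ ?_) hp0.le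
    apply Finset.Icc_subset_Icc <;> simp [hnm]

end
theorem poly_exp {c D δ : ℝ} (hc : 0 ≤ c) (hD : 0 < D) (hδ : 0 < δ) :
    ∃ A : ℝ, 0 < A ∧ ∀ u : ℝ, 0 ≤ u → (c + u) ^ D ≤ A * Real.exp (δ * u ^ 2) := by
  refine ⟨Real.exp (D * c + D ^ 2 / (4 * δ)), Real.exp_pos _, fun u hu => ?_⟩
  rw [← Real.exp_add]
  have h1 : c + u ≤ Real.exp (c + u) := by
    have := Real.add_one_le_exp (c + u)
    linarith
  calc (c + u) ^ D ≤ Real.exp (c + u) ^ D := Real.rpow_le_rpow (by positivity) h1 hD.le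
    _ = Real.exp ((c + u) * D) := (Real.exp_mul _ _).symm
    _ ≤ _ := by
      apply Real.exp_le_exp.2
      have : D * u ≤ δ * u ^ 2 + D ^ 2 / (4 * δ) := by
        have h := sq_nonneg (2 * δ * u - D)
        have e : δ * u ^ 2 + D ^ 2 / (4 * δ) - D * u = (2 * δ * u - D) ^ 2 / (4 * δ) := by
          field_simp
          ring
        have : 0 ≤ (2 * δ * u - D) ^ 2 / (4 * δ) := by positivity
        linarith
      linarith

section
theorem vol_pos {M : Type*} [MetricSpace M] [MeasurableSpace M] {μ : Measure M}
    {H : ℝ → M → M → ℝ} {C₀ b₀ : ℝ}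
    (hC₀ : 0 < C₀)
    (hlower : ∀ t x y, 0 < t →
      C₀⁻¹ * Real.exp (-b₀ * dist x y ^ 2 / t) ≤
        H t x y *
          Real.sqrt
            ((μ (ball x (Real.sqrt t))).toReal * (μ (ball y (Real.sqrt t))).toReal))
    (x : M) {t : ℝ} (ht : 0 < t) : 0 < (μ (ball x (Real.sqrt t))).toReal := by
  refine lt_of_le_of_ne ENNReal.toReal_nonneg fun h => ?_
  have := hlower t x x ht
  rw [← h] at this
  have h2 : 0 < C₀⁻¹ * Real.exp (-b₀ * dist x x ^ 2 / t) := by positivity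
  simp only [mul_zero, Real.sqrt_zero] at this
  linarith

theorem vol_comp {M : Type*} [MetricSpace M] [MeasurableSpace M] {μ : Measure M}
    {c₀ D : ℝ} {H : ℝ → M → M → ℝ} {C₀ b₀ : ℝ}
    (hc₀ : 0 < c₀)
    (hdoub : ∀ (x : M) (r R : ℝ), 0 < r → 1 ≤ R →
      μ (ball x (R * r)) ≤ ENNReal.ofReal (c₀ * R ^ D) * μ (ball x r))
    (hC₀ : 0 < C₀)
    (hlower : ∀ t x y, 0 < t →
      C₀⁻¹ * Real.exp (-b₀ * dist x y ^ 2 / t) ≤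
        H t x y *
          Real.sqrt
            ((μ (ball x (Real.sqrt t))).toReal * (μ (ball y (Real.sqrt t))).toReal))
    (x y : M) {t m : ℝ} (ht : 0 < t) (hm : 1 ≤ m) :
    (μ (ball y (Real.sqrt (m * t)))).toReal ≤
      c₀ * (Real.sqrt m + dist x y / Real.sqrt t) ^ D * (μ (ball x (Real.sqrt t))).toReal := by
  have hst : 0 < Real.sqrt t := Real.sqrt_pos.2 ht
  have hR : 1 ≤ Real.sqrt m + dist x y / Real.sqrt t := by
    have h1 : 1 ≤ Real.sqrt m := Real.one_le_sqrt.2 hm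
    have : 0 ≤ dist x y / Real.sqrt t := by positivity
    linarith
  have h := hdoub x (Real.sqrt t) _ hst hR
  have hsub : ball y (Real.sqrt (m * t)) ⊆
      ball x ((Real.sqrt m + dist x y / Real.sqrt t) * Real.sqrt t) := by
    apply ball_subset_ball'
    rw [Real.sqrt_mul (by linarith), dist_comm]
    field_simp
    exact le_rfl
  have hv := vol_pos hC₀ hlower x ht
  have hfin : μ (ball x (Real.sqrt t)) ≠ ⊤ := fun h => by simp [h] at hv
  have h2 := ENNReal.toReal_mono (ENNReal.mul_ne_top ENNReal.ofReal_ne_top hfin)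
    ((measure_mono hsub).trans h)
  rwa [ENNReal.toReal_mul, ENNReal.toReal_ofReal (by positivity)] at h2

theorem kcomp {M : Type*} [MetricSpace M] [MeasurableSpace M] {μ : Measure M}
    {c₀ D : ℝ} {H : ℝ → M → M → ℝ} {C₀ b₀ b₁ : ℝ}
    (hc₀ : 0 < c₀)
    (hD : 0 < D)
    (hdoub : ∀ (x : M) (r R : ℝ), 0 < r → 1 ≤ R →
      μ (ball x (R * r)) ≤ ENNReal.ofReal (c₀ * R ^ D) * μ (ball x r))
    (hHnonneg : ∀ t x y, 0 < t → 0 ≤ H t x y)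
    (hC₀ : 0 < C₀)
    (hlower : ∀ t x y, 0 < t →
      C₀⁻¹ * Real.exp (-b₀ * dist x y ^ 2 / t) ≤
        H t x y *
          Real.sqrt
            ((μ (ball x (Real.sqrt t))).toReal * (μ (ball y (Real.sqrt t))).toReal))
    (hupper : ∀ t x y, 0 < t →
      H t x y *
          Real.sqrt
            ((μ (ball x (Real.sqrt t))).toReal * (μ (ball y (Real.sqrt t))).toReal) ≤
        C₀ * Real.exp (-b₁ * dist x y ^ 2 / t))
    (x y z : M) {t m : ℝ} (ht : 0 < t) (hm : 1 ≤ m) :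
    H t x z ≤ C₀ ^ 2 * (c₀ * (Real.sqrt m + dist x y / Real.sqrt t) ^ D) *
      Real.exp (-b₁ * dist x z ^ 2 / t + b₀ * dist y z ^ 2 / (m * t)) * H (m * t) y z := by
  have hmt : 0 < m * t := by positivity
  set κ := c₀ * (Real.sqrt m + dist x y / Real.sqrt t) ^ D with hκ
  have hκ0 : 0 ≤ κ := by positivity
  set A := (μ (ball x (Real.sqrt t))).toReal with hA
  set B := (μ (ball z (Real.sqrt t))).toReal with hB
  set A' := (μ (ball y (Real.sqrt (m * t)))).toReal with hA'
  set B' := (μ (ball z (Real.sqrt (m * t)))).toReal with hB'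
  have pA : 0 < A := vol_pos hC₀ hlower x ht
  have pB : 0 < B := vol_pos hC₀ hlower z ht
  have pA' : 0 < A' := vol_pos hC₀ hlower y hmt
  have pB' : 0 < B' := vol_pos hC₀ hlower z hmt
  have h1 : A' ≤ κ * A := vol_comp hc₀ hdoub hC₀ hlower x y ht hm
  have h2 : B' ≤ κ * B := by
    refine (vol_comp hc₀ hdoub hC₀ hlower z z ht hm).trans ?_
    refine mul_le_mul_of_nonneg_right ?_ pB.le
    rw [hκ, dist_self, zero_div, add_zero]
    refine mul_le_mul_of_nonneg_left (Real.rpow_le_rpow (Real.sqrt_nonneg _) ?_ hD.le) hc₀.le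
    have : 0 ≤ dist x y / Real.sqrt t := by positivity
    linarith
  have hs : Real.sqrt (A' * B') ≤ κ * Real.sqrt (A * B) := by
    have : A' * B' ≤ κ ^ 2 * (A * B) := by
      calc A' * B' ≤ (κ * A) * (κ * B) := mul_le_mul h1 h2 pB'.le (by positivity)
        _ = _ := by ring
    calc Real.sqrt (A' * B') ≤ Real.sqrt (κ ^ 2 * (A * B)) := Real.sqrt_le_sqrt this
      _ = _ := by rw [Real.sqrt_mul (by positivity), Real.sqrt_sq hκ0]
  have hl := hlower (m * t) y z hmt
  have hu := hupper t x z ht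
  have hsp : 0 < Real.sqrt (A' * B') := Real.sqrt_pos.2 (by positivity)
  have hl' : Real.exp (-b₀ * dist y z ^ 2 / (m * t)) ≤ C₀ * (H (m * t) y z * Real.sqrt (A' * B')) := by
    have := mul_le_mul_of_nonneg_left hl hC₀.le
    rwa [← mul_assoc, mul_inv_cancel₀ hC₀.ne', one_mul] at this
  refine le_of_mul_le_mul_right ?_ hsp
  calc H t x z * Real.sqrt (A' * B') ≤ H t x z * (κ * Real.sqrt (A * B)) :=
        mul_le_mul_of_nonneg_left hs (hHnonneg t x z ht)
    _ = κ * (H t x z * Real.sqrt (A * B)) := by ring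
    _ ≤ κ * (C₀ * Real.exp (-b₁ * dist x z ^ 2 / t)) := mul_le_mul_of_nonneg_left hu hκ0
    _ = κ * C₀ * Real.exp (-b₁ * dist x z ^ 2 / t + b₀ * dist y z ^ 2 / (m * t)) *
          Real.exp (-b₀ * dist y z ^ 2 / (m * t)) := by
        rw [mul_assoc _ (Real.exp _), ← Real.exp_add]
        ring_nf
    _ ≤ κ * C₀ * Real.exp (-b₁ * dist x z ^ 2 / t + b₀ * dist y z ^ 2 / (m * t)) *
          (C₀ * (H (m * t) y z * Real.sqrt (A' * B'))) :=
        mul_le_mul_of_nonneg_left hl' (by positivity)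
    _ = _ := by ring

theorem kcomp_two {M : Type*} [MetricSpace M] [MeasurableSpace M] {μ : Measure M}
    {c₀ D : ℝ} {H : ℝ → M → M → ℝ} {C₀ b₀ b₁ : ℝ}
    (hc₀ : 0 < c₀)
    (hD : 0 < D)
    (hdoub : ∀ (x : M) (r R : ℝ), 0 < r → 1 ≤ R →
      μ (ball x (R * r)) ≤ ENNReal.ofReal (c₀ * R ^ D) * μ (ball x r))
    (hHnonneg : ∀ t x y, 0 < t → 0 ≤ H t x y)
    (hC₀ : 0 < C₀)
    (hb₀ : 0 < b₀)
    (hb₁ : 0 < b₁)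
    (hlower : ∀ t x y, 0 < t →
      C₀⁻¹ * Real.exp (-b₀ * dist x y ^ 2 / t) ≤
        H t x y *
          Real.sqrt
            ((μ (ball x (Real.sqrt t))).toReal * (μ (ball y (Real.sqrt t))).toReal))
    (hupper : ∀ t x y, 0 < t →
      H t x y *
          Real.sqrt
            ((μ (ball x (Real.sqrt t))).toReal * (μ (ball y (Real.sqrt t))).toReal) ≤
        C₀ * Real.exp (-b₁ * dist x y ^ 2 / t))
    {ε : ℝ} (hε : 0 < ε) : ∃ (k : ℕ) (A B : ℝ), 0 ≤ A ∧ 0 ≤ B ∧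
    (∀ (t : ℝ) (x y z : M), 0 < t →
      H t x z ≤ A * Real.exp (ε * (dist x y ^ 2 / t)) * H (2 ^ k * t) y z) ∧
    (∀ (t : ℝ) (x y : M), 0 < t →
      H t x y * Real.exp (b₁ / 2 * (dist x y ^ 2 / t)) ≤ B * H (2 ^ k * t) x y) := by
  obtain ⟨k, hk⟩ := pow_unbounded_of_one_lt (4 * b₀ / ε + 2 * b₀ / b₁) (one_lt_two (α := ℝ))
  have hk1 : (1 : ℝ) ≤ 2 ^ k := one_le_pow₀ one_le_two
  have hke : 4 * b₀ ≤ 2 ^ k * ε := by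
    have : 4 * b₀ / ε ≤ 2 ^ k := by
      have : 0 ≤ 2 * b₀ / b₁ := by positivity
      linarith
    rwa [div_le_iff₀ hε] at this
  have hkb : 2 * b₀ ≤ 2 ^ k * b₁ := by
    have : 2 * b₀ / b₁ ≤ 2 ^ k := by
      have : 0 ≤ 4 * b₀ / ε := by positivity
      linarith
    rwa [div_le_iff₀ hb₁] at this
  set m : ℝ := 2 ^ k with hmdef
  have hm0 : 0 < m := by linarith
  obtain ⟨A, hA, hpoly⟩ := poly_exp (Real.sqrt_nonneg m) hD (half_pos hε)
  refine ⟨k, C₀ ^ 2 * (c₀ * A), C₀ ^ 2 * (c₀ * (Real.sqrt m) ^ D), by positivity, by positivity,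
    fun t x y z ht => ?_, fun t x y ht => ?_⟩
  · refine (kcomp hc₀ hD hdoub hHnonneg hC₀ hlower hupper x y z ht hk1).trans ?_
    refine mul_le_mul_of_nonneg_right ?_ (hHnonneg _ _ _ (by positivity))
    have h1 := hpoly (dist x y / Real.sqrt t) (by positivity)
    rw [div_pow, Real.sq_sqrt ht.le] at h1
    have h2 : -b₁ * dist x z ^ 2 / t + b₀ * dist y z ^ 2 / (m * t) ≤ ε / 2 * (dist x y ^ 2 / t) := by
      have htri : dist y z ^ 2 ≤ 2 * dist x y ^ 2 + 2 * dist x z ^ 2 := by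
        have h3 : dist y z ≤ dist x y + dist x z := by
          rw [dist_comm x y]
          exact dist_triangle y x z
        have h4 : dist y z ^ 2 ≤ (dist x y + dist x z) ^ 2 := by gcongr
        nlinarith [sq_nonneg (dist x y - dist x z)]
      have e : ε / 2 * (dist x y ^ 2 / t) - (-b₁ * dist x z ^ 2 / t + b₀ * dist y z ^ 2 / (m * t))
          = (m * ε * dist x y ^ 2 + 2 * (m * b₁) * dist x z ^ 2 - 2 * b₀ * dist y z ^ 2)
            / (2 * m * t) := by
        field_simp
        ring
      have : 0 ≤ (m * ε * dist x y ^ 2 + 2 * (m * b₁) * dist x z ^ 2 - 2 * b₀ * dist y z ^ 2)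
            / (2 * m * t) := by
        apply div_nonneg _ (by positivity)
        have a1 := mul_le_mul_of_nonneg_right hke (sq_nonneg (dist x y))
        have a2 := mul_le_mul_of_nonneg_right hkb (sq_nonneg (dist x z))
        have a3 := mul_le_mul_of_nonneg_left htri hb₀.le
        linarith
      linarith
    calc _ ≤ C₀ ^ 2 * (c₀ * (A * Real.exp (ε / 2 * (dist x y ^ 2 / t)))) *
          Real.exp (ε / 2 * (dist x y ^ 2 / t)) := by gcongr
      _ = C₀ ^ 2 * (c₀ * A) * (Real.exp (ε / 2 * (dist x y ^ 2 / t)) *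
          Real.exp (ε / 2 * (dist x y ^ 2 / t))) := by ring
      _ = _ := by
          rw [← Real.exp_add]
          ring_nf
  · have h := kcomp hc₀ hD hdoub hHnonneg hC₀ hlower hupper x x y ht hk1
    rw [dist_self, zero_div, add_zero] at h
    have h2 : -b₁ * dist x y ^ 2 / t + b₀ * dist x y ^ 2 / (m * t) +
        b₁ / 2 * (dist x y ^ 2 / t) ≤ 0 := by
      have e : -b₁ * dist x y ^ 2 / t + b₀ * dist x y ^ 2 / (m * t) + b₁ / 2 * (dist x y ^ 2 / t)
        = -((m * b₁ - 2 * b₀) * dist x y ^ 2 / (2 * m * t)) := by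
        field_simp
        ring
      rw [e, neg_nonpos]
      have : 0 ≤ m * b₁ - 2 * b₀ := by linarith
      positivity
    have hH := hHnonneg (m * t) x y (by positivity)
    calc _ ≤ _ := mul_le_mul_of_nonneg_right h (Real.exp_pos _).le
      _ = C₀ ^ 2 * (c₀ * Real.sqrt m ^ D) * H (m * t) x y *
          Real.exp (-b₁ * dist x y ^ 2 / t + b₀ * dist x y ^ 2 / (m * t) +
            b₁ / 2 * (dist x y ^ 2 / t)) := by
          rw [Real.exp_add _ (b₁ / 2 * _)]
          ring
      _ ≤ C₀ ^ 2 * (c₀ * Real.sqrt m ^ D) * H (m * t) x y * 1 := by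
          gcongr
          exact Real.exp_le_one_iff.2 h2
      _ = _ := mul_one _

theorem comp_heat {M : Type*} [MetricSpace M] [MeasurableSpace M] {μ : Measure M}
    {c₀ D : ℝ} {H : ℝ → M → M → ℝ} {C₀ b₀ b₁ : ℝ}
    (hc₀ : 0 < c₀)
    (hD : 0 < D)
    (hdoub : ∀ (x : M) (r R : ℝ), 0 < r → 1 ≤ R →
      μ (ball x (R * r)) ≤ ENNReal.ofReal (c₀ * R ^ D) * μ (ball x r))
    (hHnonneg : ∀ t x y, 0 < t → 0 ≤ H t x y)
    (hC₀ : 0 < C₀)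
    (hb₀ : 0 < b₀)
    (hb₁ : 0 < b₁)
    (hlower : ∀ t x y, 0 < t →
      C₀⁻¹ * Real.exp (-b₀ * dist x y ^ 2 / t) ≤
        H t x y *
          Real.sqrt
            ((μ (ball x (Real.sqrt t))).toReal * (μ (ball y (Real.sqrt t))).toReal))
    (hupper : ∀ t x y, 0 < t →
      H t x y *
          Real.sqrt
            ((μ (ball x (Real.sqrt t))).toReal * (μ (ball y (Real.sqrt t))).toReal) ≤
        C₀ * Real.exp (-b₁ * dist x y ^ 2 / t))
    (hHmeas : Measurable fun p : ℝ × M × M => H p.1 p.2.1 p.2.2)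
    (hHsymm : ∀ t x y, 0 < t → H t x y = H t y x)
    (hmarkov : ∀ t x, 0 < t → ∫⁻ y, ENNReal.ofReal (H t x y) ∂μ = 1) {a : ℝ} (ha : 0 < a) :
    Comp μ (fun j x y => ENNReal.ofReal (H (a * 2 ^ j) x y)) := by
  intro r hr
  obtain ⟨k, A, B, hA, hB, h1, h2⟩ := kcomp_two hc₀ hD hdoub hHnonneg hC₀ hb₀ hb₁ hlower hupper
    (ε := b₁ / (2 * r)) (by positivity)
  refine ⟨k, ENNReal.ofReal (A ^ r) * ENNReal.ofReal B, by finiteness, ?_⟩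
  intro J g m j y hJ
  have tp : ∀ i : ℤ, 0 < a * 2 ^ i := fun i => by positivity
  have te : ∀ i : ℤ, a * (2 : ℝ) ^ (i + (m + (k : ℤ))) = 2 ^ k * (a * 2 ^ (i + m)) := fun i => by
    rw [← add_assoc, zpow_add₀ two_ne_zero, zpow_natCast]
    ring
  set τ := a * (2 : ℝ) ^ (j + m) with hτ
  have hτ0 : 0 < τ := tp _
  set F' := ∑ i ∈ J, TK μ (fun x y => ENNReal.ofReal (H (a * 2 ^ (i + (m + (k : ℤ)))) x y)) (g i) y
    with hF'
  have key : ∀ x, ENNReal.ofReal (H τ x y) *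
      (∑ i ∈ J, TK μ (fun x y => ENNReal.ofReal (H (a * 2 ^ (i + m)) x y)) (g i) x) ^ r ≤
      ENNReal.ofReal (H (2 ^ k * τ) y x) * (ENNReal.ofReal (A ^ r) * ENNReal.ofReal B * F' ^ r) := by
    intro x
    set E := Real.exp (b₁ / (2 * r) * (dist x y ^ 2 / τ)) with hE
    have hs : ∑ i ∈ J, TK μ (fun x y => ENNReal.ofReal (H (a * 2 ^ (i + m)) x y)) (g i) x ≤
        ENNReal.ofReal (A * E) * F' := by
      rw [hF', Finset.mul_sum]
      refine Finset.sum_le_sum fun i hi => ?_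
      unfold TK
      rw [← lintegral_const_mul' _ _ ENNReal.ofReal_ne_top]
      refine lintegral_mono fun z => ?_
      rw [← mul_assoc, ← ENNReal.ofReal_mul (by positivity), te]
      refine mul_le_mul_left (ENNReal.ofReal_le_ofReal ?_) _
      refine (h1 _ x y z (tp _)).trans ?_
      refine mul_le_mul_of_nonneg_right ?_ (hHnonneg _ _ _ (by have := tp (i + m); positivity))
      refine mul_le_mul_of_nonneg_left (Real.exp_le_exp.2 ?_) hA
      have hle : τ ≤ a * 2 ^ (i + m) := by
        refine mul_le_mul_of_nonneg_left (zpow_le_zpow_right₀ one_le_two ?_) ha.le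
        have := hJ i hi
        omega
      gcongr
    calc _ ≤ ENNReal.ofReal (H τ x y) * (ENNReal.ofReal (A * E) * F') ^ r := by gcongr
      _ = ENNReal.ofReal (A ^ r) * ENNReal.ofReal (H τ x y * E ^ r) * F' ^ r := by
          rw [ENNReal.mul_rpow_of_nonneg _ _ hr.le,
            ENNReal.ofReal_rpow_of_nonneg (by positivity) hr.le,
            Real.mul_rpow hA (Real.exp_pos _).le, ENNReal.ofReal_mul (by positivity),
            ENNReal.ofReal_mul (hHnonneg _ _ _ hτ0)]
          ring
      _ ≤ ENNReal.ofReal (A ^ r) * ENNReal.ofReal (B * H (2 ^ k * τ) x y) * F' ^ r := by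
          refine mul_le_mul_left (mul_le_mul_right (ENNReal.ofReal_le_ofReal ?_) _) _
          refine le_trans (le_of_eq ?_) (h2 τ x y hτ0)
          rw [hE, ← Real.exp_mul]
          congr 2
          field_simp
      _ = _ := by
          rw [ENNReal.ofReal_mul hB, hHsymm _ x y (by positivity)]
          ring
  refine (lintegral_mono key).trans ?_
  have hm' := hmarkov (2 ^ k * τ) y (by positivity)
  have hmeas : Measurable (fun x => ENNReal.ofReal (H (2 ^ k * τ) y x)) :=
    (hHmeas.comp (measurable_const.prodMk (measurable_const.prodMk measurable_id))).ennreal_ofReal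
  rw [lintegral_mul_const _ hmeas, hm', one_mul]

theorem sfinite_heat {M : Type*} [MetricSpace M] [MeasurableSpace M] {μ : Measure M}
    {H : ℝ → M → M → ℝ} {C₀ b₀ : ℝ}
    (hC₀ : 0 < C₀)
    (hlower : ∀ t x y, 0 < t →
      C₀⁻¹ * Real.exp (-b₀ * dist x y ^ 2 / t) ≤
        H t x y *
          Real.sqrt
            ((μ (ball x (Real.sqrt t))).toReal * (μ (ball y (Real.sqrt t))).toReal))
    (hHmeas : Measurable fun p : ℝ × M × M => H p.1 p.2.1 p.2.2)
    (hmarkov : ∀ t x, 0 < t → ∫⁻ y, ENNReal.ofReal (H t x y) ∂μ = 1) : SigmaFinite μ := by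
  rcases isEmpty_or_nonempty M with hM | ⟨⟨x⟩⟩
  · rw [Measure.eq_zero_of_isEmpty μ]
    infer_instance
  have hmeas : Measurable (fun y => ENNReal.ofReal (H 1 x y)) :=
    (hHmeas.comp (measurable_const.prodMk (measurable_const.prodMk measurable_id))).ennreal_ofReal
  refine ⟨⟨⟨fun n => {y | ((n : ENNReal) + 1)⁻¹ ≤ ENNReal.ofReal (H 1 x y)}, fun _ => mem_univ _,
    fun n => ?_, ?_⟩⟩⟩
  · refine (meas_ge_le_lintegral_div hmeas.aemeasurable ?_ ?_).trans_lt ?_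
    · simp
    · simp
    · rw [hmarkov 1 x one_pos]
      refine ENNReal.div_lt_top (by simp) (by simp)
  · rw [eq_univ_iff_forall]
    intro y
    have hpos : 0 < H 1 x y := by
      have h := hlower 1 x y one_pos
      have h2 : 0 < C₀⁻¹ * Real.exp (-b₀ * dist x y ^ 2 / 1) := by positivity
      exact pos_of_mul_pos_left (h2.trans_le h) (Real.sqrt_nonneg _)
    obtain ⟨n, hn⟩ := ENNReal.exists_inv_nat_lt (ENNReal.ofReal_pos.2 hpos).ne'
    refine mem_iUnion.2 ⟨n, ?_⟩
    refine le_trans ?_ hn.le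
    simp

end

end HeatFS

/-- Fefferman–Stein type vector-valued maximal inequality for the heat semigroup
(Proposition `contCRTN` of the paper): for a symmetric Markovian kernel with
Chapman–Kolmogorov identity and two-sided Gaussian bounds, `p ∈ (1,∞)`, `q ∈ [1,∞]` and
`0 < c₁ < c₂`, there is `C > 0` such that for measurable `t_j : M → ℝ` with
`c₁ 2^j ≤ t_j ≤ c₂ 2^j` and measurable `f_j`,
`‖(∑_j |T_{t_j(x)} f_j(x)|^q)^(1/q)‖_{L^p} ≤ C ‖(∑_j |f_j|^q)^(1/q)‖_{L^p}`. -/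
theorem stmt_13 {M : Type*} [MetricSpace M] [MeasurableSpace M] (μ : Measure M)
    (c₀ D : ℝ) (hc₀ : 0 < c₀) (hD : 0 < D)
    (hdoub : ∀ (x : M) (r R : ℝ), 0 < r → 1 ≤ R →
      μ (ball x (R * r)) ≤ ENNReal.ofReal (c₀ * R ^ D) * μ (ball x r))
    (H : ℝ → M → M → ℝ)
    (hHmeas : Measurable fun p : ℝ × M × M => H p.1 p.2.1 p.2.2)
    (hHnonneg : ∀ t x y, 0 < t → 0 ≤ H t x y)
    (hHsymm : ∀ t x y, 0 < t → H t x y = H t y x)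
    (hmarkov : ∀ t x, 0 < t → ∫⁻ y, ENNReal.ofReal (H t x y) ∂μ = 1)
    (hck : ∀ s t x y, 0 < s → 0 < t →
      ∫ z, H s x z * H t z y ∂μ = H (s + t) x y)
    (C₀ b₀ b₁ : ℝ) (hC₀ : 0 < C₀) (hb₀ : 0 < b₀) (hb₁ : 0 < b₁)
    (hlower : ∀ t x y, 0 < t →
      C₀⁻¹ * Real.exp (-b₀ * dist x y ^ 2 / t) ≤
        H t x y *
          Real.sqrt
            ((μ (ball x (Real.sqrt t))).toReal * (μ (ball y (Real.sqrt t))).toReal))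
    (hupper : ∀ t x y, 0 < t →
      H t x y *
          Real.sqrt
            ((μ (ball x (Real.sqrt t))).toReal * (μ (ball y (Real.sqrt t))).toReal) ≤
        C₀ * Real.exp (-b₁ * dist x y ^ 2 / t))
    (p : ℝ) (hp1 : 1 < p) (q : ENNReal) (hq : 1 ≤ q)
    (c₁ c₂ : ℝ) (hc₁ : 0 < c₁) (hc₁₂ : c₁ < c₂) :
    ∃ C : ℝ, 0 < C ∧
      ∀ tj : ℤ → M → ℝ, (∀ j, Measurable (tj j)) →
        (∀ (j : ℤ) (x : M), c₁ * 2 ^ j ≤ tj j x ∧ tj j x ≤ c₂ * 2 ^ j) →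
        ∀ f : ℤ → M → ℝ, (∀ j, Measurable (f j)) →
          (∫⁻ x,
              zlqNorm q
                  (fun j => ENNReal.ofReal |∫ y, H (tj j x) x y * f j y ∂μ|) ^ p ∂μ) ^
              (1 / p) ≤
            ENNReal.ofReal C *
              (∫⁻ x, zlqNorm q (fun j => ENNReal.ofReal |f j x|) ^ p ∂μ) ^ (1 / p) := by
  have hp0 : 0 < p := by linarith
  have hσ : SigmaFinite μ := HeatFS.sfinite_heat hC₀ hlower hHmeas hmarkov
  have hc₂ : 0 < c₂ := hc₁.trans hc₁₂
  set a : ℝ := c₂ * (1 + b₀ / b₁) with ha_def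
  have ha : 0 < a := by positivity
  have hcomp := HeatFS.comp_heat hc₀ hD hdoub hHnonneg hC₀ hb₀ hb₁ hlower hupper hHmeas hHsymm
    hmarkov ha
  set K : ℤ → M → M → ENNReal := fun j x y => ENNReal.ofReal (H (a * 2 ^ j) x y) with hK
  have tp : ∀ j : ℤ, 0 < a * (2 : ℝ) ^ j := fun j => by positivity
  have hk : ∀ j, Measurable fun z : M × M => K j z.1 z.2 := fun j =>
    (hHmeas.comp (measurable_const.prodMk measurable_id)).ennreal_ofReal
  obtain ⟨C, hC, hbound⟩ := HeatFS.full_bound hk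
    (fun j x y => by simp only [hK]; rw [hHsymm _ _ _ (tp j)]) (fun j x => hmarkov _ x (tp j))
    hcomp hp1 hq
  set B : ℝ := C₀ ^ 2 * (c₀ * Real.sqrt (a / c₁) ^ D) with hB
  have hB0 : 0 < B := by positivity
  set C' : ENNReal := ENNReal.ofReal B * C ^ (1 / p) with hC'
  have hC't : C' ≠ ⊤ := ENNReal.mul_ne_top ENNReal.ofReal_ne_top
    (ENNReal.rpow_ne_top_of_nonneg (by positivity) hC)
  refine ⟨C'.toReal + 1, by positivity, fun tj htm htj f hf => ?_⟩
  have hker : ∀ j x y, H (tj j x) x y ≤ B * H (a * 2 ^ j) x y := by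
    intro j x y
    obtain ⟨l, u⟩ := htj j x
    have h2j : (0 : ℝ) < 2 ^ j := by positivity
    have ht : 0 < tj j x := lt_of_lt_of_le (by positivity) l
    set t := tj j x
    set m := a * 2 ^ j / t with hm
    have e : m * t = a * 2 ^ j := by
      rw [hm]
      field_simp
    have hm1 : 1 + b₀ / b₁ ≤ m := by
      rw [hm, le_div_iff₀ ht, ha_def]
      calc (1 + b₀ / b₁) * t ≤ (1 + b₀ / b₁) * (c₂ * 2 ^ j) := by gcongr
        _ = _ := by ring
    have hbb : 0 < b₀ / b₁ := by positivity
    have hm2 : m ≤ a / c₁ := by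
      rw [hm, div_le_div_iff₀ ht hc₁]
      calc a * 2 ^ j * c₁ = a * (c₁ * 2 ^ j) := by ring
        _ ≤ a * t := by gcongr
    have hm3 : b₀ ≤ m * b₁ := by
      have : b₀ / b₁ ≤ m := by linarith
      rwa [div_le_iff₀ hb₁] at this
    have h := HeatFS.kcomp hc₀ hD hdoub hHnonneg hC₀ hlower hupper x x y ht
      (by linarith : (1 : ℝ) ≤ m)
    rw [dist_self, zero_div, add_zero, e] at h
    refine h.trans ?_
    refine mul_le_mul_of_nonneg_right ?_ (hHnonneg _ _ _ (tp j))
    have hexp : Real.exp (-b₁ * dist x y ^ 2 / t + b₀ * dist x y ^ 2 / (a * 2 ^ j)) ≤ 1 := by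
      rw [Real.exp_le_one_iff, ← e]
      have hm0 : 0 < m := by linarith
      have e2 : -b₁ * dist x y ^ 2 / t + b₀ * dist x y ^ 2 / (m * t)
          = -((m * b₁ - b₀) * dist x y ^ 2 / (m * t)) := by
        field_simp
        ring
      rw [e2, neg_nonpos]
      have : 0 ≤ m * b₁ - b₀ := by linarith
      positivity
    calc _ ≤ C₀ ^ 2 * (c₀ * Real.sqrt (a / c₁) ^ D) * 1 := by gcongr
      _ = B := by rw [mul_one]
  set g : ℤ → M → ENNReal := fun j x => ENNReal.ofReal |f j x| with hg
  have hgm : ∀ j, Measurable (g j) := fun j =>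
    (continuous_abs.measurable.comp (hf j)).ennreal_ofReal
  have hpt : ∀ j x, ENNReal.ofReal |∫ y, H (tj j x) x y * f j y ∂μ| ≤
      ENNReal.ofReal B * HeatFS.TK μ (K j) (g j) x := by
    intro j x
    have ht : 0 < tj j x := lt_of_lt_of_le (by positivity) (htj j x).1
    rw [← Real.norm_eq_abs, ofReal_norm]
    refine (enorm_integral_le_lintegral_enorm _).trans ?_
    rw [HeatFS.TK, ← lintegral_const_mul' _ _ ENNReal.ofReal_ne_top]
    refine lintegral_mono fun y => ?_
    rw [← ofReal_norm, Real.norm_eq_abs, abs_mul, abs_of_nonneg (hHnonneg _ _ _ ht),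
      ENNReal.ofReal_mul (hHnonneg _ _ _ ht), ← mul_assoc, ← ENNReal.ofReal_mul hB0.le]
    exact mul_le_mul_left (ENNReal.ofReal_le_ofReal (hker j x y)) _
  have hmain : ∫⁻ x, zlqNorm q
        (fun j => ENNReal.ofReal |∫ y, H (tj j x) x y * f j y ∂μ|) ^ p ∂μ ≤
      ENNReal.ofReal B ^ p * (C * ∫⁻ x, zlqNorm q (fun j => g j x) ^ p ∂μ) := by
    calc _ ≤ ∫⁻ x, ENNReal.ofReal B ^ p *
            zlqNorm q (fun j => HeatFS.TK μ (K j) (g j) x) ^ p ∂μ := by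
          refine lintegral_mono fun x => ?_
          rw [← ENNReal.mul_rpow_of_nonneg _ _ hp0.le]
          exact ENNReal.rpow_le_rpow (HeatFS.zlq_mul hq _ fun j => hpt j x) hp0.le
      _ = ENNReal.ofReal B ^ p *
            ∫⁻ x, zlqNorm q (fun j => HeatFS.TK μ (K j) (g j) x) ^ p ∂μ :=
          lintegral_const_mul' _ _ (ENNReal.rpow_ne_top_of_nonneg hp0.le ENNReal.ofReal_ne_top)
      _ ≤ _ := mul_le_mul_right (hbound g hgm) _
  calc _ ≤ (ENNReal.ofReal B ^ p * (C * ∫⁻ x, zlqNorm q (fun j => g j x) ^ p ∂μ)) ^ (1 / p) :=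
        ENNReal.rpow_le_rpow hmain (by positivity)
    _ = C' * (∫⁻ x, zlqNorm q (fun j => g j x) ^ p ∂μ) ^ (1 / p) := by
        rw [ENNReal.mul_rpow_of_nonneg _ _ (by positivity),
          ENNReal.mul_rpow_of_nonneg _ _ (by positivity), ← ENNReal.rpow_mul,
          mul_one_div_cancel hp0.ne', ENNReal.rpow_one, hC', mul_assoc]
    _ ≤ _ := by
        refine mul_le_mul_left ?_ _
        calc C' = ENNReal.ofReal C'.toReal := (ENNReal.ofReal_toReal hC't).symm
          _ ≤ _ := ENNReal.ofReal_le_ofReal (by linarith)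
end

section
/- Let (M,d,μ) be a doubling metric measure space and H_t a symmetric Markovian kernel satisfying the Chapman–Kolmogorov identity and two-sided Gaussian bounds. Let p ∈ (1,∞), q ∈ [1,∞], c > 0, and let F : [0,∞) × M → ℝ be jointly measurable. Assume there exist jointly measurable functions F₁, F₂ : [0,∞) × M → ℝ, each continuous in t ∈ [0,∞) for every fixed x ∈ M, constants δ, ε ≥ 0 and constants C₁, C₂ > 0 such that (1) T_{ct}|F(t,·)|(x) ≤ C₁ T_{δs}|F₁(s,·)|(x) for all s > 0, t ∈ [s,2s] and x ∈ M, and (2) |F₁(t,x)| ≤ C₂ T_{εs}|F₂(s,·)|(x) for all s > 0, t ∈ [s/2,s] and x ∈ M. Then there is a constant C > 0, independent of F, F₁, F₂, with ‖ (t,x) ↦ T_{ct}|F(t,·)|(x) ‖_{L^p(L^q_+)} ≤ C ‖ F₂ ‖_{L^p(L^q_+)}. -/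
open MeasureTheory Metric Set

variable {M : Type*} [MetricSpace M] [MeasurableSpace M]

/-- The operator `T_t` associated with a kernel `H`, with the convention `T_0 f = f`. -/
noncomputable def Tt (μ : Measure M) (H : ℝ → M → M → ℝ) (t : ℝ) (f : M → ℝ) (x : M) : ℝ :=
  if t = 0 then f x else ∫ y, H t x y * f y ∂μ

/-- The `L^q((0,∞), dt/t)` norm of a `(0,∞)`-indexed family in `[0,∞]`,
with the supremum when `q = ∞`. -/
noncomputable def qIntNorm (q : ENNReal) (G : ℝ → ENNReal) : ENNReal :=
  if q = ⊤ then ⨆ t ∈ Ioi (0 : ℝ), G t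
  else (∫⁻ t in Ioi (0 : ℝ), G t ^ q.toReal * ENNReal.ofReal t⁻¹) ^ (1 / q.toReal)

/-- The mixed norm `‖F‖_{L^p(L^q_+)}`. -/
noncomputable def LpLqNorm (μ : Measure M) (p : ℝ) (q : ENNReal) (F : ℝ → M → ℝ) : ENNReal :=
  (∫⁻ x, qIntNorm q (fun t => ENNReal.ofReal |F t x|) ^ p ∂μ) ^ (1 / p)


set_option linter.unusedSectionVars false


noncomputable def Pop {X : Type*} [MeasurableSpace X] (μ : Measure X) (k : X → X → ENNReal) (f : X → ENNReal) (x : X) : ENNReal :=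
  ∫⁻ y, k x y * f y ∂μ

noncomputable def Ssum {X : Type*} [MeasurableSpace X] (μ : Measure X) (k : X → X → ENNReal) (g : X → ENNReal) : ℕ → X → ENNReal
  | 0 => fun _ => 0
  | (n+1) => fun x => g x + Pop μ k (Ssum μ k g n) x

noncomputable def hfill {X : Type*} [MeasurableSpace X] (μ : Measure X) (k : X → X → ENNReal) (g e : X → ENNReal) : ℕ → X → ENNReal
  | 0 => fun _ => 0
  | (n+1) => fun x => g x + Pop μ k (hfill μ k g e n) x - e x


section abs
variable {X : Type*} [MeasurableSpace X] {μ : Measure X} [SFinite μ] {k : X → X → ENNReal}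

lemma Pop_meas (hk : Measurable (fun z : X × X => k z.1 z.2)) {f : X → ENNReal} (hf : Measurable f) :
    Measurable (Pop μ k f) := by
  unfold Pop
  exact Measurable.lintegral_prod_right' (f := fun z : X × X => k z.1 z.2 * f z.2)
    (hk.mul (hf.comp measurable_snd))

lemma Pop_mono {f g : X → ENNReal} (h : ∀ x, f x ≤ g x) (x : X) : Pop μ k f x ≤ Pop μ k g x :=
  lintegral_mono fun y => by gcongr; exact h y

lemma k_meas (hk : Measurable (fun z : X × X => k z.1 z.2)) (x : X) : Measurable (k x) :=
  hk.comp (measurable_const.prodMk measurable_id)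

lemma kf_meas (hk : Measurable (fun z : X × X => k z.1 z.2)) {f : X → ENNReal} (hf : Measurable f) (x : X) :
    Measurable (fun y => k x y * f y) := (k_meas hk x).mul hf

lemma Pop_add (hk : Measurable (fun z : X × X => k z.1 z.2)) {f g : X → ENNReal} (hf : Measurable f)
    (x : X) : Pop μ k (fun y => f y + g y) x = Pop μ k f x + Pop μ k g x := by
  unfold Pop
  rw [← lintegral_add_left (kf_meas hk hf x)]
  simp [mul_add]

lemma Pop_const (hk : Measurable (fun z : X × X => k z.1 z.2)) (hrow : ∀ x, ∫⁻ y, k x y ∂μ = 1)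
    (c : ENNReal) (x : X) : Pop μ k (fun _ => c) x = c := by
  unfold Pop
  rw [lintegral_mul_const _ (k_meas hk x), hrow, one_mul]

lemma Pop_int_mul (hk : Measurable (fun z : X × X => k z.1 z.2)) (hsymm : ∀ x y, k x y = k y x)
    {f g : X → ENNReal} (hf : Measurable f) (hg : Measurable g) :
    ∫⁻ x, Pop μ k f x * g x ∂μ = ∫⁻ x, f x * Pop μ k g x ∂μ := by
  unfold Pop
  have h1 : ∀ x, (∫⁻ y, k x y * f y ∂μ) * g x = ∫⁻ y, k x y * f y * g x ∂μ := fun x => by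
    rw [lintegral_mul_const _ (kf_meas hk hf x)]
  have h2 : ∀ x, f x * (∫⁻ y, k x y * g y ∂μ) = ∫⁻ y, f x * (k x y * g y) ∂μ := fun x => by
    rw [lintegral_const_mul _ (kf_meas hk hg x)]
  simp_rw [h1, h2]
  rw [lintegral_lintegral_swap]
  · refine lintegral_congr fun x => lintegral_congr fun y => ?_
    rw [hsymm x y]; ring
  · exact ((hk.mul (hf.comp measurable_snd)).mul (hg.comp measurable_fst)).aemeasurable

lemma Pop_int (hk : Measurable (fun z : X × X => k z.1 z.2)) (hsymm : ∀ x y, k x y = k y x)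
    (hrow : ∀ x, ∫⁻ y, k x y ∂μ = 1) {f : X → ENNReal} (hf : Measurable f) :
    ∫⁻ x, Pop μ k f x ∂μ = ∫⁻ x, f x ∂μ := by
  have := Pop_int_mul (μ := μ) hk hsymm hf (g := fun _ => 1) measurable_const
  simpa [Pop_const hk hrow] using this

lemma Ssum_meas (hk : Measurable (fun z : X × X => k z.1 z.2)) {f : X → ENNReal} (hf : Measurable f) (n : ℕ) :
    Measurable (Ssum μ k f n) := by
  induction n with
  | zero => exact measurable_const
  | succ n ih => exact hf.add (Pop_meas hk ih)

lemma Ssum_mono {f g : X → ENNReal} (h : ∀ x, f x ≤ g x) (n : ℕ) : ∀ x, Ssum μ k f n x ≤ Ssum μ k g n x := by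
  induction n with
  | zero => intro x; exact le_rfl
  | succ n ih => exact fun x => add_le_add (h x) (Pop_mono ih x)

lemma Ssum_const (hk : Measurable (fun z : X × X => k z.1 z.2)) (hrow : ∀ x, ∫⁻ y, k x y ∂μ = 1)
    (c : ENNReal) (n : ℕ) : ∀ x, Ssum μ k (fun _ => c) n x = n * c := by
  induction n with
  | zero => intro x; simp [Ssum]
  | succ n ih =>
    intro x
    have : Ssum μ k (fun _ => c) n = fun _ => n * c := funext ih
    simp only [Ssum, this, Pop_const hk hrow]
    push_cast; ring

lemma Ssum_add (hk : Measurable (fun z : X × X => k z.1 z.2)) {f g : X → ENNReal} (hf : Measurable f)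
    (n : ℕ) : ∀ x, Ssum μ k (fun y => f y + g y) n x = Ssum μ k f n x + Ssum μ k g n x := by
  induction n with
  | zero => intro x; simp [Ssum]
  | succ n ih =>
    intro x
    have : Ssum μ k (fun y => f y + g y) n = fun x => Ssum μ k f n x + Ssum μ k g n x := funext ih
    simp only [Ssum, this, Pop_add hk (Ssum_meas hk hf n)]
    ring

lemma Ssum_int (hk : Measurable (fun z : X × X => k z.1 z.2)) (hsymm : ∀ x y, k x y = k y x)
    (hrow : ∀ x, ∫⁻ y, k x y ∂μ = 1) {f : X → ENNReal} (hf : Measurable f) (n : ℕ) :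
    ∫⁻ x, Ssum μ k f n x ∂μ = n * ∫⁻ x, f x ∂μ := by
  induction n with
  | zero => simp [Ssum]
  | succ n ih =>
    simp only [Ssum]
    rw [lintegral_add_left hf, Pop_int hk hsymm hrow (Ssum_meas hk hf n), ih]
    push_cast; ring

lemma hfill_meas (hk : Measurable (fun z : X × X => k z.1 z.2)) {g e : X → ENNReal} (hg : Measurable g)
    (he : Measurable e) (n : ℕ) : Measurable (hfill μ k g e n) := by
  induction n with
  | zero => exact measurable_const
  | succ n ih => exact (hg.add (Pop_meas hk ih)).sub he

lemma hfill_succ {g e : X → ENNReal} (n : ℕ) :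
    ∀ x, hfill μ k g e n x ≤ hfill μ k g e (n+1) x := by
  induction n with
  | zero => intro x; exact zero_le
  | succ n ih => exact fun x => tsub_le_tsub_right (add_le_add le_rfl (Pop_mono ih x)) _

lemma hfill_le {g e : X → ENNReal} (n : ℕ) : ∀ x, hfill μ k g e n x ≤ Ssum μ k g n x := by
  induction n with
  | zero => intro x; exact le_rfl
  | succ n ih => exact fun x => tsub_le_self.trans (add_le_add le_rfl (Pop_mono ih x))

lemma Ssum_le_hfill (hk : Measurable (fun z : X × X => k z.1 z.2)) {g e : X → ENNReal} (hg : Measurable g)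
    (he : Measurable e) (n : ℕ) :
    ∀ x, Ssum μ k g n x ≤ hfill μ k g e n x + Ssum μ k e n x := by
  induction n with
  | zero => intro x; simp [Ssum]
  | succ n ih =>
    intro x
    simp only [Ssum, hfill]
    calc g x + Pop μ k (Ssum μ k g n) x ≤ g x + (Pop μ k (hfill μ k g e n) x + Pop μ k (Ssum μ k e n) x) := by
          rw [← Pop_add hk (hfill_meas hk hg he n)]
          exact add_le_add le_rfl (Pop_mono ih x)
      _ = (g x + Pop μ k (hfill μ k g e n) x) + Pop μ k (Ssum μ k e n) x := by ring
      _ ≤ ((g x + Pop μ k (hfill μ k g e n) x - e x) + e x) + Pop μ k (Ssum μ k e n) x := by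
          exact add_le_add (le_tsub_add (a := e x)) le_rfl
      _ = _ := by ring

/-- Hopf's maximal ergodic inequality (weak type). -/
lemma hopf_fin (hk : Measurable (fun z : X × X => k z.1 z.2)) (hsymm : ∀ x y, k x y = k y x)
    (hrow : ∀ x, ∫⁻ y, k x y ∂μ = 1) {g : X → ENNReal} (hg : Measurable g) (l : ENNReal) (N : ℕ) :
    l * μ {x | ∃ n ≤ N, n * l < Ssum μ k g n x} ≤ ∫⁻ x, g x ∂μ := by
  by_cases hfin : ∫⁻ x, g x ∂μ = ⊤
  · rw [hfin]; exact le_top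
  set E := {x | ∃ n ≤ N, n * l < Ssum μ k g n x} with hE
  have hEm : MeasurableSet E := by
    have : E = ⋃ n ∈ Finset.range (N+1), {x | n * l < Ssum μ k g n x} := by
      ext x; simp [hE]
    rw [this]
    exact Finset.measurableSet_biUnion _ fun n _ => measurableSet_lt measurable_const (Ssum_meas hk hg n)
  set e : X → ENNReal := E.indicator (fun _ => l) with he
  have hem : Measurable e := measurable_const.indicator hEm
  have hel : ∀ x, e x ≤ l := fun x => by
    rw [he]; exact indicator_le_self' (by simp) x
  have hmono : Monotone (fun n => hfill μ k g e n) :=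
    monotone_nat_of_le_succ fun n x => hfill_succ n x
  have key : ∀ x, hfill μ k g e (N+1) x + e x = g x + Pop μ k (hfill μ k g e N) x := by
    intro x
    by_cases hx : x ∈ E
    · obtain ⟨n, hn, hlt⟩ := hx
      have h1 := Ssum_le_hfill (μ := μ) hk hg hem n x
      have h2 : Ssum μ k e n x ≤ n * l := by
        rw [← Ssum_const (μ := μ) hk hrow l n x]; exact Ssum_mono hel n x
      have h3 : 0 < hfill μ k g e n x := by
        rw [pos_iff_ne_zero]; intro h0
        rw [h0, zero_add] at h1
        exact absurd (hlt.trans_le (h1.trans h2)) (lt_irrefl _)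
      have h4 : 0 < hfill μ k g e (N+1) x := h3.trans_le (hmono (hn.trans (Nat.le_succ N)) x)
      have h5 : e x ≤ g x + Pop μ k (hfill μ k g e N) x := by
        simp only [hfill] at h4
        exact (tsub_pos_iff_lt.1 h4).le
      simp only [hfill]
      exact tsub_add_cancel_of_le h5
    · have : e x = 0 := by rw [he]; simp [hx]
      simp [hfill, this]
  have hi : ∫⁻ x, hfill μ k g e (N+1) x ∂μ + ∫⁻ x, e x ∂μ ≤
      ∫⁻ x, hfill μ k g e (N+1) x ∂μ + ∫⁻ x, g x ∂μ := by
    rw [← lintegral_add_left (hfill_meas hk hg hem _), lintegral_congr key, lintegral_add_left hg,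
      Pop_int hk hsymm hrow (hfill_meas hk hg hem _), add_comm]
    gcongr with x
    exact hfill_succ N x
  have hne : ∫⁻ x, hfill μ k g e (N+1) x ∂μ ≠ ⊤ := by
    refine ne_top_of_le_ne_top ?_ (lintegral_mono (hfill_le (N+1)))
    rw [Ssum_int hk hsymm hrow hg]
    exact ENNReal.mul_ne_top (by simp) hfin
  have := (ENNReal.add_le_add_iff_left hne).1 hi
  rwa [he, lintegral_indicator_const hEm] at this

lemma hopf (hk : Measurable (fun z : X × X => k z.1 z.2)) (hsymm : ∀ x y, k x y = k y x)
    (hrow : ∀ x, ∫⁻ y, k x y ∂μ = 1) {g : X → ENNReal} (hg : Measurable g) (l : ENNReal) :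
    l * μ {x | ∃ n : ℕ, n * l < Ssum μ k g n x} ≤ ∫⁻ x, g x ∂μ := by
  have : {x | ∃ n : ℕ, n * l < Ssum μ k g n x} = ⋃ N : ℕ, {x | ∃ n ≤ N, n * l < Ssum μ k g n x} := by
    ext x; simp only [mem_ofPred_eq, mem_iUnion]
    constructor
    · rintro ⟨n, h⟩; exact ⟨n, n, le_rfl, h⟩
    · rintro ⟨N, n, _, h⟩; exact ⟨n, h⟩
  rw [this, Monotone.measure_iUnion, ENNReal.mul_iSup]
  · exact iSup_le fun N => hopf_fin hk hsymm hrow hg l N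
  · intro a b hab x
    rintro ⟨n, hn, h⟩; exact ⟨n, hn.trans hab, h⟩

noncomputable def Astar {X : Type*} [MeasurableSpace X] (μ : Measure X) (k : X → X → ENNReal) (g : X → ENNReal) (x : X) : ENNReal :=
  ⨆ n : ℕ, Ssum μ k g n x / n

lemma Astar_meas (hk : Measurable (fun z : X × X => k z.1 z.2)) {f : X → ENNReal} (hf : Measurable f) :
    Measurable (Astar μ k f) :=
  Measurable.iSup fun n => (Ssum_meas hk hf n).div measurable_const

/-- improved weak type -/
lemma weak (hk : Measurable (fun z : X × X => k z.1 z.2)) (hsymm : ∀ x y, k x y = k y x)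
    (hrow : ∀ x, ∫⁻ y, k x y ∂μ = 1) {f : X → ENNReal} (hf : Measurable f) (l : ℝ) :
    ENNReal.ofReal l * μ {x | ENNReal.ofReal l < Astar μ k f x} ≤
      2 * ∫⁻ x, f x * {x | ENNReal.ofReal l < 2 * f x}.indicator 1 x ∂μ := by
  set m := ENNReal.ofReal (l/2) with hm
  have hlm : ENNReal.ofReal l = 2 * m := by
    rw [hm, ← ENNReal.ofReal_ofNat, ← ENNReal.ofReal_mul (by norm_num)]; congr 1; ring
  have hg : Measurable (fun x => f x - m) := hf.sub measurable_const
  have h1 := hopf (μ := μ) hk hsymm hrow hg m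
  have hsub : {x | ENNReal.ofReal l < Astar μ k f x} ⊆ {x | ∃ n : ℕ, n * m < Ssum μ k (fun x => f x - m) n x} := by
    intro x hx
    simp only [mem_ofPred_eq, Astar, lt_iSup_iff] at hx ⊢
    obtain ⟨n, hn⟩ := hx
    refine ⟨n, ?_⟩
    have h0 : n ≠ 0 := by
      rintro rfl; simp [Ssum] at hn
    have h2 : Ssum μ k f n x ≤ Ssum μ k (fun x => f x - m) n x + n * m := by
      rw [← Ssum_const (μ := μ) hk hrow m n x, ← Ssum_add hk hg]
      exact Ssum_mono (fun x => le_tsub_add) n x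
    rw [ENNReal.lt_div_iff_mul_lt (by simp [h0]) (by simp)] at hn
    rw [hlm] at hn
    have h3 := hn.trans_le h2
    have h4 : 2 * m * n = n * m + n * m := by ring
    rw [h4] at h3
    exact lt_of_add_lt_add_right h3
  calc _ ≤ 2 * (m * μ {x | ∃ n : ℕ, n * m < Ssum μ k (fun x => f x - m) n x}) := by
        rw [hlm, mul_assoc]; rw [← hlm]; gcongr
    _ ≤ 2 * ∫⁻ x, (f x - m) ∂μ := by gcongr
    _ ≤ _ := by
      gcongr with x
      by_cases hx : ENNReal.ofReal l < 2 * f x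
      · simp [hx]
      · have : f x - m = 0 := by
          rw [not_lt, hlm] at hx
          rw [tsub_eq_zero_iff_le]
          rwa [ENNReal.mul_le_mul_iff_right (by simp) (by simp)] at hx
        rw [this]; exact zero_le

lemma layer (a : ℝ) (ha : 0 < a) (x : ENNReal) :
    ∫⁻ l in Ioi (0:ℝ), ENNReal.ofReal (l^(a-1)) * {l : ℝ | ENNReal.ofReal l < x}.indicator 1 l = x^a / ENNReal.ofReal a := by
  have hfin : ∀ r : ℝ, 0 ≤ r → ∫⁻ l in Ioi (0:ℝ), ENNReal.ofReal (l^(a-1)) * {l : ℝ | ENNReal.ofReal l < ENNReal.ofReal r}.indicator 1 l = (ENNReal.ofReal r)^a / ENNReal.ofReal a := by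
    intro r hr
    have h1 : ∫⁻ l in Ioi (0:ℝ), ENNReal.ofReal (l^(a-1)) * {l : ℝ | ENNReal.ofReal l < ENNReal.ofReal r}.indicator 1 l
        = ∫⁻ l in Ioo (0:ℝ) r, ENNReal.ofReal (l^(a-1)) := by
      rw [← lintegral_indicator measurableSet_Ioi, ← lintegral_indicator measurableSet_Ioo]
      refine lintegral_congr fun l => ?_
      by_cases h0 : 0 < l
      · by_cases h1 : l < r
        · have : ENNReal.ofReal l < ENNReal.ofReal r := (ENNReal.ofReal_lt_ofReal_iff (h0.trans h1)).2 h1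
          simp [h0, h1, this]
        · have : ¬ ENNReal.ofReal l < ENNReal.ofReal r := not_lt.2 (ENNReal.ofReal_le_ofReal (not_lt.1 h1))
          simp [h0, h1, this]
      · simp [h0]
    rw [h1, restrict_Ioo_eq_restrict_Ioc, ← ofReal_integral_eq_lintegral_ofReal]
    · rw [← intervalIntegral.integral_of_le hr, integral_rpow (Or.inl (by linarith))]
      rw [ENNReal.ofReal_rpow_of_nonneg hr ha.le, ← ENNReal.ofReal_div_of_pos ha]
      simp [Real.zero_rpow ha.ne']
    · have := (intervalIntegral.intervalIntegrable_rpow' (a := 0) (b := r) (r := a - 1) (by linarith))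
      rwa [intervalIntegrable_iff_integrableOn_Ioc_of_le hr] at this
    · filter_upwards [ae_restrict_mem measurableSet_Ioc] with l hl
      exact Real.rpow_nonneg hl.1.le _
  induction x with
  | coe r => 
    have := hfin r r.2
    simpa using this
  | top =>
    rw [ENNReal.top_rpow_of_pos ha, ENNReal.top_div_of_ne_top ENNReal.ofReal_ne_top, eq_top_iff]
    have h2 : ∀ n : ℕ, (ENNReal.ofReal n)^a / ENNReal.ofReal a ≤ ∫⁻ l in Ioi (0:ℝ), ENNReal.ofReal (l^(a-1)) * {l : ℝ | ENNReal.ofReal l < ⊤}.indicator 1 l := by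
      intro n
      rw [← hfin n (by positivity)]
      gcongr
      exact le_top
    have h3 : Filter.Tendsto (fun n : ℕ => (ENNReal.ofReal n)^a / ENNReal.ofReal a) Filter.atTop (nhds ⊤) := by
      have : Filter.Tendsto (fun n : ℕ => (ENNReal.ofReal n)) Filter.atTop (nhds ⊤) := by
        simpa using ENNReal.tendsto_nat_nhds_top
      have h4 := (ENNReal.continuous_rpow_const (y := a)).tendsto ⊤ |>.comp this
      rw [ENNReal.top_rpow_of_pos ha] at h4
      have h5 := ENNReal.Tendsto.div_const h4 (b := ENNReal.ofReal a) (Or.inl (by simp))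
      rwa [ENNReal.top_div_of_ne_top ENNReal.ofReal_ne_top] at h5
    exact le_of_tendsto' h3 h2
end abs


section abs2
variable {X : Type*} [MeasurableSpace X] {μ : Measure X} [SFinite μ] {k : X → X → ENNReal}

lemma ind_meas {A : X → ENNReal} (hA : Measurable A) :
    Measurable (fun z : X × ℝ => {l : ℝ | ENNReal.ofReal l < A z.1}.indicator (1 : ℝ → ENNReal) z.2) := by
  have h : MeasurableSet {z : X × ℝ | ENNReal.ofReal z.2 < A z.1} :=
    measurableSet_lt (ENNReal.measurable_ofReal.comp measurable_snd) (hA.comp measurable_fst)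
  have : (fun z : X × ℝ => {l : ℝ | ENNReal.ofReal l < A z.1}.indicator (1 : ℝ → ENNReal) z.2)
      = {z : X × ℝ | ENNReal.ofReal z.2 < A z.1}.indicator (fun _ => 1) := by
    ext z; simp [indicator]
  rw [this]; exact measurable_const.indicator h

lemma pw_meas (a : ℝ) : Measurable (fun z : X × ℝ => ENNReal.ofReal (z.2 ^ a)) := by fun_prop

/-- Strong type maximal ergodic theorem. -/
lemma strong (hk : Measurable (fun z : X × X => k z.1 z.2)) (hsymm : ∀ x y, k x y = k y x)
    (hrow : ∀ x, ∫⁻ y, k x y ∂μ = 1) {f : X → ENNReal} (hf : Measurable f) (r : ℝ) (hr : 1 < r) :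
    ∫⁻ x, Astar μ k f x ^ r ∂μ ≤
      (ENNReal.ofReal r * (2 * (2 ^ (r-1) / ENNReal.ofReal (r-1)))) * ∫⁻ x, f x ^ r ∂μ := by
  set A := Astar μ k f with hA
  have hAm : Measurable A := Astar_meas hk hf
  have hr0 : 0 < r := by linarith
  have hr1 : 0 < r - 1 := by linarith
  have e1 : ∀ x, A x ^ r = ENNReal.ofReal r * ∫⁻ l in Ioi (0:ℝ), ENNReal.ofReal (l^(r-1)) * {l : ℝ | ENNReal.ofReal l < A x}.indicator 1 l := by
    intro x
    rw [layer r hr0, ENNReal.mul_div_cancel (by simpa using hr0) ENNReal.ofReal_ne_top]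
  have hm1 : Measurable (fun z : X × ℝ => ENNReal.ofReal (z.2^(r-1)) * {l : ℝ | ENNReal.ofReal l < A z.1}.indicator 1 z.2) :=
    (pw_meas _).mul (ind_meas hAm)
  have hm2 : Measurable (fun z : X × ℝ => f z.1 * (ENNReal.ofReal (z.2^(r-1-1)) * {l : ℝ | ENNReal.ofReal l < 2 * f z.1}.indicator 1 z.2)) :=
    (hf.comp measurable_fst).mul ((pw_meas _).mul (ind_meas (hf.const_mul 2)))
  simp_rw [e1]
  rw [lintegral_const_mul _ (Measurable.lintegral_prod_right' hm1), mul_assoc]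
  gcongr
  rw [lintegral_lintegral_swap hm1.aemeasurable]
  calc ∫⁻ l in Ioi (0:ℝ), ∫⁻ x, ENNReal.ofReal (l^(r-1)) * {l : ℝ | ENNReal.ofReal l < A x}.indicator 1 l ∂μ
      ≤ ∫⁻ l in Ioi (0:ℝ), 2 * ∫⁻ x, f x * (ENNReal.ofReal (l^(r-1-1)) * {l : ℝ | ENNReal.ofReal l < 2 * f x}.indicator 1 l) ∂μ := by
        refine lintegral_mono_ae ?_
        filter_upwards [ae_restrict_mem measurableSet_Ioi] with l hl
        have hl0 : (0:ℝ) < l := hl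
        have hset : MeasurableSet {x | ENNReal.ofReal l < A x} := measurableSet_lt measurable_const hAm
        have i1 : ∫⁻ x, ENNReal.ofReal (l^(r-1)) * {l : ℝ | ENNReal.ofReal l < A x}.indicator 1 l ∂μ
            = ENNReal.ofReal (l^(r-1)) * μ {x | ENNReal.ofReal l < A x} := by
          have : ∀ x, {l : ℝ | ENNReal.ofReal l < A x}.indicator (1 : ℝ → ENNReal) l = {x | ENNReal.ofReal l < A x}.indicator 1 x := by
            intro x; simp [indicator]
          simp_rw [this]
          rw [lintegral_const_mul _ (measurable_one.indicator hset), lintegral_indicator_one hset]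
        have i2 : ∫⁻ x, f x * (ENNReal.ofReal (l^(r-1-1)) * {l : ℝ | ENNReal.ofReal l < 2 * f x}.indicator 1 l) ∂μ
            = ENNReal.ofReal (l^(r-1-1)) * ∫⁻ x, f x * {x | ENNReal.ofReal l < 2 * f x}.indicator 1 x ∂μ := by
          rw [← lintegral_const_mul]
          · refine lintegral_congr fun x => ?_
            simp only [indicator, mem_ofPred_eq, Pi.one_apply]; ring
          · exact hf.mul (measurable_one.indicator (measurableSet_lt measurable_const (hf.const_mul 2)))
        rw [i1, i2]
        have i3 : ENNReal.ofReal (l^(r-1)) = ENNReal.ofReal (l^(r-1-1)) * ENNReal.ofReal l := by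
          rw [← ENNReal.ofReal_mul (Real.rpow_nonneg hl0.le _), Real.rpow_sub_one hl0.ne' (r-1)]
          congr 1; field_simp
        rw [i3, mul_assoc, mul_left_comm 2]
        exact mul_le_mul_right (weak hk hsymm hrow hf l) _
    _ = 2 * ∫⁻ l in Ioi (0:ℝ), ∫⁻ x, f x * (ENNReal.ofReal (l^(r-1-1)) * {l : ℝ | ENNReal.ofReal l < 2 * f x}.indicator 1 l) ∂μ := by
        rw [lintegral_const_mul _ (Measurable.lintegral_prod_left' hm2)]
    _ = 2 * ∫⁻ x, f x * ((2 * f x) ^ (r-1) / ENNReal.ofReal (r-1)) ∂μ := by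
        rw [← lintegral_lintegral_swap hm2.aemeasurable]
        congr 1
        refine lintegral_congr fun x => ?_
        rw [lintegral_const_mul, layer _ hr1]
        exact (pw_meas _).comp (measurable_prodMk_left (x := x)) |>.mul ((ind_meas (hf.const_mul 2)).comp (measurable_prodMk_left (x := x)))
    _ = _ := by
        rw [mul_assoc, ← lintegral_const_mul _ (hf.pow_const _)]
        congr 1
        refine lintegral_congr fun x => ?_
        rw [ENNReal.mul_rpow_of_nonneg _ _ hr1.le]
        have : f x ^ r = f x * f x ^ (r-1) := by
          conv_lhs => rw [show r = 1 + (r-1) by ring]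
          rw [ENNReal.rpow_add_of_nonneg _ _ zero_le_one hr1.le, ENNReal.rpow_one]
        rw [this]; simp only [div_eq_mul_inv]; ring

lemma strong_const (r : ℝ) (hr : 1 < r) :
    (ENNReal.ofReal r * (2 * (2 ^ (r-1) / ENNReal.ofReal (r-1)))) ≠ ⊤ := by
  have : ENNReal.ofReal (r-1) ≠ 0 := by simpa using hr
  refine ENNReal.mul_ne_top ENNReal.ofReal_ne_top (ENNReal.mul_ne_top (by simp) (ENNReal.div_ne_top ?_ this))
  exact ENNReal.rpow_ne_top_of_nonneg (by linarith) (by simp)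

lemma dual [SigmaFinite μ] {r r' : ℝ} (hrr : r.HolderConjugate r') {G : X → ENNReal} (hG : Measurable G) (K : ENNReal)
    (h : ∀ g : X → ENNReal, Measurable g → ∫⁻ x, G x * g x ∂μ ≤ K * (∫⁻ x, g x ^ r' ∂μ) ^ (1/r')) :
    ∫⁻ x, G x ^ r ∂μ ≤ K ^ r := by
  have hr0 : 0 < r := hrr.pos
  have hr1 : 0 < r - 1 := hrr.sub_one_pos
  set Gn : ℕ → X → ENNReal := fun n => (spanningSets μ n).indicator (fun x => min (G x) n) with hGn
  have hGm : ∀ n, Measurable (Gn n) := fun n =>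
    (hG.min measurable_const).indicator (measurableSet_spanningSets μ n)
  have hle : ∀ n x, Gn n x ≤ G x := fun n x =>
    (indicator_le_self' (by simp) x).trans (min_le_left _ _)
  have hbd : ∀ n, ∫⁻ x, Gn n x ^ r ∂μ ≤ K ^ r := by
    intro n
    set I := ∫⁻ x, Gn n x ^ r ∂μ with hI
    have hfin : I ≠ ⊤ := by
      have : I ≤ ∫⁻ x, (spanningSets μ n).indicator (fun _ => (n : ENNReal)^r) x ∂μ := by
        refine lintegral_mono fun x => ?_
        by_cases hx : x ∈ spanningSets μ n
        · simp only [hGn, indicator_of_mem hx]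
          exact ENNReal.rpow_le_rpow (min_le_right _ _) hr0.le
        · simp [hGn, hx, hr0]
      refine ne_top_of_le_ne_top ?_ this
      rw [lintegral_indicator_const (measurableSet_spanningSets μ n)]
      exact ENNReal.mul_ne_top (ENNReal.rpow_ne_top_of_nonneg hr0.le (by simp)) (measure_spanningSets_lt_top μ n).ne
    have h1 : I ≤ K * I ^ (1/r') := by
      calc I ≤ ∫⁻ x, G x * Gn n x ^ (r-1) ∂μ := by
            refine lintegral_mono fun x => ?_
            have : Gn n x ^ r = Gn n x * Gn n x ^ (r-1) := by
              conv_lhs => rw [show r = 1 + (r-1) by ring]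
              rw [ENNReal.rpow_add_of_nonneg _ _ zero_le_one hr1.le, ENNReal.rpow_one]
            simp only [this]
            gcongr; exact hle n x
        _ ≤ _ := h _ ((hGm n).pow_const _)
        _ = _ := by
          simp_rw [← ENNReal.rpow_mul]
          rw [hrr.sub_one_mul_conj]
    by_cases h0 : I = 0
    · rw [h0]; exact zero_le
    have h2 : I = I ^ (1/r) * I ^ (1/r') := by
      rw [← ENNReal.rpow_add _ _ h0 hfin, one_div, one_div, hrr.inv_add_inv_eq_one, ENNReal.rpow_one]
    have h3 : I ^ (1/r) ≤ K := by
      have h4 : I ^ (1/r) * I ^ (1/r') ≤ K * I ^ (1/r') := h2 ▸ h1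
      refine (ENNReal.mul_le_mul_iff_left ?_ ?_).1 h4
      · exact (ENNReal.rpow_pos (pos_iff_ne_zero.2 h0) hfin).ne'
      · exact ENNReal.rpow_ne_top_of_nonneg (by have := hrr.symm.pos; positivity) hfin
    calc I = (I ^ (1/r))^r := by rw [← ENNReal.rpow_mul, one_div, inv_mul_cancel₀ hr0.ne', ENNReal.rpow_one]
      _ ≤ _ := by gcongr
  have hlim : ∀ x, Filter.Tendsto (fun n => Gn n x ^ r) Filter.atTop (nhds (G x ^ r)) := by
    intro x
    refine ((ENNReal.continuous_rpow_const (y := r)).tendsto _).comp ?_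
    have h1 : Filter.Tendsto (fun n : ℕ => min (G x) (n:ENNReal)) Filter.atTop (nhds (min (G x) ⊤)) :=
      tendsto_const_nhds.min ENNReal.tendsto_nat_nhds_top
    rw [min_eq_left le_top] at h1
    refine h1.congr' ?_
    filter_upwards [Filter.eventually_ge_atTop (spanningSetsIndex μ x)] with n hn
    have : x ∈ spanningSets μ n := mem_spanningSets_of_index_le μ x hn
    simp [hGn, this]
  calc ∫⁻ x, G x ^ r ∂μ = ∫⁻ x, Filter.liminf (fun n => Gn n x ^ r) Filter.atTop ∂μ :=
        lintegral_congr fun x => ((hlim x).liminf_eq).symm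
    _ ≤ Filter.liminf (fun n => ∫⁻ x, Gn n x ^ r ∂μ) Filter.atTop :=
        lintegral_liminf_le fun n => (hGm n).pow_const r
    _ ≤ K ^ r := by
        refine (Filter.liminf_le_liminf (Filter.Eventually.of_forall hbd)).trans ?_
        simp

lemma Pop_holder (hk : Measurable (fun z : X × X => k z.1 z.2)) {q q' : ℝ} (hq : q.HolderConjugate q')
    {f g : X → ENNReal} (hf : Measurable f) (hg : Measurable g) (x : X) :
    Pop μ k (fun y => f y * g y) x ≤ (Pop μ k (fun y => f y ^ q) x) ^ (1/q) * (Pop μ k (fun y => g y ^ q') x) ^ (1/q') := by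
  have key : ∀ h : X → ENNReal, Measurable h → Pop μ k h x = ∫⁻ y, h y ∂(μ.withDensity (k x)) := fun h hh => by
    rw [lintegral_withDensity_eq_lintegral_mul _ (k_meas hk x) hh]; rfl
  have hfg : Measurable (fun y => f y * g y) := hf.mul hg
  rw [key _ hfg, key _ (hf.pow_const q), key _ (hg.pow_const q')]
  exact ENNReal.lintegral_mul_le_Lp_mul_Lq _ hq hf.aemeasurable hg.aemeasurable

lemma Pop_jensen (hk : Measurable (fun z : X × X => k z.1 z.2)) (hrow : ∀ x, ∫⁻ y, k x y ∂μ = 1) {q : ℝ} (hq : 1 ≤ q)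
    {f : X → ENNReal} (hf : Measurable f) (x : X) :
    Pop μ k f x ^ q ≤ Pop μ k (fun y => f y ^ q) x := by
  rcases hq.eq_or_lt with rfl | hq
  · simp
  have hc := Real.HolderConjugate.conjExponent hq
  have := Pop_holder (μ := μ) hk hc hf (g := fun _ => 1) measurable_const x
  simp only [mul_one, ENNReal.one_rpow, Pop_const hk hrow] at this
  calc _ ≤ ((Pop μ k (fun y => f y ^ q) x) ^ (1/q))^q := by gcongr
    _ = _ := by rw [← ENNReal.rpow_mul, one_div, inv_mul_cancel₀ (by linarith), ENNReal.rpow_one]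

variable {T : Type*} [MeasurableSpace T] {ν : Measure T} [SFinite ν] {L : T → X → X → ENNReal}

lemma PopL_meas (hL : Measurable (fun z : (T × X) × X => L z.1.1 z.1.2 z.2)) {F : T → X → ENNReal}
    (hF : Measurable (fun z : T × X => F z.1 z.2)) :
    Measurable (fun z : T × X => Pop μ (L z.1) (F z.1) z.2) := by
  unfold Pop
  exact Measurable.lintegral_prod_right' (f := fun z : (T × X) × X => L z.1.1 z.1.2 z.2 * F z.1.1 z.2)
    (hL.mul (hF.comp ((measurable_fst.comp measurable_fst).prodMk measurable_snd)))

lemma L_meas (hL : Measurable (fun z : (T × X) × X => L z.1.1 z.1.2 z.2)) (t : T) :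
    Measurable (fun z : X × X => L t z.1 z.2) :=
  hL.comp (((measurable_const (a := t)).prodMk measurable_fst).prodMk measurable_snd)

lemma F_meas {F : T → X → ENNReal}
    (hF : Measurable (fun z : T × X => F z.1 z.2)) (t : T) : Measurable (F t) :=
  hF.comp (measurable_prodMk_left (x := t))

lemma Fi_meas {F : T → X → ENNReal}
    (hF : Measurable (fun z : T × X => F z.1 z.2)) : Measurable (fun x => ∫⁻ t, F t x ∂ν) :=
  Measurable.lintegral_prod_left' hF

lemma PopL_int (hL : Measurable (fun z : (T × X) × X => L z.1.1 z.1.2 z.2)) (hsymm : ∀ t x y, L t x y = L t y x)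
    (hrow : ∀ t x, ∫⁻ y, L t x y ∂μ = 1) {F : T → X → ENNReal}
    (hF : Measurable (fun z : T × X => F z.1 z.2)) :
    ∫⁻ x, ∫⁻ t, Pop μ (L t) (F t) x ∂ν ∂μ = ∫⁻ x, ∫⁻ t, F t x ∂ν ∂μ := by
  rw [lintegral_lintegral_swap (f := fun x t => Pop μ (L t) (F t) x)
      ((PopL_meas hL hF).comp measurable_swap).aemeasurable,
    lintegral_lintegral_swap (f := fun x t => F t x) (hF.comp measurable_swap).aemeasurable]
  exact lintegral_congr fun t => Pop_int (L_meas hL t) (hsymm t) (hrow t) (F_meas hF t)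

lemma T1 [SigmaFinite μ] (hL : Measurable (fun z : (T × X) × X => L z.1.1 z.1.2 z.2)) (hsymm : ∀ t x y, L t x y = L t y x)
    (hrow : ∀ t x, ∫⁻ y, L t x y ∂μ = 1)
    {Mx : (X → ENNReal) → X → ENNReal} (hMm : ∀ f, Measurable f → Measurable (Mx f))
    (hMle : ∀ t f x, Measurable f → Pop μ (L t) f x ≤ Mx f x)
    (hMr : ∀ r : ℝ, 1 < r → ∃ C : ENNReal, C ≠ ⊤ ∧ ∀ f, Measurable f → ∫⁻ x, Mx f x ^ r ∂μ ≤ C * ∫⁻ x, f x ^ r ∂μ)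
    (r : ℝ) (hr : 1 ≤ r) :
    ∃ C : ENNReal, C ≠ ⊤ ∧ ∀ F : T → X → ENNReal, Measurable (fun z : T × X => F z.1 z.2) →
      ∫⁻ x, (∫⁻ t, Pop μ (L t) (F t) x ∂ν) ^ r ∂μ ≤ C * ∫⁻ x, (∫⁻ t, F t x ∂ν) ^ r ∂μ := by
  rcases hr.eq_or_lt with rfl | hr
  · refine ⟨1, by simp, fun F hF => ?_⟩
    simp only [ENNReal.rpow_one, one_mul]
    rw [PopL_int hL hsymm hrow hF]
  have hc := Real.HolderConjugate.conjExponent hr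
  set r' := r.conjExponent
  obtain ⟨C, hC, hCM⟩ := hMr r' hc.symm.lt
  have hr0 : 0 < r := hc.pos
  have hr0' : 0 < r' := hc.symm.pos
  refine ⟨(C ^ (1/r'))^r, ?_, fun F hF => ?_⟩
  · exact ENNReal.rpow_ne_top_of_nonneg hr0.le (ENNReal.rpow_ne_top_of_nonneg (by positivity) hC)
  have hP := PopL_meas (μ := μ) hL hF
  have hd := dual (μ := μ) hc (Fi_meas (ν := ν) (F := fun t => Pop μ (L t) (F t)) hP)
    ((∫⁻ x, (∫⁻ t, F t x ∂ν) ^ r ∂μ) ^ (1/r) * C ^ (1/r')) ?_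
  · rw [ENNReal.mul_rpow_of_nonneg _ _ hr0.le, ← ENNReal.rpow_mul (∫⁻ x, (∫⁻ t, F t x ∂ν) ^ r ∂μ), one_div, inv_mul_cancel₀ hr0.ne', ENNReal.rpow_one, mul_comm] at hd
    exact hd
  intro g hg
  have hgm : Measurable (fun z : T × X => g z.2) := hg.comp measurable_snd
  calc ∫⁻ x, (∫⁻ t, Pop μ (L t) (F t) x ∂ν) * g x ∂μ
      = ∫⁻ x, ∫⁻ t, Pop μ (L t) (F t) x * g x ∂ν ∂μ := by
        refine lintegral_congr fun x => ?_
        rw [lintegral_mul_const]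
        exact hP.comp (measurable_prodMk_right (y := x))
    _ = ∫⁻ t, ∫⁻ x, Pop μ (L t) (F t) x * g x ∂μ ∂ν :=
        lintegral_lintegral_swap ((hP.mul hgm).comp measurable_swap).aemeasurable
    _ = ∫⁻ t, ∫⁻ x, F t x * Pop μ (L t) g x ∂μ ∂ν :=
        lintegral_congr fun t => Pop_int_mul (L_meas hL t) (hsymm t) (F_meas hF t) hg
    _ ≤ ∫⁻ t, ∫⁻ x, F t x * Mx g x ∂μ ∂ν := by
        gcongr with t x
        exact hMle t g x hg
    _ = ∫⁻ x, ∫⁻ t, F t x * Mx g x ∂ν ∂μ :=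
        lintegral_lintegral_swap (hF.mul ((hMm g hg).comp measurable_snd)).aemeasurable
    _ = ∫⁻ x, (∫⁻ t, F t x ∂ν) * Mx g x ∂μ := by
        refine lintegral_congr fun x => ?_
        rw [lintegral_mul_const]
        exact hF.comp (measurable_prodMk_right (y := x))
    _ ≤ (∫⁻ x, (∫⁻ t, F t x ∂ν) ^ r ∂μ) ^ (1/r) * (∫⁻ x, Mx g x ^ r' ∂μ) ^ (1/r') :=
        ENNReal.lintegral_mul_le_Lp_mul_Lq _ hc (Fi_meas hF).aemeasurable (hMm g hg).aemeasurable
    _ ≤ (∫⁻ x, (∫⁻ t, F t x ∂ν) ^ r ∂μ) ^ (1/r) * (C * ∫⁻ x, g x ^ r' ∂μ) ^ (1/r') := by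
        gcongr; exact hCM g hg
    _ = _ := by rw [ENNReal.mul_rpow_of_nonneg _ _ (by positivity), mul_assoc]

lemma T2a [SigmaFinite μ] (hL : Measurable (fun z : (T × X) × X => L z.1.1 z.1.2 z.2)) (hsymm : ∀ t x y, L t x y = L t y x)
    (hrow : ∀ t x, ∫⁻ y, L t x y ∂μ = 1)
    {Mx : (X → ENNReal) → X → ENNReal} (hMm : ∀ f, Measurable f → Measurable (Mx f))
    (hMle : ∀ t f x, Measurable f → Pop μ (L t) f x ≤ Mx f x)
    (hMr : ∀ r : ℝ, 1 < r → ∃ C : ENNReal, C ≠ ⊤ ∧ ∀ f, Measurable f → ∫⁻ x, Mx f x ^ r ∂μ ≤ C * ∫⁻ x, f x ^ r ∂μ)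
    (p q : ℝ) (hq : 1 ≤ q) (hqp : q ≤ p) :
    ∃ C : ENNReal, C ≠ ⊤ ∧ ∀ F : T → X → ENNReal, Measurable (fun z : T × X => F z.1 z.2) →
      ∫⁻ x, (∫⁻ t, Pop μ (L t) (F t) x ^ q ∂ν) ^ (p/q) ∂μ ≤ C * ∫⁻ x, (∫⁻ t, F t x ^ q ∂ν) ^ (p/q) ∂μ := by
  have h1 : 1 ≤ p/q := by rw [le_div_iff₀ (by linarith)]; linarith
  obtain ⟨C, hC, h⟩ := T1 (ν := ν) hL hsymm hrow hMm hMle hMr (p/q) h1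
  refine ⟨C, hC, fun F hF => le_trans ?_ (h (fun t x => F t x ^ q) (hF.pow_const q))⟩
  gcongr with x t
  exact Pop_jensen (L_meas hL t) (hrow t) hq (F_meas hF t) x

lemma T2b [SigmaFinite μ] (hL : Measurable (fun z : (T × X) × X => L z.1.1 z.1.2 z.2)) (hsymm : ∀ t x y, L t x y = L t y x)
    (hrow : ∀ t x, ∫⁻ y, L t x y ∂μ = 1)
    {Mx : (X → ENNReal) → X → ENNReal} (hMm : ∀ f, Measurable f → Measurable (Mx f))
    (hMle : ∀ t f x, Measurable f → Pop μ (L t) f x ≤ Mx f x)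
    (hMr : ∀ r : ℝ, 1 < r → ∃ C : ENNReal, C ≠ ⊤ ∧ ∀ f, Measurable f → ∫⁻ x, Mx f x ^ r ∂μ ≤ C * ∫⁻ x, f x ^ r ∂μ)
    (p q : ℝ) (hp : 1 < p) (hpq : p < q) :
    ∃ C : ENNReal, C ≠ ⊤ ∧ ∀ F : T → X → ENNReal, Measurable (fun z : T × X => F z.1 z.2) →
      (∀ x, ∫⁻ t, F t x ^ q ∂ν = 0 → ∀ t, F t x = 0) →
      ∫⁻ x, (∫⁻ t, Pop μ (L t) (F t) x ^ q ∂ν) ^ (p/q) ∂μ ≤ C * ∫⁻ x, (∫⁻ t, F t x ^ q ∂ν) ^ (p/q) ∂μ := by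
  have hq1 : 1 < q := hp.trans hpq
  have hc := Real.HolderConjugate.conjExponent hq1
  have hq' : q.conjExponent = q / (q-1) := rfl
  set q' := q.conjExponent
  have hp0 : 0 < p := by linarith
  have hq0 : 0 < q := by linarith
  have hq10 : 0 < q - 1 := by linarith
  have hqp0 : 0 < q - p := by linarith
  have hq'0 : 0 < q' := hc.symm.pos
  set ρ := (q-1)*p/(q-p) with hρ
  have hρ1 : 1 < ρ := by rw [hρ, lt_div_iff₀ hqp0]; nlinarith
  obtain ⟨C, hC, hCM⟩ := hMr ρ hρ1
  set θ := p/q with hθ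
  have hθ0 : 0 < θ := by positivity
  have hθ1 : θ < 1 := by rw [hθ, div_lt_one hq0]; exact hpq
  have h1θ : 0 < 1 - θ := by linarith
  refine ⟨C ^ (1-θ) + 1, ?_, fun F hF hF0 => ?_⟩
  · exact ENNReal.add_ne_top.2 ⟨ENNReal.rpow_ne_top_of_nonneg h1θ.le hC, by simp⟩
  set Q : X → ENNReal := fun x => ∫⁻ t, F t x ^ q ∂ν with hQ
  have hQm : Measurable Q := Fi_meas (F := fun t x => F t x ^ q) (hF.pow_const q)
  change _ ≤ _ * ∫⁻ x, Q x ^ θ ∂μ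
  set I := ∫⁻ x, Q x ^ θ ∂μ with hI
  by_cases hIt : I = ⊤
  · rw [hIt, ENNReal.mul_top (by simp)]; exact le_top
  have hQfin : ∀ᵐ x ∂μ, Q x ≠ ⊤ := by
    filter_upwards [ae_lt_top (hQm.pow_const θ) hIt] with x hx hx2
    rw [hx2, ENNReal.top_rpow_of_pos hθ0] at hx
    exact lt_irrefl _ hx
  set β := (1-θ)/q with hβ
  have hβ0 : 0 < β := by positivity
  set W : X → ENNReal := fun x => (Q x ^ β) ^ q' with hW
  have hWm : Measurable W := (hQm.pow_const _).pow_const _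
  set E : T → X → ENNReal := fun t x => (F t x * Q x ^ (-β)) ^ q with hE
  have hEm0 : Measurable (fun z : T × X => F z.1 z.2 * Q z.2 ^ (-β)) := hF.mul ((hQm.comp measurable_snd).pow_const _)
  have hEm : Measurable (fun z : T × X => E z.1 z.2) := hEm0.pow_const _
  set B : X → ENNReal := fun x => ∫⁻ t, Pop μ (L t) (E t) x ∂ν with hB
  have hBm : Measurable B := Fi_meas (F := fun t => Pop μ (L t) (E t)) (PopL_meas hL hEm)
  have step1 : ∀ t x, Pop μ (L t) (F t) x ^ q ≤ Pop μ (L t) (E t) x * (Mx W x) ^ (q/q') := by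
    intro t x
    have h1 : Pop μ (L t) (F t) x = Pop μ (L t) (fun y => (F t y * Q y ^ (-β)) * Q y ^ β) x := by
      refine lintegral_congr_ae ?_
      filter_upwards [hQfin] with y hy
      by_cases h0 : Q y = 0
      · rw [hF0 y h0 t]; simp
      · rw [mul_assoc (F t y), ← ENNReal.rpow_add _ _ h0 hy]; simp
    have h2 := Pop_holder (μ := μ) (L_meas hL t) hc (F_meas (F := fun t x => F t x * Q x ^ (-β)) hEm0 t) (hQm.pow_const β) x
    rw [← h1] at h2
    calc _ ≤ (Pop μ (L t) (E t) x ^ (1/q) * Pop μ (L t) W x ^ (1/q')) ^ q := by gcongr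
      _ = Pop μ (L t) (E t) x * Pop μ (L t) W x ^ (q/q') := by
        rw [ENNReal.mul_rpow_of_nonneg _ _ hq0.le, ← ENNReal.rpow_mul, ← ENNReal.rpow_mul, one_div,
          inv_mul_cancel₀ hq0.ne', ENNReal.rpow_one, one_div_mul_eq_div]
      _ ≤ _ := by
        gcongr
        exact hMle t W x hWm
  have step2 : ∀ x, (∫⁻ t, Pop μ (L t) (F t) x ^ q ∂ν) ^ θ ≤ B x ^ θ * (Mx W x ^ (q/q')) ^ θ := by
    intro x
    rw [← ENNReal.mul_rpow_of_nonneg _ _ hθ0.le]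
    gcongr
    rw [hB, ← lintegral_mul_const]
    · exact lintegral_mono fun t => step1 t x
    · exact (PopL_meas hL hEm).comp (measurable_prodMk_right (y := x))
  have hBI : ∫⁻ x, B x ∂μ ≤ I := by
    rw [hB, PopL_int hL hsymm hrow hEm]
    refine lintegral_mono fun x => ?_
    have h1 : ∫⁻ t, E t x ∂ν = Q x * (Q x ^ (-β)) ^ q := by
      simp only [hE, hQ]
      have hFx : Measurable (fun t => F t x ^ q) := (hF.pow_const q).comp (measurable_prodMk_right (y := x))
      rw [← lintegral_mul_const _ hFx]
      refine lintegral_congr fun t => ?_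
      rw [ENNReal.mul_rpow_of_nonneg _ _ hq0.le]
    simp only [h1]
    by_cases h0 : Q x = 0
    · simp [h0]
    by_cases ht : Q x = ⊤
    · rw [ht, ENNReal.top_rpow_of_pos hθ0]; exact le_top
    · rw [← ENNReal.rpow_mul]
      conv_lhs => rw [← ENNReal.rpow_one (Q x), ← ENNReal.rpow_mul, one_mul]
      rw [← ENNReal.rpow_add _ _ h0 ht]
      apply le_of_eq; congr 1
      rw [hβ]; field_simp; ring
  have hconj : (1/θ).HolderConjugate (1/(1-θ)) := by
    rw [Real.holderConjugate_iff]
    constructor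
    · rw [lt_div_iff₀ hθ0]; linarith
    · simp
  have hWI : ∫⁻ x, ((Mx W x ^ (q/q')) ^ θ) ^ (1/(1-θ)) ∂μ ≤ C * I := by
    have e1 : q/q'*θ*(1/(1-θ)) = ρ := by
      rw [hq', hθ, hρ]; 
      have : 1 - p/q = (q-p)/q := by field_simp
      rw [this]; field_simp
    have e2 : β * q' * ρ = θ := by
      have : 1 - p/q = (q-p)/q := by field_simp
      rw [hβ, hq', hθ, hρ, this]; field_simp
    simp_rw [← ENNReal.rpow_mul, e1]
    refine (hCM W hWm).trans (le_of_eq ?_)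
    simp_rw [hW, ← ENNReal.rpow_mul, e2]
    rfl
  calc _ ≤ ∫⁻ x, B x ^ θ * (Mx W x ^ (q/q')) ^ θ ∂μ := lintegral_mono step2
    _ ≤ (∫⁻ x, (B x ^ θ) ^ (1/θ) ∂μ) ^ (1/(1/θ)) * (∫⁻ x, ((Mx W x ^ (q/q')) ^ θ) ^ (1/(1-θ)) ∂μ) ^ (1/(1/(1-θ))) :=
        ENNReal.lintegral_mul_le_Lp_mul_Lq _ hconj (hBm.pow_const _).aemeasurable (((hMm W hWm).pow_const _).pow_const _).aemeasurable
    _ ≤ I ^ θ * (C * I) ^ (1-θ) := by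
        rw [one_div_one_div, one_div_one_div]
        gcongr
        simp_rw [← ENNReal.rpow_mul]
        rw [mul_one_div, div_self hθ0.ne']
        simpa using hBI
    _ = C ^ (1-θ) * I := by
        rw [ENNReal.mul_rpow_of_nonneg _ _ h1θ.le, mul_left_comm, ← ENNReal.rpow_add_of_nonneg _ _ hθ0.le h1θ.le]
        simp
    _ ≤ _ := by gcongr; exact le_self_add
end abs2


section conc
variable {X : Type*} [MeasurableSpace X] {μ : Measure X}

noncomputable def kH (H : ℝ → X → X → ℝ) (t : ℝ) (x y : X) : ENNReal := ENNReal.ofReal (H t x y)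

lemma kH_meas {H : ℝ → X → X → ℝ} (hH : Measurable fun p : ℝ × X × X => H p.1 p.2.1 p.2.2) (t : ℝ) :
    Measurable (fun z : X × X => kH H t z.1 z.2) :=
  ENNReal.measurable_ofReal.comp (hH.comp (measurable_prodMk_left (x := t)))

lemma Pop_sum [SFinite μ] {k : X → X → ENNReal} (hk : Measurable (fun z : X × X => k z.1 z.2)) (n : ℕ)
    {g : ℕ → X → ENNReal} (hg : ∀ j, Measurable (g j)) (x : X) :
    Pop μ k (fun y => ∑ j ∈ Finset.range n, g j y) x = ∑ j ∈ Finset.range n, Pop μ k (g j) x := by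
  unfold Pop
  simp_rw [Finset.mul_sum]
  exact lintegral_finsetSum _ fun j _ => kf_meas hk (hg j) x

lemma Pop_comp [SFinite μ] {H : ℝ → X → X → ℝ} (hH : Measurable fun p : ℝ × X × X => H p.1 p.2.1 p.2.2)
    (hck : ∀ s t x y, 0 < s → 0 < t → ∫⁻ z, kH H s x z * kH H t z y ∂μ = kH H (s+t) x y)
    {s t : ℝ} (hs : 0 < s) (ht : 0 < t) {f : X → ENNReal} (hf : Measurable f) (x : X) :
    Pop μ (kH H s) (Pop μ (kH H t) f) x = Pop μ (kH H (s+t)) f x := by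
  unfold Pop
  have h1 : ∀ y, kH H s x y * ∫⁻ z, kH H t y z * f z ∂μ = ∫⁻ z, kH H s x y * (kH H t y z * f z) ∂μ := fun y => by
    rw [lintegral_const_mul _ (kf_meas (kH_meas hH t) hf y)]
  simp_rw [h1]
  rw [lintegral_lintegral_swap]
  · refine lintegral_congr fun z => ?_
    rw [← hck s t x z hs ht, ← lintegral_mul_const]
    · refine lintegral_congr fun y => ?_
      ring
    · exact (k_meas (kH_meas hH s) x).mul ((kH_meas hH t).comp (measurable_prodMk_right (y := z)))
  · exact ((((k_meas (kH_meas hH s) x)).comp measurable_fst).mul ((kH_meas hH t).mul (hf.comp measurable_snd))).aemeasurable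

lemma Ssum_eq [SFinite μ] {H : ℝ → X → X → ℝ} (hH : Measurable fun p : ℝ × X × X => H p.1 p.2.1 p.2.2)
    (hck : ∀ s t x y, 0 < s → 0 < t → ∫⁻ z, kH H s x z * kH H t z y ∂μ = kH H (s+t) x y)
    {h : ℝ} (hh : 0 < h) {f : X → ENNReal} (hf : Measurable f) (n : ℕ) :
    ∀ x, Ssum μ (kH H h) f (n+1) x = f x + ∑ j ∈ Finset.range n, Pop μ (kH H ((j+1)*h)) f x := by
  induction n with
  | zero => intro x; simp [Ssum, Pop]
  | succ n ih =>
    intro x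
    rw [Ssum, funext ih]
    beta_reduce
    rw [Pop_add (kH_meas hH h) hf, Pop_sum (kH_meas hH h) n (fun j => Pop_meas (kH_meas hH _) hf),
      Finset.sum_range_succ', add_comm (Pop μ (kH H h) f x)]
    congr 2
    · refine Finset.sum_congr rfl fun j _ => ?_
      rw [Pop_comp hH hck hh (by positivity) hf]
      congr 2; push_cast; ring
    · simp

lemma Pop_le_Astar [SFinite μ] {H : ℝ → X → X → ℝ} (hH : Measurable fun p : ℝ × X × X => H p.1 p.2.1 p.2.2)
    (hck : ∀ s t x y, 0 < s → 0 < t → ∫⁻ z, kH H s x z * kH H t z y ∂μ = kH H (s+t) x y)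
    {κ : ℝ} (hκ : 1 ≤ κ) {Cc : ENNReal}
    (hcomp : ∀ s t x y, 0 < t → κ * t ≤ s → s ≤ 4 * (κ * t) → kH H t x y ≤ Cc * kH H s x y)
    {h t : ℝ} (hh : 0 < h) (ht : 0 < t) (hht : h ≤ t) {f : X → ENNReal} (hf : Measurable f) (x : X) :
    Pop μ (kH H t) f x ≤ 3 * Cc * Astar μ (kH H h) f x := by
  have hcp : ∀ s, κ * t ≤ s → s ≤ 4 * (κ * t) → Pop μ (kH H t) f x ≤ Cc * Pop μ (kH H s) f x := by
    intro s h1 h2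
    unfold Pop
    rw [← lintegral_const_mul _ (kf_meas (kH_meas hH s) hf x)]
    refine lintegral_mono fun y => ?_
    rw [← mul_assoc]
    exact mul_le_mul_left (hcomp s t x y ht h1 h2) _
  have hκt : h ≤ κ * t := by nlinarith
  set m := ⌈κ * t / h⌉₊ with hm
  have hm1 : κ * t ≤ m * h := by
    have := Nat.le_ceil (κ * t / h)
    rwa [div_le_iff₀ hh] at this
  have hm2 : m * h < κ * t + h := by
    have := Nat.ceil_lt_add_one (a := κ * t / h) (by positivity)
    rw [← hm] at this
    calc m * h < (κ * t / h + 1) * h := by gcongr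
      _ = _ := by field_simp
  have hm0 : 0 < m := by
    rw [hm, Nat.ceil_pos]; positivity
  have h1 : (m : ENNReal) * Pop μ (kH H t) f x ≤ Cc * Ssum μ (kH H h) f (2*m+1) x := by
    rw [Ssum_eq hH hck hh hf]
    calc (m : ENNReal) * Pop μ (kH H t) f x = ∑ j ∈ Finset.Ico m (2*m), Pop μ (kH H t) f x := by
          rw [Finset.sum_const, Nat.card_Ico, nsmul_eq_mul]; congr 2; omega
      _ ≤ ∑ j ∈ Finset.Ico m (2*m), Cc * Pop μ (kH H ((j+1)*h)) f x := by
          refine Finset.sum_le_sum fun j hj => hcp _ ?_ ?_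
          · rw [Finset.mem_Ico] at hj
            have : (m:ℝ) ≤ j := by exact_mod_cast hj.1
            nlinarith
          · rw [Finset.mem_Ico] at hj
            have : (j:ℝ) + 1 ≤ 2 * m := by exact_mod_cast hj.2
            nlinarith
      _ ≤ ∑ j ∈ Finset.range (2*m), Cc * Pop μ (kH H ((j+1)*h)) f x := by
          refine Finset.sum_le_sum_of_subset ?_
          intro j hj
          rw [Finset.mem_Ico] at hj; rw [Finset.mem_range]; exact hj.2
      _ = Cc * ∑ j ∈ Finset.range (2*m), Pop μ (kH H ((j+1)*h)) f x := by rw [Finset.mul_sum]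
      _ ≤ _ := by gcongr; exact le_add_self
  have h2 : Ssum μ (kH H h) f (2*m+1) x ≤ (m : ENNReal) * (3 * Astar μ (kH H h) f x) := by
    have h3 : Ssum μ (kH H h) f (2*m+1) x / ((2*m+1 : ℕ) : ENNReal) ≤ Astar μ (kH H h) f x :=
      le_iSup (fun n : ℕ => Ssum μ (kH H h) f n x / (n : ENNReal)) (2*m+1)
    rw [ENNReal.div_le_iff (by simp) (ENNReal.natCast_ne_top _)] at h3
    refine h3.trans ?_
    rw [mul_comm, ← mul_assoc]
    gcongr
    have : 2 * m + 1 ≤ m * 3 := by omega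
    exact_mod_cast this
  have h4 : (m : ENNReal) * Pop μ (kH H t) f x ≤ (m : ENNReal) * (3 * Cc * Astar μ (kH H h) f x) :=
    h1.trans <| (mul_le_mul_right h2 _).trans (le_of_eq (by ring))
  exact (ENNReal.mul_le_mul_iff_right (by simpa using hm0.ne') (by simp)).1 h4

noncomputable def Dmax (μ : Measure X) (H : ℝ → X → X → ℝ) (N : ℕ) (f : X → ENNReal) (x : X) : ENNReal :=
  ⨆ j : ℕ, Pop μ (kH H ((2:ℝ) ^ ((j:ℤ) - N))) f x

lemma exists_max [SFinite μ] {H : ℝ → X → X → ℝ} (hH : Measurable fun p : ℝ × X × X => H p.1 p.2.1 p.2.2)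
    (hsymm : ∀ t x y, 0 < t → kH H t x y = kH H t y x)
    (hrow : ∀ t x, 0 < t → ∫⁻ y, kH H t x y ∂μ = 1)
    (hck : ∀ s t x y, 0 < s → 0 < t → ∫⁻ z, kH H s x z * kH H t z y ∂μ = kH H (s+t) x y)
    {κ : ℝ} (hκ : 1 ≤ κ) {Cc : ENNReal} (hCc : Cc ≠ ⊤)
    (hcomp : ∀ s t x y, 0 < t → κ * t ≤ s → s ≤ 4 * (κ * t) → kH H t x y ≤ Cc * kH H s x y) :
    ∃ Mx : (X → ENNReal) → X → ENNReal, (∀ f, Measurable f → Measurable (Mx f)) ∧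
      (∀ f g, (∀ x, f x ≤ g x) → ∀ x, Mx f x ≤ Mx g x) ∧
      (∀ t f x, 0 < t → Measurable f → Pop μ (kH H t) f x ≤ Mx f x) ∧
      (∀ r : ℝ, 1 < r → ∃ C : ENNReal, C ≠ ⊤ ∧ ∀ f, Measurable f → ∫⁻ x, Mx f x ^ r ∂μ ≤ C * ∫⁻ x, f x ^ r ∂μ) := by
  have hDm : ∀ N f, Measurable f → Measurable (Dmax μ H N f) := fun N f hf =>
    Measurable.iSup fun j => Pop_meas (kH_meas hH _) hf
  refine ⟨fun f x => Cc * ⨆ N : ℕ, Dmax μ H N f x, ?_, ?_, ?_, ?_⟩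
  · intro f hf
    exact (Measurable.iSup fun N => hDm N f hf).const_mul _
  · intro f g hfg x
    refine mul_le_mul_right (iSup_mono fun N => iSup_mono fun j => Pop_mono hfg x) _
  · intro t f x ht hf
    obtain ⟨n, hn1, hn2⟩ := exists_mem_Ico_zpow (x := κ * t) (y := (2:ℝ)) (by positivity) (by norm_num)
    have h1 : Pop μ (kH H t) f x ≤ Cc * Pop μ (kH H ((2:ℝ)^(n+1))) f x := by
      unfold Pop
      rw [← lintegral_const_mul _ (kf_meas (kH_meas hH _) hf x)]
      refine lintegral_mono fun y => ?_
      rw [← mul_assoc]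
      refine mul_le_mul_left (hcomp _ t x y ht hn2.le ?_) _
      rw [zpow_add_one₀ (by norm_num)]
      have : 0 < κ * t := by positivity
      linarith
    refine h1.trans (mul_le_mul_right ?_ _)
    refine le_iSup_of_le (-(n+1)).toNat (le_iSup_of_le (n+1).toNat (le_of_eq ?_))
    rw [Int.toNat_sub_toNat_neg]
  · intro r hr
    have hr0 : 0 < r := by linarith
    refine ⟨Cc ^ r * ((3 * Cc) ^ r * (ENNReal.ofReal r * (2 * (2 ^ (r-1) / ENNReal.ofReal (r-1))))), ?_, ?_⟩
    · refine ENNReal.mul_ne_top (ENNReal.rpow_ne_top_of_nonneg hr0.le hCc) (ENNReal.mul_ne_top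
        (ENNReal.rpow_ne_top_of_nonneg hr0.le (ENNReal.mul_ne_top (by simp) hCc)) (strong_const r hr))
    intro f hf
    have hD : ∀ N, ∫⁻ x, Dmax μ H N f x ^ r ∂μ ≤ (3 * Cc) ^ r * (ENNReal.ofReal r * (2 * (2 ^ (r-1) / ENNReal.ofReal (r-1)))) * ∫⁻ x, f x ^ r ∂μ := by
      intro N
      have hpos : (0:ℝ) < 2 ^ (-(N:ℤ)) := by positivity
      calc _ ≤ ∫⁻ x, (3 * Cc) ^ r * (Astar μ (kH H (2 ^ (-(N:ℤ)))) f x) ^ r ∂μ := by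
            refine lintegral_mono fun x => ?_
            rw [← ENNReal.mul_rpow_of_nonneg _ _ hr0.le]
            refine ENNReal.rpow_le_rpow ?_ hr0.le
            refine iSup_le fun j => Pop_le_Astar hH hck hκ hcomp hpos (by positivity) ?_ hf x
            exact zpow_le_zpow_right₀ (by norm_num) (by omega)
        _ = (3 * Cc) ^ r * ∫⁻ x, (Astar μ (kH H (2 ^ (-(N:ℤ)))) f x) ^ r ∂μ := by
            rw [lintegral_const_mul _ ((Astar_meas (kH_meas hH _) hf).pow_const _)]
        _ ≤ _ := by
            rw [mul_assoc]
            exact mul_le_mul_right (strong (kH_meas hH _) (fun x y => hsymm _ x y hpos) (fun x => hrow _ x hpos) hf r hr) _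
    have e1 : ∀ x, (Cc * ⨆ N : ℕ, Dmax μ H N f x) ^ r = Cc ^ r * ⨆ N : ℕ, Dmax μ H N f x ^ r := by
      intro x
      rw [ENNReal.mul_rpow_of_nonneg _ _ hr0.le]
      congr 1
      exact (ENNReal.orderIsoRpow r hr0).map_iSup _
    simp_rw [e1]
    rw [lintegral_const_mul _ (Measurable.iSup fun N => (hDm N f hf).pow_const r),
      lintegral_iSup (fun N => (hDm N f hf).pow_const r), mul_assoc]
    · exact mul_le_mul_right (iSup_le hD) _
    · refine monotone_nat_of_le_succ fun N x => ENNReal.rpow_le_rpow ?_ hr0.le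
      refine iSup_le fun j => le_iSup_of_le (j+1) (le_of_eq ?_)
      congr 3; push_cast; ring

end conc

section geo

lemma vol_pos (μ : Measure M) (H : ℝ → M → M → ℝ) (C₀ b₀ : ℝ) (hC₀ : 0 < C₀)
    (hlower : ∀ t x y, 0 < t →
      C₀⁻¹ * Real.exp (-b₀ * dist x y ^ 2 / t) ≤
        H t x y *
          Real.sqrt
            ((μ (ball x (Real.sqrt t))).toReal * (μ (ball y (Real.sqrt t))).toReal)) (t : ℝ) (ht : 0 < t) (x : M) :
    0 < (μ (ball x (Real.sqrt t))).toReal := by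
  have h := hlower t x x ht
  have h1 : 0 < C₀⁻¹ * Real.exp (-b₀ * dist x x ^ 2 / t) := by positivity
  refine lt_of_le_of_ne ENNReal.toReal_nonneg fun h0 => ?_
  rw [← h0] at h
  simp only [mul_zero, Real.sqrt_zero] at h
  linarith

lemma compare (μ : Measure M) (c₀ D : ℝ) (hc₀ : 0 < c₀) (hD : 0 < D)
    (hdoub : ∀ (x : M) (r R : ℝ), 0 < r → 1 ≤ R →
      μ (ball x (R * r)) ≤ ENNReal.ofReal (c₀ * R ^ D) * μ (ball x r))
    (H : ℝ → M → M → ℝ)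
    (hHnonneg : ∀ t x y, 0 < t → 0 ≤ H t x y)
    (C₀ b₀ b₁ : ℝ) (hC₀ : 0 < C₀) (hb₁ : 0 < b₁)
    (hlower : ∀ t x y, 0 < t →
      C₀⁻¹ * Real.exp (-b₀ * dist x y ^ 2 / t) ≤
        H t x y *
          Real.sqrt
            ((μ (ball x (Real.sqrt t))).toReal * (μ (ball y (Real.sqrt t))).toReal))
    (hupper : ∀ t x y, 0 < t →
      H t x y *
          Real.sqrt
            ((μ (ball x (Real.sqrt t))).toReal * (μ (ball y (Real.sqrt t))).toReal) ≤
        C₀ * Real.exp (-b₁ * dist x y ^ 2 / t)) :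
    ∃ κ : ℝ, 1 ≤ κ ∧ ∃ Cc : ENNReal, Cc ≠ ⊤ ∧
      ∀ s t x y, 0 < t → κ * t ≤ s → s ≤ 4 * (κ * t) → kH H t x y ≤ Cc * kH H s x y := by
  set κ := max 1 (b₀/b₁) with hκ
  have hκ1 : 1 ≤ κ := le_max_left _ _
  have hκ2 : b₀ ≤ κ * b₁ := by
    have : b₀/b₁ ≤ κ := le_max_right _ _
    rwa [div_le_iff₀ hb₁] at this
  set c' := c₀ * (Real.sqrt (4*κ)) ^ D with hc'
  have hc'0 : 0 < c' := by positivity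
  refine ⟨κ, hκ1, ENNReal.ofReal (C₀ * C₀ * c'), ENNReal.ofReal_ne_top, ?_⟩
  intro s t x y ht h1 h2
  have hs : 0 < s := lt_of_lt_of_le (by positivity) h1
  have hts : t ≤ s := by nlinarith
  have hv := vol_pos μ H C₀ b₀ hC₀ hlower
  have hvol : ∀ z, (μ (ball z (Real.sqrt s))).toReal ≤ c' * (μ (ball z (Real.sqrt t))).toReal := by
    intro z
    have hst : 0 < Real.sqrt t := Real.sqrt_pos.2 ht
    have hR : 1 ≤ Real.sqrt s / Real.sqrt t := by
      rw [one_le_div hst]; exact Real.sqrt_le_sqrt hts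
    have hR2 : Real.sqrt s / Real.sqrt t ≤ Real.sqrt (4*κ) := by
      rw [div_le_iff₀ hst, ← Real.sqrt_mul (by positivity)]
      exact Real.sqrt_le_sqrt (by linarith)
    have h3 := hdoub z (Real.sqrt t) (Real.sqrt s / Real.sqrt t) hst hR
    rw [div_mul_cancel₀ _ hst.ne'] at h3
    have hfin : μ (ball z (Real.sqrt t)) ≠ ⊤ := by
      have := hv t ht z
      intro h; rw [h] at this; simp at this
    have h4 : μ (ball z (Real.sqrt s)) ≤ ENNReal.ofReal c' * μ (ball z (Real.sqrt t)) := by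
      refine h3.trans (mul_le_mul_left (ENNReal.ofReal_le_ofReal ?_) _)
      rw [hc']; gcongr
    have h5 := ENNReal.toReal_mono (ENNReal.mul_ne_top ENNReal.ofReal_ne_top hfin) h4
    rwa [ENNReal.toReal_mul, ENNReal.toReal_ofReal hc'0.le] at h5
  set Vt := Real.sqrt ((μ (ball x (Real.sqrt t))).toReal * (μ (ball y (Real.sqrt t))).toReal) with hVt
  set Vs := Real.sqrt ((μ (ball x (Real.sqrt s))).toReal * (μ (ball y (Real.sqrt s))).toReal) with hVs
  have hVt0 : 0 < Vt := Real.sqrt_pos.2 (mul_pos (hv t ht x) (hv t ht y))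
  have hVV : Vs ≤ c' * Vt := by
    rw [hVs, Real.sqrt_le_left (by positivity), mul_pow, hVt, Real.sq_sqrt (by positivity)]
    calc _ ≤ (c' * (μ (ball x (Real.sqrt t))).toReal) * (c' * (μ (ball y (Real.sqrt t))).toReal) := by
          gcongr
          · exact hvol x
          · exact hvol y
      _ = _ := by ring
  have hexp : Real.exp (-b₁ * dist x y ^ 2 / t) ≤ Real.exp (-b₀ * dist x y ^ 2 / s) := by
    rw [Real.exp_le_exp, div_le_div_iff₀ ht hs]
    have h6 : b₀ * t ≤ b₁ * s := by nlinarith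
    nlinarith [mul_le_mul_of_nonneg_left h6 (sq_nonneg (dist x y))]
  have hl := hlower s x y hs
  have hu := hupper t x y ht
  rw [← hVs] at hl
  rw [← hVt] at hu
  have hl' : Real.exp (-b₀ * dist x y ^ 2 / s) ≤ C₀ * (H s x y * Vs) := by
    rwa [inv_mul_le_iff₀ hC₀] at hl
  have hfinal : H t x y * Vt ≤ (C₀ * C₀ * c' * H s x y) * Vt := by
    calc H t x y * Vt ≤ C₀ * (C₀ * (H s x y * Vs)) := by
          refine hu.trans (mul_le_mul_of_nonneg_left (hexp.trans hl') hC₀.le)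
      _ ≤ C₀ * (C₀ * (H s x y * (c' * Vt))) := by
          have := hHnonneg s x y hs
          gcongr
      _ = _ := by ring
  have := le_of_mul_le_mul_right hfinal hVt0
  unfold kH
  rw [← ENNReal.ofReal_mul (by positivity)]
  exact ENNReal.ofReal_le_ofReal this

lemma sigmaFin (μ : Measure M) (H : ℝ → M → M → ℝ) (C₀ b₀ : ℝ) (hC₀ : 0 < C₀)
    (hlower : ∀ t x y, 0 < t →
      C₀⁻¹ * Real.exp (-b₀ * dist x y ^ 2 / t) ≤
        H t x y *
          Real.sqrt
            ((μ (ball x (Real.sqrt t))).toReal * (μ (ball y (Real.sqrt t))).toReal)) : SigmaFinite μ := by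
  rcases isEmpty_or_nonempty M with h | ⟨⟨x⟩⟩
  · rw [Measure.eq_zero_of_isEmpty μ]; infer_instance
  · refine ⟨⟨⟨fun n => ball x (Real.sqrt (n+1)), fun _ => trivial, fun n => ?_, ?_⟩⟩⟩
    · have := vol_pos μ H C₀ b₀ hC₀ hlower (n+1) (by positivity) x
      rw [lt_top_iff_ne_top]
      intro h; rw [h] at this; simp at this
    · rw [eq_univ_iff_forall]
      intro y
      obtain ⟨n, hn⟩ := exists_nat_gt (dist y x ^ 2)
      refine mem_iUnion.2 ⟨n, ?_⟩
      rw [mem_ball]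
      exact Real.lt_sqrt_of_sq_lt (by linarith)

lemma ckE (μ : Measure M) (H : ℝ → M → M → ℝ) (C₀ b₀ : ℝ) (hC₀ : 0 < C₀)
    (hHnonneg : ∀ t x y, 0 < t → 0 ≤ H t x y)
    (hck : ∀ s t x y, 0 < s → 0 < t →
      ∫ z, H s x z * H t z y ∂μ = H (s + t) x y)
    (hlower : ∀ t x y, 0 < t →
      C₀⁻¹ * Real.exp (-b₀ * dist x y ^ 2 / t) ≤
        H t x y *
          Real.sqrt
            ((μ (ball x (Real.sqrt t))).toReal * (μ (ball y (Real.sqrt t))).toReal)) :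
    ∀ s t x y, 0 < s → 0 < t → ∫⁻ z, kH H s x z * kH H t z y ∂μ = kH H (s+t) x y := by
  intro s t x y hs ht
  have h0 : H (s+t) x y ≠ 0 := by
    intro h
    have := hlower (s+t) x y (by positivity)
    rw [h, zero_mul] at this
    have h1 : 0 < C₀⁻¹ * Real.exp (-b₀ * dist x y ^ 2 / (s+t)) := by positivity
    linarith
  have hint : Integrable (fun z => H s x z * H t z y) μ := by
    by_contra hn
    have := hck s t x y hs ht
    rw [integral_undef hn] at this
    exact h0 this.symm
  unfold kH
  rw [← hck s t x y hs ht, ofReal_integral_eq_lintegral_ofReal hint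
    (Filter.Eventually.of_forall fun z => mul_nonneg (hHnonneg s x z hs) (hHnonneg t z y ht))]
  exact lintegral_congr fun z => (ENNReal.ofReal_mul (hHnonneg s x z hs)).symm
end geo

section fin

lemma qIntNorm_scale {q : ENNReal} {A : ENNReal} (hA : A ≠ ⊤) {g S : ℝ → ENNReal}
    (h : ∀ t, 0 < t → g t ≤ A * S t) (hq : 1 ≤ q) : qIntNorm q g ≤ A * qIntNorm q S := by
  unfold qIntNorm
  split_ifs with hqt
  · refine iSup₂_le fun t ht => (h t ht).trans (mul_le_mul_right ?_ _)
    exact le_iSup₂ (f := fun (t : ℝ) (_ : t ∈ Ioi (0:ℝ)) => S t) t ht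
  · have hq0 : 0 < q.toReal := ENNReal.toReal_pos (zero_lt_one.trans_le hq).ne' hqt
    have : ∫⁻ t in Ioi (0 : ℝ), g t ^ q.toReal * ENNReal.ofReal t⁻¹ ≤
        A ^ q.toReal * ∫⁻ t in Ioi (0 : ℝ), S t ^ q.toReal * ENNReal.ofReal t⁻¹ := by
      rw [← lintegral_const_mul' _ _ (ENNReal.rpow_ne_top_of_nonneg hq0.le hA)]
      refine setLIntegral_mono' measurableSet_Ioi fun t ht => ?_
      rw [← mul_assoc, ← ENNReal.mul_rpow_of_nonneg _ _ hq0.le]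
      gcongr
      exact h t ht
    calc _ ≤ (A ^ q.toReal * ∫⁻ t in Ioi (0 : ℝ), S t ^ q.toReal * ENNReal.ofReal t⁻¹) ^ (1/q.toReal) := by
          gcongr
      _ = _ := by
        rw [ENNReal.mul_rpow_of_nonneg _ _ (by positivity), ← ENNReal.rpow_mul, mul_one_div, div_self hq0.ne', ENNReal.rpow_one]

lemma mixed_scale (μ : Measure M) {p : ℝ} (hp : 1 < p) {q : ENNReal} (hq : 1 ≤ q) {A : ENNReal} (hA : A ≠ ⊤)
    {g S : ℝ → M → ENNReal} (h : ∀ t x, 0 < t → g t x ≤ A * S t x) :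
    (∫⁻ x, qIntNorm q (fun t => g t x) ^ p ∂μ) ^ (1/p) ≤ A * (∫⁻ x, qIntNorm q (fun t => S t x) ^ p ∂μ) ^ (1/p) := by
  have hp0 : 0 < p := by linarith
  calc _ ≤ (A ^ p * ∫⁻ x, qIntNorm q (fun t => S t x) ^ p ∂μ) ^ (1/p) := by
        rw [← lintegral_const_mul' _ _ (ENNReal.rpow_ne_top_of_nonneg hp0.le hA)]
        gcongr with x
        rw [← ENNReal.mul_rpow_of_nonneg _ _ hp0.le]
        gcongr
        exact qIntNorm_scale hA (fun t ht => h t x ht) hq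
    _ = _ := by
        rw [ENNReal.mul_rpow_of_nonneg _ _ (by positivity), ← ENNReal.rpow_mul, mul_one_div, div_self hp0.ne', ENNReal.rpow_one]

noncomputable def KK (μ : Measure M) (H : ℝ → M → M → ℝ) (t : ℝ) (f : M → ENNReal) (x : M) : ENNReal :=
  if t = 0 then f x else Pop μ (kH H t) f x

lemma Tt_le (μ : Measure M) (H : ℝ → M → M → ℝ) (hHnonneg : ∀ t x y, 0 < t → 0 ≤ H t x y) {t : ℝ} (ht : 0 ≤ t)
    (f : M → ℝ) (x : M) :
    ENNReal.ofReal (Tt μ H t (fun y => |f y|) x) ≤ KK μ H t (fun y => ENNReal.ofReal |f y|) x := by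
  unfold Tt KK
  split_ifs with h
  · exact le_rfl
  · have ht0 : 0 < t := lt_of_le_of_ne ht (Ne.symm h)
    by_cases hi : Integrable (fun y => H t x y * |f y|) μ
    · rw [ofReal_integral_eq_lintegral_ofReal hi (Filter.Eventually.of_forall fun y => mul_nonneg (hHnonneg t x y ht0) (abs_nonneg _))]
      refine lintegral_mono fun y => ?_
      rw [ENNReal.ofReal_mul (hHnonneg t x y ht0)]; rfl
    · rw [integral_undef hi]; simp

lemma Tt_nonneg (μ : Measure M) (H : ℝ → M → M → ℝ) (hHnonneg : ∀ t x y, 0 < t → 0 ≤ H t x y) {t : ℝ} (ht : 0 ≤ t)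
    (f : M → ℝ) (x : M) : 0 ≤ Tt μ H t (fun y => |f y|) x := by
  unfold Tt
  split_ifs with h
  · exact abs_nonneg _
  · have ht0 : 0 < t := lt_of_le_of_ne ht (Ne.symm h)
    exact integral_nonneg fun y => mul_nonneg (hHnonneg t x y ht0) (abs_nonneg _)

lemma KK_meas {μ : Measure M} [SFinite μ] {H : ℝ → M → M → ℝ} (hH : Measurable fun p : ℝ × M × M => H p.1 p.2.1 p.2.2)
    (t : ℝ) {f : M → ENNReal} (hf : Measurable f) : Measurable (KK μ H t f) := by
  by_cases h : t = 0
  · have : KK μ H t f = f := by ext x; simp [KK, h]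
    rwa [this]
  · have : KK μ H t f = Pop μ (kH H t) f := by ext x; simp [KK, h]
    rw [this]; exact Pop_meas (kH_meas hH t) hf

lemma KK_mono {μ : Measure M} {H : ℝ → M → M → ℝ} [SFinite μ]
    (t : ℝ) {f g : M → ENNReal} (hfg : ∀ x, f x ≤ g x) (x : M) : KK μ H t f x ≤ KK μ H t g x := by
  unfold KK
  split_ifs
  · exact hfg x
  · exact Pop_mono hfg x

lemma KK_const_mul {μ : Measure M} [SFinite μ] {H : ℝ → M → M → ℝ} (hH : Measurable fun p : ℝ × M × M => H p.1 p.2.1 p.2.2)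
    (t : ℝ) {f : M → ENNReal} (hf : Measurable f) (A : ENNReal) (x : M) :
    KK μ H t (fun y => A * f y) x = A * KK μ H t f x := by
  unfold KK
  split_ifs
  · rfl
  · unfold Pop
    rw [← lintegral_const_mul _ (kf_meas (kH_meas hH t) hf x)]
    exact lintegral_congr fun y => by ring

lemma KK_comp {μ : Measure M} [SFinite μ] {H : ℝ → M → M → ℝ} (hH : Measurable fun p : ℝ × M × M => H p.1 p.2.1 p.2.2)
    (hck : ∀ s t x y, 0 < s → 0 < t → ∫⁻ z, kH H s x z * kH H t z y ∂μ = kH H (s+t) x y)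
    {s t : ℝ} (hs : 0 ≤ s) (ht : 0 ≤ t) {f : M → ENNReal} (hf : Measurable f) (x : M) :
    KK μ H s (KK μ H t f) x = KK μ H (s+t) f x := by
  rcases hs.eq_or_lt with rfl | hs
  · simp [KK]
  rcases ht.eq_or_lt with rfl | ht
  · have : KK μ H 0 f = f := by ext x; simp [KK]
    rw [this, add_zero]
  have h1 : KK μ H t f = Pop μ (kH H t) f := by ext x; simp [KK, ht.ne']
  rw [h1]
  unfold KK
  rw [if_neg hs.ne', if_neg (by positivity), Pop_comp hH hck hs ht hf]

lemma sup_rat {φ : ℝ → ENNReal} (hφ : ContinuousOn φ (Ioi 0)) :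
    ⨆ t ∈ Ioi (0:ℝ), φ t = ⨆ r : {r : ℚ // 0 < r}, φ (r : ℚ) := by
  apply le_antisymm
  · refine iSup₂_le fun t ht => ?_
    by_contra hlt
    rw [not_le] at hlt
    have hc : ContinuousAt φ t := hφ.continuousAt (Ioi_mem_nhds ht)
    have h1 : ∀ᶠ s in nhds t, (⨆ r : {r : ℚ // 0 < r}, φ (r : ℚ)) < φ s ∧ 0 < s :=
      (hc.eventually (lt_mem_nhds hlt)).and (lt_mem_nhds ht)
    obtain ⟨U, hU, hUo, htU⟩ := _root_.mem_nhds_iff.1 h1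
    obtain ⟨r, hr⟩ := (Rat.denseRange_cast (𝕜 := ℝ)).exists_mem_open hUo ⟨t, htU⟩
    have h2 := hU hr
    have h3 : (0:ℚ) < r := by exact_mod_cast h2.2
    exact absurd h2.1 (not_lt.2 (le_iSup (fun r : {r : ℚ // 0 < r} => φ (r : ℚ)) ⟨r, h3⟩))
  · refine iSup_le fun r => ?_
    have : ((r : ℚ) : ℝ) ∈ Ioi (0:ℝ) := by
      have := r.2
      simp only [mem_Ioi]; exact_mod_cast this
    exact le_iSup₂ (f := fun (t : ℝ) (_ : t ∈ Ioi (0:ℝ)) => φ t) _ this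

lemma core (μ : Measure M) [SigmaFinite μ] {H : ℝ → M → M → ℝ}
    (hH : Measurable fun p : ℝ × M × M => H p.1 p.2.1 p.2.2)
    (hsymm : ∀ t x y, 0 < t → kH H t x y = kH H t y x)
    (hrow : ∀ t x, 0 < t → ∫⁻ y, kH H t x y ∂μ = 1)
    {Mx : (M → ENNReal) → M → ENNReal} (hMm : ∀ f, Measurable f → Measurable (Mx f))
    (hMle : ∀ t f x, 0 < t → Measurable f → Pop μ (kH H t) f x ≤ Mx f x)
    (hMr : ∀ r : ℝ, 1 < r → ∃ C : ENNReal, C ≠ ⊤ ∧ ∀ f, Measurable f → ∫⁻ x, Mx f x ^ r ∂μ ≤ C * ∫⁻ x, f x ^ r ∂μ)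
    {p : ℝ} (hp : 1 < p) {q : ENNReal} (hq : 1 ≤ q) {a : ℝ} (ha : 0 < a) :
    ∃ C : ENNReal, C ≠ ⊤ ∧ ∀ F : ℝ → M → ENNReal, Measurable (fun z : ℝ × M => F z.1 z.2) →
      (∀ x, ContinuousOn (fun t => F t x) (Ioi 0)) →
      ∫⁻ x, qIntNorm q (fun t => Pop μ (kH H (a * t)) (F t) x) ^ p ∂μ ≤
        C * ∫⁻ x, qIntNorm q (fun t => F t x) ^ p ∂μ := by
  have hp0 : 0 < p := by linarith
  by_cases hqt : q = ⊤
  · obtain ⟨C, hC, h⟩ := hMr p hp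
    refine ⟨C, hC, fun F hF hFc => ?_⟩
    simp only [qIntNorm, if_pos hqt]
    set N : M → ENNReal := fun x => ⨆ t ∈ Ioi (0:ℝ), F t x with hN
    have hNm : Measurable N := by
      have : N = fun x => ⨆ r : {r : ℚ // 0 < r}, F (r : ℚ) x := by
        ext x; exact sup_rat (hFc x)
      rw [this]
      exact Measurable.iSup fun r => F_meas hF _
    refine le_trans ?_ (h N hNm)
    gcongr with x
    refine iSup₂_le fun t ht => ?_
    refine le_trans (Pop_mono (fun y => ?_) x) (hMle (a * t) N x (mul_pos ha ht) hNm)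
    exact le_iSup₂ (f := fun (t : ℝ) (_ : t ∈ Ioi (0:ℝ)) => F t y) t ht
  set s := q.toReal with hs
  have hs1 : 1 ≤ s := by
    rw [hs, ← ENNReal.toReal_one]; exact ENNReal.toReal_mono hqt hq
  have hs0 : 0 < s := by linarith
  set τ : ℝ → ℝ := fun t => if 0 < t then a * t else 1 with hτ
  have hτ0 : ∀ t, 0 < τ t := by
    intro t; simp only [hτ]; split_ifs with h
    · positivity
    · exact one_pos
  have hτm : Measurable τ := Measurable.ite measurableSet_Ioi (measurable_id.const_mul a) measurable_const
  set L : ℝ → M → M → ENNReal := fun t => kH H (τ t) with hLdef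
  have hL : Measurable (fun z : (ℝ × M) × M => L z.1.1 z.1.2 z.2) :=
    ENNReal.measurable_ofReal.comp (hH.comp ((hτm.comp (measurable_fst.comp measurable_fst)).prodMk
      ((measurable_snd.comp measurable_fst).prodMk measurable_snd)))
  set ν : Measure ℝ := (volume.restrict (Ioi (0:ℝ))).withDensity (fun t => ENNReal.ofReal t⁻¹) with hν
  have hwm : Measurable (fun t : ℝ => ENNReal.ofReal t⁻¹) := by fun_prop
  have hνint : ∀ g g' : ℝ → ENNReal, Measurable g → (∀ t, 0 < t → g t = g' t) →
      ∫⁻ t, g t ^ s ∂ν = ∫⁻ t in Ioi (0:ℝ), g' t ^ s * ENNReal.ofReal t⁻¹ := by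
    intro g g' hg hgg
    rw [hν, lintegral_withDensity_eq_lintegral_mul _ hwm (hg.pow_const s)]
    refine setLIntegral_congr_fun measurableSet_Ioi fun t ht => ?_
    simp only [Pi.mul_apply]
    rw [hgg t ht, mul_comm]
  have hT : ∃ C : ENNReal, C ≠ ⊤ ∧ ∀ F : ℝ → M → ENNReal, Measurable (fun z : ℝ × M => F z.1 z.2) →
      (∀ x, ∫⁻ t, F t x ^ s ∂ν = 0 → ∀ t, F t x = 0) →
      ∫⁻ x, (∫⁻ t, Pop μ (L t) (F t) x ^ s ∂ν) ^ (p/s) ∂μ ≤ C * ∫⁻ x, (∫⁻ t, F t x ^ s ∂ν) ^ (p/s) ∂μ := by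
    rcases le_or_gt s p with hsp | hsp
    · obtain ⟨C, hC, h⟩ := T2a (μ := μ) (ν := ν) hL (fun t x y => hsymm _ x y (hτ0 t)) (fun t x => hrow _ x (hτ0 t))
        hMm (fun t f x hf => hMle _ f x (hτ0 t) hf) hMr p s hs1 hsp
      exact ⟨C, hC, fun F hF _ => h F hF⟩
    · exact T2b (μ := μ) (ν := ν) hL (fun t x y => hsymm _ x y (hτ0 t)) (fun t x => hrow _ x (hτ0 t))
        hMm (fun t f x hf => hMle _ f x (hτ0 t) hf) hMr p s hp hsp
  obtain ⟨C, hC, h⟩ := hT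
  refine ⟨C, hC, fun F hF hFc => ?_⟩
  set F' : ℝ → M → ENNReal := fun t x => if 0 < t then F t x else 0 with hF'
  have hF'm : Measurable (fun z : ℝ × M => F' z.1 z.2) :=
    Measurable.ite (measurableSet_lt measurable_const measurable_fst) hF measurable_const
  have e1 : ∀ x, ∫⁻ t, F' t x ^ s ∂ν = ∫⁻ t in Ioi (0:ℝ), F t x ^ s * ENNReal.ofReal t⁻¹ := fun x =>
    hνint _ _ (hF'm.comp (measurable_prodMk_right (y := x))) (fun t ht => by simp [hF', ht])
  have e2 : ∀ x, ∫⁻ t, Pop μ (L t) (F' t) x ^ s ∂ν = ∫⁻ t in Ioi (0:ℝ), Pop μ (kH H (a*t)) (F t) x ^ s * ENNReal.ofReal t⁻¹ := fun x =>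
    hνint _ _ ((PopL_meas hL hF'm).comp (measurable_prodMk_right (y := x)))
      (fun t ht => by simp [hF', hLdef, hτ, ht])
  have hz : ∀ x, ∫⁻ t, F' t x ^ s ∂ν = 0 → ∀ t, F' t x = 0 := by
    intro x hx t
    by_cases ht : 0 < t
    swap
    · simp [hF', ht]
    rw [e1 x] at hx
    have hmx : Measurable (fun t => F t x ^ s * ENNReal.ofReal t⁻¹) :=
      ((hF.comp (measurable_prodMk_right (y := x))).pow_const s).mul hwm
    rw [lintegral_eq_zero_iff hmx] at hx
    have hae : (fun t => F t x) =ᵐ[volume.restrict (Ioi (0:ℝ))] fun _ => 0 := by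
      filter_upwards [hx, ae_restrict_mem measurableSet_Ioi] with u hu hu0
      have hu0' : (0:ℝ) < u := hu0
      simp only [Pi.zero_apply, mul_eq_zero] at hu
      rcases hu with hu | hu
      · exact (ENNReal.rpow_eq_zero_iff_of_pos hs0).1 hu
      · rw [ENNReal.ofReal_eq_zero] at hu
        have : 0 < u⁻¹ := by positivity
        linarith
    have := Measure.eqOn_open_of_ae_eq hae isOpen_Ioi (hFc x) continuousOn_const
    simpa [hF', ht] using this ht
  have hfin := h F' hF'm hz
  simp_rw [e1, e2] at hfin
  simp only [qIntNorm, if_neg hqt, ← ENNReal.rpow_mul]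
  rw [one_div_mul_eq_div]
  exact hfin

end fin

/-- Proposition `CRTNintegrale` of the paper: under the standing kernel assumptions, for
`p ∈ (1,∞)`, `q ∈ [1,∞]`, `c > 0`, `δ, ε ≥ 0` and `C₁, C₂ > 0`, there is `C > 0` such that
whenever `F, F₁, F₂` satisfy (1) `T_{ct}|F(t,·)| ≤ C₁ T_{δs}|F₁(s,·)|` for `t ∈ [s,2s]` and
(2) `|F₁(t,·)| ≤ C₂ T_{εs}|F₂(s,·)|` for `t ∈ [s/2,s]`, one has
`‖T_{ct}|F(t,·)|‖_{L^p(L^q_+)} ≤ C ‖F₂‖_{L^p(L^q_+)}`. -/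
theorem stmt_14 (μ : Measure M)
    (c₀ D : ℝ) (hc₀ : 0 < c₀) (hD : 0 < D)
    (hdoub : ∀ (x : M) (r R : ℝ), 0 < r → 1 ≤ R →
      μ (ball x (R * r)) ≤ ENNReal.ofReal (c₀ * R ^ D) * μ (ball x r))
    (H : ℝ → M → M → ℝ)
    (hHmeas : Measurable fun p : ℝ × M × M => H p.1 p.2.1 p.2.2)
    (hHnonneg : ∀ t x y, 0 < t → 0 ≤ H t x y)
    (hHsymm : ∀ t x y, 0 < t → H t x y = H t y x)
    (hmarkov : ∀ t x, 0 < t → ∫⁻ y, ENNReal.ofReal (H t x y) ∂μ = 1)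
    (hck : ∀ s t x y, 0 < s → 0 < t →
      ∫ z, H s x z * H t z y ∂μ = H (s + t) x y)
    (C₀ b₀ b₁ : ℝ) (hC₀ : 0 < C₀) (hb₀ : 0 < b₀) (hb₁ : 0 < b₁)
    (hlower : ∀ t x y, 0 < t →
      C₀⁻¹ * Real.exp (-b₀ * dist x y ^ 2 / t) ≤
        H t x y *
          Real.sqrt
            ((μ (ball x (Real.sqrt t))).toReal * (μ (ball y (Real.sqrt t))).toReal))
    (hupper : ∀ t x y, 0 < t →
      H t x y *
          Real.sqrt
            ((μ (ball x (Real.sqrt t))).toReal * (μ (ball y (Real.sqrt t))).toReal) ≤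
        C₀ * Real.exp (-b₁ * dist x y ^ 2 / t))
    (p : ℝ) (hp1 : 1 < p) (q : ENNReal) (hq : 1 ≤ q) (c : ℝ) (hc : 0 < c)
    (δ ε : ℝ) (hδ : 0 ≤ δ) (hε : 0 ≤ ε) (C₁ C₂ : ℝ) (hC₁ : 0 < C₁) (hC₂ : 0 < C₂) :
    ∃ C : ℝ, 0 < C ∧
      ∀ F F₁ F₂ : ℝ → M → ℝ,
        Measurable (fun z : ℝ × M => F z.1 z.2) →
        Measurable (fun z : ℝ × M => F₁ z.1 z.2) →
        Measurable (fun z : ℝ × M => F₂ z.1 z.2) →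
        (∀ x, ContinuousOn (fun t => F₁ t x) (Ici 0)) →
        (∀ x, ContinuousOn (fun t => F₂ t x) (Ici 0)) →
        (∀ s t x, 0 < s → t ∈ Icc s (2 * s) →
          Tt μ H (c * t) (fun y => |F t y|) x ≤ C₁ * Tt μ H (δ * s) (fun y => |F₁ s y|) x) →
        (∀ s t x, 0 < s → t ∈ Icc (s / 2) s →
          |F₁ t x| ≤ C₂ * Tt μ H (ε * s) (fun y => |F₂ s y|) x) →
        LpLqNorm μ p q (fun t x => Tt μ H (c * t) (fun y => |F t y|) x) ≤
          ENNReal.ofReal C * LpLqNorm μ p q F₂ := by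
  haveI : SigmaFinite μ := sigmaFin μ H C₀ b₀ hC₀ hlower
  obtain ⟨κ, hκ, Cc, hCc, hcomp⟩ := compare μ c₀ D hc₀ hD hdoub H hHnonneg C₀ b₀ b₁ hC₀ hb₁ hlower hupper
  have hckE := ckE μ H C₀ b₀ hC₀ hHnonneg hck hlower
  have hsymm : ∀ t x y, 0 < t → kH H t x y = kH H t y x := fun t x y ht => by
    unfold kH; rw [hHsymm t x y ht]
  have hrow : ∀ t x, 0 < t → ∫⁻ y, kH H t x y ∂μ = 1 := hmarkov
  obtain ⟨Mx, hMm, -, hMle, hMr⟩ := exists_max hHmeas hsymm hrow hckE hκ hCc hcomp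
  set a := δ + ε with ha
  have ha0 : 0 ≤ a := by positivity
  set A := ENNReal.ofReal C₁ * ENNReal.ofReal C₂ with hA
  have hAt : A ≠ ⊤ := ENNReal.mul_ne_top ENNReal.ofReal_ne_top ENNReal.ofReal_ne_top
  have hp0 : 0 < p := by linarith
  -- the pointwise bound
  have hpt : ∀ F F₁ F₂ : ℝ → M → ℝ,
        Measurable (fun z : ℝ × M => F₂ z.1 z.2) →
        (∀ s t x, 0 < s → t ∈ Icc s (2 * s) →
          Tt μ H (c * t) (fun y => |F t y|) x ≤ C₁ * Tt μ H (δ * s) (fun y => |F₁ s y|) x) →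
        (∀ s t x, 0 < s → t ∈ Icc (s / 2) s →
          |F₁ t x| ≤ C₂ * Tt μ H (ε * s) (fun y => |F₂ s y|) x) →
        ∀ t x, 0 < t → ENNReal.ofReal |Tt μ H (c * t) (fun y => |F t y|) x| ≤
          A * KK μ H (a * t) (fun y => ENNReal.ofReal |F₂ t y|) x := by
    intro F F₁ F₂ hF₂ h1 h2 t x ht
    have hf2 : Measurable (fun y => ENNReal.ofReal |F₂ t y|) := by
      have : Measurable (F₂ t) := hF₂.comp (measurable_prodMk_left (x := t))
      exact ENNReal.measurable_ofReal.comp (measurable_norm.comp this)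
    rw [abs_of_nonneg (Tt_nonneg μ H hHnonneg (by positivity) _ _)]
    have hb : ∀ y, ENNReal.ofReal |F₁ t y| ≤ ENNReal.ofReal C₂ * KK μ H (ε * t) (fun y => ENNReal.ofReal |F₂ t y|) y := by
      intro y
      refine (ENNReal.ofReal_le_ofReal (h2 t t y ht ⟨by linarith, le_rfl⟩)).trans ?_
      rw [ENNReal.ofReal_mul hC₂.le]
      exact mul_le_mul_right (Tt_le μ H hHnonneg (by positivity) _ _) _
    calc _ ≤ ENNReal.ofReal (C₁ * Tt μ H (δ * t) (fun y => |F₁ t y|) x) :=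
          ENNReal.ofReal_le_ofReal (h1 t t x ht ⟨le_rfl, by linarith⟩)
      _ ≤ ENNReal.ofReal C₁ * KK μ H (δ * t) (fun y => ENNReal.ofReal |F₁ t y|) x := by
          rw [ENNReal.ofReal_mul hC₁.le]
          exact mul_le_mul_right (Tt_le μ H hHnonneg (by positivity) _ _) _
      _ ≤ ENNReal.ofReal C₁ * KK μ H (δ * t) (fun y => ENNReal.ofReal C₂ * KK μ H (ε * t) (fun y => ENNReal.ofReal |F₂ t y|) y) x :=
          mul_le_mul_right (KK_mono _ hb x) _
      _ = _ := by
          rw [KK_const_mul hHmeas _ (KK_meas hHmeas _ hf2), KK_comp hHmeas hckE (by positivity) (by positivity) hf2,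
            ← mul_assoc, ← add_mul]
  have hfinal : ∃ Ct : ENNReal, Ct ≠ ⊤ ∧ ∀ F F₁ F₂ : ℝ → M → ℝ,
        Measurable (fun z : ℝ × M => F₂ z.1 z.2) →
        (∀ x, ContinuousOn (fun t => F₂ t x) (Ici 0)) →
        (∀ s t x, 0 < s → t ∈ Icc s (2 * s) →
          Tt μ H (c * t) (fun y => |F t y|) x ≤ C₁ * Tt μ H (δ * s) (fun y => |F₁ s y|) x) →
        (∀ s t x, 0 < s → t ∈ Icc (s / 2) s →
          |F₁ t x| ≤ C₂ * Tt μ H (ε * s) (fun y => |F₂ s y|) x) →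
        LpLqNorm μ p q (fun t x => Tt μ H (c * t) (fun y => |F t y|) x) ≤ Ct * LpLqNorm μ p q F₂ := by
    rcases ha0.eq_or_lt with h0 | hapos
    · refine ⟨A, hAt, fun F F₁ F₂ hF₂ _ h1 h2 => ?_⟩
      refine mixed_scale μ hp1 hq hAt fun t x ht => ?_
      have := hpt F F₁ F₂ hF₂ h1 h2 t x ht
      rw [← h0] at this
      simpa [KK] using this
    · obtain ⟨C, hC, h⟩ := core μ hHmeas hsymm hrow hMm hMle hMr hp1 hq hapos
      refine ⟨A * C ^ (1/p), ENNReal.mul_ne_top hAt (ENNReal.rpow_ne_top_of_nonneg (by positivity) hC),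
        fun F F₁ F₂ hF₂ hc2 h1 h2 => ?_⟩
      have hs := mixed_scale μ hp1 hq hAt (g := fun t x => ENNReal.ofReal |Tt μ H (c * t) (fun y => |F t y|) x|)
        (S := fun t x => Pop μ (kH H (a * t)) (fun y => ENNReal.ofReal |F₂ t y|) x) (fun t x ht => by
          have := hpt F F₁ F₂ hF₂ h1 h2 t x ht
          simpa [KK, hapos.ne', ht.ne'] using this)
      refine hs.trans ?_
      rw [mul_assoc A (C ^ (1/p))]
      refine mul_le_mul' (le_refl A) ?_
      unfold LpLqNorm
      rw [← ENNReal.mul_rpow_of_nonneg _ _ (by positivity)]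
      refine ENNReal.rpow_le_rpow ?_ (by positivity)
      refine h (fun t x => ENNReal.ofReal |F₂ t x|) (ENNReal.measurable_ofReal.comp (measurable_norm.comp hF₂)) fun x => ?_
      exact ENNReal.continuous_ofReal.comp_continuousOn (((hc2 x).mono Ioi_subset_Ici_self).abs)
  obtain ⟨Ct, hCt, h⟩ := hfinal
  refine ⟨Ct.toReal + 1, by positivity, fun F F₁ F₂ _ _ hF₂ _ hc2 h1 h2 => (h F F₁ F₂ hF₂ hc2 h1 h2).trans ?_⟩
  refine mul_le_mul' ?_ le_rfl
  calc Ct = ENNReal.ofReal Ct.toReal := (ENNReal.ofReal_toReal hCt).symm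
    _ ≤ _ := ENNReal.ofReal_le_ofReal (by linarith)
end
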